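/- arXiv:1412.2654 — 2 statements merged into one kernel-verified Lean document; each statement's English description precedes it below -/
import Mathlib

section
/- Let R be a Cohen-Macaulay commutative noetherian ring with a dualizing module D. If G is a Gorenstein injective R-module and E is any injective R-module, then the module Tor_k^R(Hom_R(D,E), G) is Gorenstein injective for all k ≥ 0. -/
/-!
Common definitions: property t(p), injective hulls, (C-)Gorenstein injective modules,
(C-)Gorenstein injective / injective / flat dimensions, small support, torsion functor,
Tor and Ext modules, semidualizing and dualizing modules, depth, Cohen-Macaulay rings,
Serre's condition (S₁), Gorenstein local rings, minimal injective resolutions.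
-/

universe u

open CategoryTheory Limits DirectSum

noncomputable section

/-- An `R`-module `S` has property `t(p)`: multiplication by every `r ∉ p` is bijective on `S`,
and every element of `S` is annihilated by a power of `p`. -/
def PropT (R : Type u) [CommRing R] (p : Ideal R) (S : Type u) [AddCommGroup S]
    [Module R S] : Prop :=
  (∀ r : R, r ∉ p → Function.Bijective (fun s : S => r • s)) ∧
  (∀ x : S, ∃ m : ℕ, 0 < m ∧ ∀ a ∈ p ^ m, a • x = 0)

/-- `E` is an injective hull of `N` over `R`: `E` is injective and `N` embeds in `E` as an
essential submodule. -/
def IsInjectiveHull (R : Type u) [CommRing R] (N : Type u) [AddCommGroup N] [Module R N]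
    (E : Type u) [AddCommGroup E] [Module R E] : Prop :=
  Module.Injective R E ∧ ∃ ι : N →ₗ[R] E, Function.Injective ι ∧
    ∀ K : Submodule R E, K ≠ ⊥ → K ⊓ LinearMap.range ι ≠ ⊥

/-- A complete injective resolution: a doubly infinite exact sequence of injective modules
which stays exact after applying `Hom_R(-, I)` for every injective module `I`. -/
structure CompleteInjRes (R : Type u) [CommRing R] where
  E : ℤ → Type u
  [acg : ∀ i, AddCommGroup (E i)]
  [mod : ∀ i, Module R (E i)]
  d : ∀ i, E i →ₗ[R] E (i + 1)
  inj : ∀ i, Module.Injective R (E i)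
  exct : ∀ i, LinearMap.range (d i) = LinearMap.ker (d (i + 1))
  homExact : ∀ (I : Type u) [AddCommGroup I] [Module R I], Module.Injective R I →
    ∀ (i : ℤ) (g : E (i + 1) →ₗ[R] I), g ∘ₗ d i = 0 →
      ∃ h : E (i + 1 + 1) →ₗ[R] I, h ∘ₗ d (i + 1) = g

attribute [instance] CompleteInjRes.acg CompleteInjRes.mod

/-- `G` is a Gorenstein injective `R`-module: it is the image of some map in a complete
injective resolution. -/
def GorensteinInjective (R : Type u) [CommRing R] (G : Type u) [AddCommGroup G]
    [Module R G] : Prop :=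
  ∃ X : CompleteInjRes R, Nonempty (G ≃ₗ[R] LinearMap.range (X.d 0))

/-- A complete `I_C I`-resolution: an exact sequence
`⋯ → Hom(C,I₁) → Hom(C,I₀) → I⁰ → I¹ → ⋯` (terms in nonnegative degrees are injective,
terms in negative degrees are of the form `Hom_R(C, I)` with `I` injective) such that
`Hom_R(Hom_R(C,J), -)` leaves it exact for every injective `R`-module `J`. -/
structure CompleteICIRes (R : Type u) [CommRing R] (C : Type u) [AddCommGroup C]
    [Module R C] where
  X : ℤ → Type u
  [acg : ∀ i, AddCommGroup (X i)]
  [mod : ∀ i, Module R (X i)]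
  d : ∀ i, X i →ₗ[R] X (i + 1)
  exct : ∀ i, LinearMap.range (d i) = LinearMap.ker (d (i + 1))
  injPos : ∀ i : ℤ, 0 ≤ i → Module.Injective R (X i)
  homCInjNeg : ∀ i : ℤ, i < 0 → ∃ (I : Type u) (_ : AddCommGroup I) (_ : Module R I),
    Module.Injective R I ∧ Nonempty (X i ≃ₗ[R] (C →ₗ[R] I))
  homExact : ∀ (J : Type u) [AddCommGroup J] [Module R J], Module.Injective R J →
    ∀ (i : ℤ) (g : (C →ₗ[R] J) →ₗ[R] X (i + 1)), d (i + 1) ∘ₗ g = 0 →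
      ∃ h : (C →ₗ[R] J) →ₗ[R] X i, d i ∘ₗ h = g

attribute [instance] CompleteICIRes.acg CompleteICIRes.mod

/-- `G` is a `C`-Gorenstein injective `R`-module: it is the image of the map
`Hom_R(C, I₀) → I⁰` in some complete `I_C I`-resolution. -/
def CGorensteinInjective (R : Type u) [CommRing R] (C : Type u) [AddCommGroup C] [Module R C]
    (G : Type u) [AddCommGroup G] [Module R G] : Prop :=
  ∃ X : CompleteICIRes R C, Nonempty (G ≃ₗ[R] LinearMap.range (X.d (-1)))

/-- `M` has a `C`-Gorenstein injective coresolution `0 → M → G⁰ → ⋯ → Gⁿ → 0`,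
i.e. `C`-Gorenstein injective dimension at most `n`. -/
def CGidLE (R : Type u) [CommRing R] (C : Type u) [AddCommGroup C] [Module R C] :
    ℕ → ModuleCat.{u} R → Prop
  | 0, M => CGorensteinInjective R C M
  | n + 1, M => ∃ (G : ModuleCat.{u} R), CGorensteinInjective R C G ∧
      ∃ ι : M →ₗ[R] G, Function.Injective ι ∧
        CGidLE R C n (ModuleCat.of R (G ⧸ LinearMap.range ι))

/-- The `C`-Gorenstein injective dimension of `M` (equal to `⊤` if `M` admits no bounded
coresolution by `C`-Gorenstein injective modules). -/
def CGid (R : Type u) [CommRing R] (C : Type u) [AddCommGroup C] [Module R C]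
    (M : Type u) [AddCommGroup M] [Module R M] : ℕ∞ :=
  sInf {n : ℕ∞ | ∃ m : ℕ, (m : ℕ∞) = n ∧ CGidLE R C m (ModuleCat.of R M)}

/-- There exists an exact sequence `0 → N → Gₙ → ⋯ → G₁ → M → 0` in which each `Gᵢ` is
`C`-Gorenstein injective (and `N` is arbitrary). -/
def CGICoresApprox (R : Type u) [CommRing R] (C : Type u) [AddCommGroup C] [Module R C] :
    ℕ → ModuleCat.{u} R → Prop
  | 0, _ => True
  | n + 1, M => ∃ (G : ModuleCat.{u} R), CGorensteinInjective R C G ∧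
      ∃ π : G →ₗ[R] M, Function.Surjective π ∧
        CGICoresApprox R C n (ModuleCat.of R (LinearMap.ker π))

/-- The `a`-torsion submodule `Γ_a(N)` of `N`. -/
def torsionSubmodule (R : Type u) [CommRing R] (a : Ideal R) (N : Type u) [AddCommGroup N]
    [Module R N] : Submodule R N :=
  ⨆ m : ℕ, Submodule.torsionBySet R N ((a ^ m : Ideal R) : Set R)

/-- `Tor_i^R(M, N)`, as an object of `ModuleCat R`. -/
abbrev TorM (R : Type u) [CommRing R] (i : ℕ) (M N : Type u) [AddCommGroup M] [Module R M]
    [AddCommGroup N] [Module R N] : ModuleCat.{u} R :=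
  ((Tor (ModuleCat.{u} R) i).obj (ModuleCat.of R M)).obj (ModuleCat.of R N)

/-- `Ext_R^i(M, N)`, as an object of `ModuleCat R`. -/
abbrev ExtM (R : Type u) [CommRing R] (i : ℕ) (M N : Type u) [AddCommGroup M] [Module R M]
    [AddCommGroup N] [Module R N] : ModuleCat.{u} R :=
  ((Ext R (ModuleCat.{u} R) i).obj (Opposite.op (ModuleCat.of R M))).obj (ModuleCat.of R N)

/-- The small support of `M`: primes `p` such that `Tor_i^R(κ(p), M) ≠ 0` for some `i`,
where `κ(p)` is the residue field of `R_p`. -/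
def smallSupport (R : Type u) [CommRing R] (M : Type u) [AddCommGroup M] [Module R M] :
    Set (PrimeSpectrum R) :=
  {p | ∃ i : ℕ,
    Nontrivial (TorM R i (IsLocalRing.ResidueField (Localization.AtPrime p.asIdeal)) M)}

/-- `C` is a semidualizing `R`-module: finitely generated, the homothety map
`R → Hom_R(C,C)` is bijective, and `Ext_R^i(C,C) = 0` for `i ≥ 1`. -/
def IsSemidualizing (R : Type u) [CommRing R] (C : Type u) [AddCommGroup C] [Module R C] : Prop :=
  Module.Finite R C ∧
  Function.Bijective (fun r : R => (r • LinearMap.id : C →ₗ[R] C)) ∧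
  ∀ i : ℕ, 1 ≤ i → Subsingleton (ExtM R i C C)

/-- `M` has injective dimension at most `n`. -/
def InjDimLE (R : Type u) [CommRing R] : ℕ → ModuleCat.{u} R → Prop
  | 0, M => Module.Injective R M
  | n + 1, M => ∃ (I : ModuleCat.{u} R), Module.Injective R I ∧
      ∃ ι : M →ₗ[R] I, Function.Injective ι ∧
        InjDimLE R n (ModuleCat.of R (I ⧸ LinearMap.range ι))

/-- `M` has flat dimension at most `n`. -/
def FlatDimLE (R : Type u) [CommRing R] : ℕ → ModuleCat.{u} R → Prop
  | 0, M => Module.Flat R M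
  | n + 1, M => ∃ (F : ModuleCat.{u} R), Module.Flat R F ∧
      ∃ π : F →ₗ[R] M, Function.Surjective π ∧
        FlatDimLE R n (ModuleCat.of R (LinearMap.ker π))

/-- `D` is a dualizing `R`-module: semidualizing of finite injective dimension. -/
def IsDualizing (R : Type u) [CommRing R] (D : Type u) [AddCommGroup D] [Module R D] : Prop :=
  IsSemidualizing R D ∧ ∃ n : ℕ, InjDimLE R n (ModuleCat.of R D)

/-- The depth of a local ring: the supremum of lengths of regular sequences contained in
the maximal ideal. -/
def localRingDepth (A : Type u) [CommRing A] [IsLocalRing A] : ℕ∞ :=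
  sSup {n : ℕ∞ | ∃ rs : List A, (∀ r ∈ rs, r ∈ IsLocalRing.maximalIdeal A) ∧
    RingTheory.Sequence.IsRegular A rs ∧ (rs.length : ℕ∞) = n}

/-- `R` is a Cohen-Macaulay ring: for each prime `p`, `depth (R_p) = dim (R_p)`. -/
def IsCohenMacaulayRing (R : Type u) [CommRing R] : Prop :=
  ∀ (p : Ideal R) (_ : p.IsPrime),
    (localRingDepth (Localization.AtPrime p) : WithBot ℕ∞) =
      ringKrullDim (Localization.AtPrime p)

/-- Serre's condition `(S₁)`: `depth (R_p) ≥ min (ht p, 1)` for every prime `p`. -/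
def SerreS1 (R : Type u) [CommRing R] : Prop :=
  ∀ (p : Ideal R) (hp : p.IsPrime),
    min (Order.height (⟨p, hp⟩ : PrimeSpectrum R)) 1 ≤ localRingDepth (Localization.AtPrime p)

/-- A Gorenstein local ring: a noetherian local ring of finite self-injective dimension. -/
def IsGorensteinLocalRing (A : Type u) [CommRing A] : Prop :=
  IsLocalRing A ∧ IsNoetherianRing A ∧ ∃ n : ℕ, InjDimLE A n (ModuleCat.of A A)

/-- A minimal injective resolution `0 → D → J⁰ → J¹ → ⋯` of `D`: an exact sequence with all
`Jⁱ` injective, in which the kernel of each differential is an essential submodule. -/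
structure MinimalInjRes (R : Type u) [CommRing R] (D : Type u) [AddCommGroup D]
    [Module R D] where
  J : ℕ → Type u
  [acg : ∀ i, AddCommGroup (J i)]
  [mod : ∀ i, Module R (J i)]
  ε : D →ₗ[R] J 0
  d : ∀ i, J i →ₗ[R] J (i + 1)
  inj : ∀ i, Module.Injective R (J i)
  ε_inj : Function.Injective ε
  exct0 : LinearMap.range ε = LinearMap.ker (d 0)
  exct : ∀ i, LinearMap.range (d i) = LinearMap.ker (d (i + 1))
  minimal : ∀ i, ∀ K : Submodule R (J i), K ≠ ⊥ → K ⊓ LinearMap.ker (d i) ≠ ⊥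

attribute [instance] MinimalInjRes.acg MinimalInjRes.mod

end

open TensorProduct

/-! ### Flat resolutions and the torsion modules they compute -/

/-- A flat resolution of the module `Z 0`, given by its syzygies `Z n` and the short exact
sequences `0 → Z (n + 1) → Q n → Z n → 0`. -/
structure FlatRes (R : Type u) [CommRing R] where
  Z : ℕ → ModuleCat.{u} R
  Q : ℕ → ModuleCat.{u} R
  ι : ∀ n, Z (n + 1) →ₗ[R] Q n
  π : ∀ n, Q n →ₗ[R] Z n
  ι_injective : ∀ n, Function.Injective (ι n)
  π_surjective : ∀ n, Function.Surjective (π n)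
  exact : ∀ n, Function.Exact (ι n) (π n)
  flat : ∀ n, Module.Flat R (Q n)

namespace FlatRes

variable {R : Type u} [CommRing R] (S : FlatRes R)

attribute [instance] FlatRes.flat

/-- The flat module containing the `n`-th syzygy: zero for `n = 0`. -/
def amb : ℕ → ModuleCat.{u} R
  | 0 => ModuleCat.of R PUnit
  | n + 1 => S.Q n

instance flat_amb : ∀ n, Module.Flat R (S.amb n)
  | 0 => inferInstanceAs (Module.Flat R PUnit.{u + 1})
  | n + 1 => S.flat n

/-- The inclusion of the `n`-th syzygy in the flat module `S.amb n`. -/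
def inc : ∀ n, S.Z n →ₗ[R] S.amb n
  | 0 => (0 : S.Z 0 →ₗ[R] PUnit.{u + 1})
  | n + 1 => S.ι n

/-- `Tor_n(Z 0, M)`, as the kernel of `Z n ⊗ M → Q (n - 1) ⊗ M`. -/
def tor (n : ℕ) (M : Type u) [AddCommGroup M] [Module R M] : Submodule R (S.Z n ⊗[R] M) :=
  LinearMap.ker ((S.inc n).rTensor M)

variable {L M N : Type u} [AddCommGroup L] [Module R L] [AddCommGroup M] [Module R M]
  [AddCommGroup N] [Module R N]

lemma mem_tor {n : ℕ} {x : S.Z n ⊗[R] M} : x ∈ S.tor n M ↔ (S.inc n).rTensor M x = 0 := Iff.rfl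

lemma mem_tor_zero (x : S.Z 0 ⊗[R] M) : x ∈ S.tor 0 M := by
  have : (S.inc 0).rTensor M = 0 := by
    change (0 : S.Z 0 →ₗ[R] PUnit.{u + 1}).rTensor M = 0
    simp
  simp [mem_tor, this]

lemma mem_tor_succ {n : ℕ} {x : S.Z (n + 1) ⊗[R] M} :
    x ∈ S.tor (n + 1) M ↔ (S.ι n).rTensor M x = 0 := Iff.rfl

lemma inc_lTensor (n : ℕ) (f : M →ₗ[R] N) (x : S.Z n ⊗[R] M) :
    (S.inc n).rTensor N (f.lTensor _ x) = f.lTensor _ ((S.inc n).rTensor M x) := by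
  rw [← LinearMap.comp_apply, ← LinearMap.comp_apply, LinearMap.rTensor_comp_lTensor,
    LinearMap.lTensor_comp_rTensor]

lemma ι_lTensor (n : ℕ) (f : M →ₗ[R] N) (x : S.Z (n + 1) ⊗[R] M) :
    (S.ι n).rTensor N (f.lTensor _ x) = f.lTensor _ ((S.ι n).rTensor M x) :=
  S.inc_lTensor (n + 1) f x

lemma π_lTensor (n : ℕ) (f : M →ₗ[R] N) (x : S.Q n ⊗[R] M) :
    (S.π n).rTensor N (f.lTensor _ x) = f.lTensor _ ((S.π n).rTensor M x) := by
  rw [← LinearMap.comp_apply, ← LinearMap.comp_apply, LinearMap.rTensor_comp_lTensor,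
    LinearMap.lTensor_comp_rTensor]

lemma lTensor_amb_injective (n : ℕ) {f : M →ₗ[R] N} (hf : Function.Injective f) :
    Function.Injective (f.lTensor (S.amb n)) :=
  Module.Flat.lTensor_preserves_injective_linearMap f hf

lemma lTensor_Q_injective (n : ℕ) {f : M →ₗ[R] N} (hf : Function.Injective f) :
    Function.Injective (f.lTensor (S.Q n)) :=
  Module.Flat.lTensor_preserves_injective_linearMap f hf

lemma π_ι_rTensor (n : ℕ) (x : S.Z (n + 1) ⊗[R] M) :
    (S.π n).rTensor M ((S.ι n).rTensor M x) = 0 :=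
  (rTensor_exact M (S.exact n) (S.π_surjective n)).apply_apply_eq_zero x

lemma exists_ι_rTensor (n : ℕ) {x : S.Q n ⊗[R] M} (hx : (S.π n).rTensor M x = 0) :
    ∃ y, (S.ι n).rTensor M y = x :=
  (rTensor_exact M (S.exact n) (S.π_surjective n) x).1 hx

/-- Functoriality of `tor` in the module. -/
def torMap (n : ℕ) (f : M →ₗ[R] N) : S.tor n M →ₗ[R] S.tor n N :=
  (f.lTensor (S.Z n)).restrict fun x hx => by
    rw [mem_tor] at hx ⊢
    rw [inc_lTensor, hx, map_zero]

@[simp] lemma coe_torMap (n : ℕ) (f : M →ₗ[R] N) (x : S.tor n M) :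
    (S.torMap n f x : S.Z n ⊗[R] N) = f.lTensor _ (x : S.Z n ⊗[R] M) := rfl

lemma torMap_id (n : ℕ) : S.torMap n (LinearMap.id : M →ₗ[R] M) = LinearMap.id := by
  ext x; simp

lemma torMap_comp (n : ℕ) (g : M →ₗ[R] N) (f : L →ₗ[R] M) :
    S.torMap n (g ∘ₗ f) = S.torMap n g ∘ₗ S.torMap n f := by
  ext x; simp [LinearMap.lTensor_comp]

lemma torMap_comp_apply (n : ℕ) (g : M →ₗ[R] N) (f : L →ₗ[R] M) (x : S.tor n L) :
    S.torMap n g (S.torMap n f x) = S.torMap n (g ∘ₗ f) x := by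
  rw [torMap_comp]; rfl

lemma torMap_add (n : ℕ) (f g : M →ₗ[R] N) :
    S.torMap n (f + g) = S.torMap n f + S.torMap n g := by
  ext x; simp [LinearMap.lTensor_add]

lemma torMap_smul (n : ℕ) (r : R) (f : M →ₗ[R] N) :
    S.torMap n (r • f) = r • S.torMap n f := by
  ext x; simp [LinearMap.lTensor_smul]

lemma torMap_zero (n : ℕ) : S.torMap n (0 : M →ₗ[R] N) = 0 := by
  ext x; simp

lemma torMap_sum (n : ℕ) {κ : Type*} (s : Finset κ) (f : κ → M →ₗ[R] N) :
    S.torMap n (∑ i ∈ s, f i) = ∑ i ∈ s, S.torMap n (f i) := by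
  classical
  induction s using Finset.induction_on with
  | empty => simp [torMap_zero]
  | insert a s ha ih => rw [Finset.sum_insert ha, Finset.sum_insert ha, torMap_add, ih]

/-- `tor` of isomorphic modules. -/
def torCongr (n : ℕ) (e : M ≃ₗ[R] N) : S.tor n M ≃ₗ[R] S.tor n N :=
  LinearEquiv.ofLinearMap (S.torMap n e) (S.torMap n e.symm)
    (by rw [← torMap_comp, LinearEquiv.comp_symm, torMap_id])
    (by rw [← torMap_comp, LinearEquiv.symm_comp, torMap_id])

lemma torMap_zero_surjective {g : M →ₗ[R] N} (hg : Function.Surjective g) :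
    Function.Surjective (S.torMap 0 g) := fun y => by
  obtain ⟨x, hx⟩ := g.lTensor_surjective (S.Z 0) hg y
  exact ⟨⟨x, S.mem_tor_zero x⟩, Subtype.ext hx⟩

section ShortExact

variable {f : L →ₗ[R] M} {g : M →ₗ[R] N}

lemma torMap_exact (n : ℕ) (hf : Function.Injective f) (hg : Function.Surjective g)
    (hfg : Function.Exact f g) : Function.Exact (S.torMap n f) (S.torMap n g) := by
  intro x
  constructor
  · intro hx
    obtain ⟨w, hw⟩ := (lTensor_exact (S.Z n) hfg hg x).1 (congrArg Subtype.val hx)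
    refine ⟨⟨w, ?_⟩, Subtype.ext hw⟩
    apply S.lTensor_amb_injective n hf
    rw [map_zero, ← inc_lTensor, hw]
    exact x.2
  · rintro ⟨w, rfl⟩
    ext1
    exact (lTensor_exact (S.Z n) hfg hg).apply_apply_eq_zero _

lemma lTensor_injective_of_tor (n : ℕ) (hf : Function.Injective f) (hg : Function.Surjective g)
    (hfg : Function.Exact f g) (h : S.tor (n + 1) N = ⊥) :
    Function.Injective (f.lTensor (S.Z n)) := by
  rw [injective_iff_map_eq_zero]
  intro w hw
  obtain ⟨q, rfl⟩ := LinearMap.rTensor_surjective L (S.π_surjective n) w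
  rw [← π_lTensor] at hw
  obtain ⟨z, hz⟩ := S.exists_ι_rTensor n hw
  have hz0 : g.lTensor _ z ∈ S.tor (n + 1) N := by
    rw [mem_tor_succ, ι_lTensor, hz]
    exact (lTensor_exact _ hfg hg).apply_apply_eq_zero _
  rw [h, Submodule.mem_bot] at hz0
  obtain ⟨z', rfl⟩ := (lTensor_exact _ hfg hg z).1 hz0
  rw [ι_lTensor] at hz
  rw [← S.lTensor_Q_injective n hf hz, π_ι_rTensor]

lemma torMap_injective (n : ℕ) (hf : Function.Injective f) (hg : Function.Surjective g)
    (hfg : Function.Exact f g) (h : S.tor (n + 1) N = ⊥) :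
    Function.Injective (S.torMap n f) := fun _ _ hxy =>
  Subtype.ext (S.lTensor_injective_of_tor n hf hg hfg h (congrArg Subtype.val hxy))

lemma torMap_succ_surjective (n : ℕ) (hf : Function.Injective f) (hg : Function.Surjective g)
    (hfg : Function.Exact f g) (h : Function.Injective (S.torMap n f)) :
    Function.Surjective (S.torMap (n + 1) g) := by
  rintro ⟨t, ht⟩
  rw [mem_tor_succ] at ht
  obtain ⟨z, rfl⟩ := g.lTensor_surjective (S.Z (n + 1)) hg t
  rw [ι_lTensor] at ht
  obtain ⟨q, hq⟩ := (lTensor_exact _ hfg hg _).1 ht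
  have hw : f.lTensor _ ((S.π n).rTensor L q) = 0 := by
    rw [← π_lTensor, hq, π_ι_rTensor]
  have hw' : (S.π n).rTensor L q ∈ S.tor n L := by
    apply S.lTensor_amb_injective n hf
    rw [map_zero, ← inc_lTensor, hw, map_zero]
  have := congrArg Subtype.val (h (a₁ := ⟨_, hw'⟩) (a₂ := 0) (by ext1; simpa using hw))
  obtain ⟨z', rfl⟩ := S.exists_ι_rTensor n this
  refine ⟨⟨z - f.lTensor _ z', ?_⟩, ?_⟩
  · rw [mem_tor_succ, map_sub, ι_lTensor, hq, sub_self]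
  · ext1
    rw [coe_torMap, map_sub, (lTensor_exact _ hfg hg).apply_apply_eq_zero, sub_zero]

lemma tor_eq_bot_of_exact (n : ℕ) (hf : Function.Injective f) (hg : Function.Surjective g)
    (hfg : Function.Exact f g) (hL : S.tor n L = ⊥) (hN : S.tor n N = ⊥) : S.tor n M = ⊥ := by
  rw [Submodule.eq_bot_iff]
  intro x hx
  have h0 : S.torMap n g ⟨x, hx⟩ = 0 := by
    ext1
    exact (Submodule.mem_bot R).1 (hN.le (S.torMap n g ⟨x, hx⟩).2)
  obtain ⟨w, hw⟩ := (S.torMap_exact n hf hg hfg _).1 h0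
  have hw0 : (w : S.Z n ⊗[R] L) = 0 := (Submodule.mem_bot R).1 (hL.le w.2)
  have := congrArg Subtype.val hw
  rw [coe_torMap, hw0, map_zero] at this
  exact this.symm

lemma tor_left_eq_bot (n : ℕ) (hf : Function.Injective f) (hg : Function.Surjective g)
    (hfg : Function.Exact f g) (hM : S.tor n M = ⊥) (hN : S.tor (n + 1) N = ⊥) :
    S.tor n L = ⊥ := by
  rw [Submodule.eq_bot_iff]
  intro x hx
  refine congrArg Subtype.val (S.torMap_injective n hf hg hfg hN (a₁ := ⟨x, hx⟩) (a₂ := 0) ?_)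
  rw [map_zero]
  ext1
  exact (Submodule.mem_bot R).1 (hM.le (S.torMap n f ⟨x, hx⟩).2)

end ShortExact

lemma torMap_injective_of_eq_bot (n : ℕ) (f : M →ₗ[R] N) (h : S.tor n M = ⊥) :
    Function.Injective (S.torMap n f) := by
  have := Submodule.subsingleton_iff_eq_bot.2 h
  exact Function.injective_of_subsingleton _

lemma tor_eq_bot_of_surjective (n : ℕ) {f : M →ₗ[R] N} (hf : Function.Surjective (S.torMap n f))
    (h : S.tor n M = ⊥) : S.tor n N = ⊥ := by
  have := Submodule.subsingleton_iff_eq_bot.2 h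
  have := hf.subsingleton
  exact Submodule.subsingleton_iff_eq_bot.1 this

lemma tor_eq_bot_of_equiv (n : ℕ) (e : M ≃ₗ[R] N) (h : S.tor n M = ⊥) : S.tor n N = ⊥ :=
  S.tor_eq_bot_of_surjective n (f := e.toLinearMap)
    (fun y => ⟨S.torMap n e.symm y, by
      rw [torMap_comp_apply, LinearEquiv.comp_symm, torMap_id, LinearMap.id_apply]⟩) h

/-- `tor` vanishes if it vanishes on all finitely generated submodules. -/
lemma tor_eq_bot_of_fg (n : ℕ)
    (h : ∀ P : Submodule R M, P.FG → S.tor n P = ⊥) : S.tor n M = ⊥ := by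
  rw [Submodule.eq_bot_iff]
  intro x hx
  obtain ⟨P, hP, y, rfl⟩ : ∃ P : Submodule R M, P.FG ∧ ∃ y, P.subtype.lTensor (S.Z n) y = x := by
    clear hx
    induction x with
    | zero => exact ⟨⊥, Submodule.fg_bot, 0, by simp⟩
    | tmul a b =>
      exact ⟨Submodule.span R {b}, Submodule.fg_span_singleton b,
        a ⊗ₜ ⟨b, Submodule.mem_span_singleton_self b⟩, by simp⟩
    | add x y hx hy =>
      obtain ⟨P₁, h₁, y₁, rfl⟩ := hx
      obtain ⟨P₂, h₂, y₂, rfl⟩ := hy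
      refine ⟨P₁ ⊔ P₂, h₁.sup h₂, (Submodule.inclusion le_sup_left).lTensor _ y₁ +
        (Submodule.inclusion le_sup_right).lTensor _ y₂, ?_⟩
      rw [map_add, ← LinearMap.comp_apply, ← LinearMap.comp_apply, ← LinearMap.lTensor_comp,
        ← LinearMap.lTensor_comp, Submodule.subtype_comp_inclusion,
        Submodule.subtype_comp_inclusion]
  have hy : y ∈ S.tor n P := by
    apply S.lTensor_amb_injective n P.injective_subtype
    rw [map_zero, ← inc_lTensor]
    exact hx
  rw [h P hP, Submodule.mem_bot] at hy
  rw [hy, map_zero]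

/-- Dimension shifting along a short exact sequence with flat middle term. -/
lemma tor_succ_equiv_ker (n : ℕ) {f : L →ₗ[R] M} {g : M →ₗ[R] N} [Module.Flat R M]
    (hf : Function.Injective f) (hg : Function.Surjective g) (hfg : Function.Exact f g) :
    Nonempty (S.tor (n + 1) N ≃ₗ[R] LinearMap.ker (f.lTensor (S.Z n))) := by
  let P : Submodule R ((S.Z (n + 1) ⊗[R] M) × (S.Q n ⊗[R] L)) :=
    LinearMap.ker ((S.ι n).rTensor M ∘ₗ LinearMap.fst R _ _ -
      f.lTensor (S.Q n) ∘ₗ LinearMap.snd R _ _)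
  have hP : ∀ x ∈ P, (S.ι n).rTensor M x.1 = f.lTensor (S.Q n) x.2 := fun x hx =>
    sub_eq_zero.1 hx
  let α : P →ₗ[R] S.tor (n + 1) N :=
    (g.lTensor (S.Z (n + 1)) ∘ₗ LinearMap.fst R _ _ ∘ₗ P.subtype).codRestrict _ fun x => by
      change (S.ι n).rTensor N (g.lTensor _ x.1.1) = 0
      rw [ι_lTensor, hP _ x.2]
      exact (lTensor_exact _ hfg hg).apply_apply_eq_zero _
  let β : P →ₗ[R] LinearMap.ker (f.lTensor (S.Z n)) :=
    ((S.π n).rTensor L ∘ₗ LinearMap.snd R _ _ ∘ₗ P.subtype).codRestrict _ fun x => by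
      change f.lTensor _ ((S.π n).rTensor L x.1.2) = 0
      rw [← π_lTensor, ← hP _ x.2, π_ι_rTensor]
  have hα : Function.Surjective α := by
    rintro ⟨t, ht⟩
    obtain ⟨z, rfl⟩ := g.lTensor_surjective (S.Z (n + 1)) hg t
    rw [mem_tor_succ, ι_lTensor] at ht
    obtain ⟨q, hq⟩ := (lTensor_exact _ hfg hg _).1 ht
    exact ⟨⟨(z, q), sub_eq_zero.2 hq.symm⟩, rfl⟩
  have hβ : Function.Surjective β := by
    rintro ⟨t, ht⟩
    obtain ⟨q, rfl⟩ := LinearMap.rTensor_surjective L (S.π_surjective n) t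
    rw [LinearMap.mem_ker, ← π_lTensor] at ht
    obtain ⟨z, hz⟩ := S.exists_ι_rTensor n ht
    exact ⟨⟨(z, q), sub_eq_zero.2 hz⟩, rfl⟩
  have hι : Function.Injective ((S.ι n).rTensor M) :=
    Module.Flat.rTensor_preserves_injective_linearMap (S.ι n) (S.ι_injective n)
  have hαβ : LinearMap.ker α = LinearMap.ker β := by
    ext ⟨⟨z, q⟩, hx⟩
    have hx' : (S.ι n).rTensor M z = f.lTensor (S.Q n) q := hP _ hx
    constructor
    · intro h
      obtain ⟨z', rfl⟩ := (lTensor_exact _ hfg hg z).1 (congrArg Subtype.val h)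
      rw [ι_lTensor] at hx'
      have := S.lTensor_Q_injective n hf hx'
      subst this
      exact Subtype.ext (S.π_ι_rTensor n z')
    · intro h
      obtain ⟨z', rfl⟩ := S.exists_ι_rTensor n (congrArg Subtype.val h)
      rw [← ι_lTensor] at hx'
      have := hι hx'
      subst this
      exact Subtype.ext ((lTensor_exact _ hfg hg).apply_apply_eq_zero _)
  exact ⟨(α.quotKerEquivOfSurjective hα).symm ≪≫ₗ Submodule.quotEquivOfEq _ _ hαβ ≪≫ₗ
    β.quotKerEquivOfSurjective hβ⟩

end FlatRes

section DirectSumAux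

open Classical in
/-- A module with a compatible family of inclusions and projections in which every element is
the finite sum of its components is a direct sum. -/
lemma directSum_equiv_of_components {R : Type u} [CommRing R] {κ : Type u} (X : κ → Type u)
    [∀ j, AddCommGroup (X j)] [∀ j, Module R (X j)] {Y : Type u} [AddCommGroup Y] [Module R Y]
    (i : ∀ j, X j →ₗ[R] Y) (p : ∀ j, Y →ₗ[R] X j) (h₁ : ∀ j x, p j (i j x) = x)
    (h₂ : ∀ j k x, j ≠ k → p k (i j x) = 0)
    (h₃ : ∀ y, ∃ J : Finset κ, ∑ j ∈ J, i j (p j y) = y) :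
    Nonempty ((⨁ j, X j) ≃ₗ[R] Y) := by
  have key : ∀ (x : ⨁ j, X j) k, p k (DirectSum.toModule R κ Y i x) = x k := by
    intro x k
    induction x using DirectSum.induction_on with
    | zero => simp
    | of j y =>
      rw [← DirectSum.lof_eq_of R, DirectSum.toModule_lof]
      by_cases h : j = k
      · subst h
        rw [h₁, DirectSum.lof_eq_of, DirectSum.of_eq_same]
      · rw [h₂ _ _ _ h, DirectSum.lof_eq_of, DirectSum.of_eq_of_ne _ _ _ (Ne.symm h)]
    | add x y hx hy => rw [map_add, map_add, hx, hy]; rfl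
  refine ⟨LinearEquiv.ofBijective (DirectSum.toModule R κ Y i) ⟨fun x y h => ?_, fun y => ?_⟩⟩
  · ext k
    rw [← key, ← key, h]
  · obtain ⟨J, hJ⟩ := h₃ y
    refine ⟨∑ j ∈ J, DirectSum.lof R κ X j (p j y), ?_⟩
    rw [map_sum, ← hJ]
    exact Finset.sum_congr rfl fun j _ => by rw [hJ, DirectSum.toModule_lof]

variable {R : Type u} [CommRing R] {κ : Type u} (X : κ → Type u)
    [∀ j, AddCommGroup (X j)] [∀ j, Module R (X j)]

open Classical in
lemma directSum_component_lof (j k : κ) (x : X j) (h : j ≠ k) :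
    DirectSum.component R κ X k (DirectSum.lof R κ X j x) = 0 := by
  rw [DirectSum.component.of, dif_neg h]

open Classical in
lemma directSum_exists_finset (x : ⨁ j, X j) : ∃ J : Finset κ, ∀ J', J ⊆ J' →
    ∑ j ∈ J', DirectSum.lof R κ X j (DirectSum.component R κ X j x) = x := by
  refine ⟨DFinsupp.support x, fun J' hJ' => ?_⟩
  conv_rhs => rw [← DirectSum.sum_support_of x]
  refine (Finset.sum_subset hJ' fun j _ hj => ?_).symm
  rw [show DirectSum.component R κ X j x = 0 from DFinsupp.notMem_support_iff.1 hj, map_zero]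

open Classical in
/-- Homomorphisms out of a finite module commute with direct sums. -/
lemma linearMap_directSum_equiv (D : Type u) [AddCommGroup D] [Module R D] [Module.Finite R D] :
    Nonempty ((⨁ j, (D →ₗ[R] X j)) ≃ₗ[R] (D →ₗ[R] ⨁ j, X j)) := by
  refine directSum_equiv_of_components (fun j => D →ₗ[R] X j)
    (fun j => LinearMap.llcomp R D (X j) _ (DirectSum.lof R κ X j))
    (fun j => LinearMap.llcomp R D _ (X j) (DirectSum.component R κ X j)) ?_ ?_ ?_
  · intro j f
    ext d
    simp [DirectSum.component.lof_self]
  · intro j k f h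
    ext d
    simp [directSum_component_lof X j k _ h]
  · intro f
    obtain ⟨s, hs⟩ := Module.Finite.fg_top (R := R) (M := D)
    choose J hJ using directSum_exists_finset (R := R) X
    refine ⟨s.biUnion fun d => J (f d), ?_⟩
    apply LinearMap.ext_on hs
    intro d hd
    rw [LinearMap.sum_apply]
    exact hJ (f d) _ (Finset.subset_biUnion_of_mem (fun d => J (f d)) hd)

open Classical in
/-- `tor` commutes with direct sums. -/
lemma FlatRes.tor_directSum_equiv (S : FlatRes R) (n : ℕ) :
    Nonempty ((⨁ j, S.tor n (X j)) ≃ₗ[R] S.tor n (⨁ j, X j)) := by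
  refine directSum_equiv_of_components (fun j => S.tor n (X j))
    (fun j => S.torMap n (DirectSum.lof R κ X j))
    (fun j => S.torMap n (DirectSum.component R κ X j)) ?_ ?_ ?_
  · intro j x
    rw [S.torMap_comp_apply]
    rw [show DirectSum.component R κ X j ∘ₗ DirectSum.lof R κ X j = LinearMap.id from
      LinearMap.ext fun d => DirectSum.component.lof_self R j d, torMap_id, LinearMap.id_apply]
  · intro j k x h
    rw [S.torMap_comp_apply]
    rw [show DirectSum.component R κ X k ∘ₗ DirectSum.lof R κ X j = 0 from
      LinearMap.ext fun d => directSum_component_lof (R := R) X j k d h,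
      torMap_zero, LinearMap.zero_apply]
  · have key : ∀ x : S.Z n ⊗[R] (⨁ j, X j), ∃ J : Finset κ, ∀ J', J ⊆ J' →
        (∑ j ∈ J', DirectSum.lof R κ X j ∘ₗ DirectSum.component R κ X j).lTensor (S.Z n) x
          = x := by
      intro x
      induction x with
      | zero => exact ⟨∅, fun _ _ => map_zero _⟩
      | tmul a b =>
        obtain ⟨J, hJ⟩ := directSum_exists_finset (R := R) X b
        refine ⟨J, fun J' h => ?_⟩
        rw [LinearMap.lTensor_tmul, LinearMap.sum_apply]
        exact congrArg _ (hJ J' h)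
      | add x y hx hy =>
        obtain ⟨J, hJ⟩ := hx
        obtain ⟨K, hK⟩ := hy
        refine ⟨J ∪ K, fun J' h => ?_⟩
        rw [map_add, hJ _ (Finset.subset_union_left.trans h),
          hK _ (Finset.subset_union_right.trans h)]
    intro y
    obtain ⟨J, hJ⟩ := key y
    refine ⟨J, Subtype.ext ?_⟩
    refine Eq.trans ?_ (hJ J subset_rfl)
    rw [← coe_torMap, torMap_sum, LinearMap.sum_apply]
    simp_rw [torMap_comp_apply]

end DirectSumAux

namespace FlatRes

variable {R : Type u} [CommRing R] (S S' : FlatRes R)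

section Balance

variable {L M N : Type u} [AddCommGroup L] [Module R L] [AddCommGroup M] [Module R M]
  [AddCommGroup N] [Module R N]

lemma ker_lTensor_eq_tor (n : ℕ) {f : L →ₗ[R] M} [Module.Flat R M] (hf : Function.Injective f) :
    LinearMap.ker (f.lTensor (S.Z (n + 1))) = S.tor (n + 1) L := by
  ext x
  rw [LinearMap.mem_ker, mem_tor_succ]
  constructor
  · intro h
    apply S.lTensor_Q_injective n hf
    rw [← ι_lTensor, h, map_zero, map_zero]
  · intro h
    apply Module.Flat.rTensor_preserves_injective_linearMap (M := M) (S.ι n) (S.ι_injective n)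
    rw [ι_lTensor, h, map_zero, map_zero]

/-- Dimension shifting along a short exact sequence with flat middle term. -/
lemma tor_succ_succ_equiv (n : ℕ) {f : L →ₗ[R] M} {g : M →ₗ[R] N} [Module.Flat R M]
    (hf : Function.Injective f) (hg : Function.Surjective g) (hfg : Function.Exact f g) :
    Nonempty (S.tor (n + 2) N ≃ₗ[R] S.tor (n + 1) L) := by
  obtain ⟨e⟩ := S.tor_succ_equiv_ker (n + 1) hf hg hfg
  exact ⟨e ≪≫ₗ LinearEquiv.ofEq _ _ (S.ker_lTensor_eq_tor n hf)⟩

lemma ker_lTensor_equiv_ker_rTensor (f : L →ₗ[R] M) :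
    Nonempty (LinearMap.ker (f.lTensor N) ≃ₗ[R] LinearMap.ker (f.rTensor N)) := by
  refine ⟨LinearEquiv.ofSubmodules (TensorProduct.comm R N L) _ _ ?_⟩
  ext x
  rw [Submodule.mem_map_equiv, LinearMap.mem_ker, LinearMap.mem_ker]
  rw [← (TensorProduct.comm R N M).map_eq_zero_iff]
  have : ∀ y, TensorProduct.comm R N M (f.lTensor N y) =
      f.rTensor N (TensorProduct.comm R N L y) := fun y => by
    induction y with
    | zero => simp
    | tmul a b => simp
    | add a b ha hb => rw [map_add, map_add, map_add, map_add, ha, hb]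
  rw [this, LinearEquiv.apply_symm_apply]

/-- The torsion modules are balanced. -/
lemma tor_balance (k : ℕ) : Nonempty (S.tor k (S'.Z 0) ≃ₗ[R] S'.tor k (S.Z 0)) := by
  cases k with
  | zero =>
    have h : ∀ (T : FlatRes R) (M : Type u) [AddCommGroup M] [Module R M], T.tor 0 M = ⊤ :=
      fun T M _ _ => Submodule.eq_top_iff'.2 T.mem_tor_zero
    exact ⟨LinearEquiv.ofTop _ (h _ _) ≪≫ₗ TensorProduct.comm R _ _ ≪≫ₗ
      (LinearEquiv.ofTop _ (h _ _)).symm⟩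
  | succ k =>
    have key : ∀ j m, Nonempty (S.tor (j + 1) (S'.Z m) ≃ₗ[R] S'.tor (m + j + 1) (S.Z 0)) := by
      intro j
      induction j with
      | zero =>
        intro m
        obtain ⟨e⟩ := S.tor_succ_equiv_ker 0 (S'.ι_injective m) (S'.π_surjective m) (S'.exact m)
        obtain ⟨e'⟩ := ker_lTensor_equiv_ker_rTensor (N := S.Z 0) (S'.ι m)
        exact ⟨e ≪≫ₗ e'⟩
      | succ j ih =>
        intro m
        obtain ⟨e⟩ := S.tor_succ_succ_equiv j (S'.ι_injective m) (S'.π_surjective m) (S'.exact m)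
        obtain ⟨e'⟩ := ih (m + 1)
        rw [show m + 1 + j + 1 = m + (j + 1) + 1 by omega] at e'
        exact ⟨e ≪≫ₗ e'⟩
    obtain ⟨e⟩ := key k 0
    rw [Nat.zero_add] at e
    exact ⟨e⟩

end Balance

section Canonical

/-- The syzygies of the canonical free resolution. -/
noncomputable def canZ (A : ModuleCat.{u} R) : ℕ → ModuleCat.{u} R
  | 0 => A
  | n + 1 => ModuleCat.of R (LinearMap.ker (Finsupp.linearCombination R (id : canZ A n → _)))

/-- The canonical free resolution of a module. -/
noncomputable def can (A : Type u) [AddCommGroup A] [Module R A] : FlatRes R where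
  Z := canZ (ModuleCat.of R A)
  Q n := ModuleCat.of R (canZ (ModuleCat.of R A) n →₀ R)
  ι n := (LinearMap.ker (Finsupp.linearCombination R
    (id : canZ (ModuleCat.of R A) n → _))).subtype
  π n := Finsupp.linearCombination R (id : canZ (ModuleCat.of R A) n → _)
  ι_injective _ := Submodule.injective_subtype _
  π_surjective _ := Finsupp.linearCombination_id_surjective R _
  exact _ := LinearMap.exact_subtype_ker_map _
  flat n := inferInstanceAs (Module.Flat R (canZ (ModuleCat.of R A) n →₀ R))

instance can_projective (A : Type u) [AddCommGroup A] [Module R A] (n : ℕ) :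
    Module.Projective R ((can (R := R) A).Q n) :=
  inferInstanceAs (Module.Projective R (canZ (ModuleCat.of R A) n →₀ R))

/-- The rank of a chosen free cover of a finite module. -/
noncomputable def coverRank (A : Type u) [AddCommGroup A] [Module R A] [Module.Finite R A] : ℕ :=
  (Module.Finite.exists_fin' R A).choose

/-- A chosen finite free cover of a finite module. -/
noncomputable def cover (A : Type u) [AddCommGroup A] [Module R A] [Module.Finite R A] :
    (Fin (coverRank (R := R) A) → R) →ₗ[R] A :=
  (Module.Finite.exists_fin' R A).choose_spec.choose

lemma cover_surjective (A : Type u) [AddCommGroup A] [Module R A] [Module.Finite R A] :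
    Function.Surjective (cover (R := R) A) :=
  (Module.Finite.exists_fin' R A).choose_spec.choose_spec

variable [IsNoetherianRing R]

/-- The syzygies of a resolution by finite free modules. -/
noncomputable def finZ (A : {A : ModuleCat.{u} R // Module.Finite R A}) :
    ℕ → {A : ModuleCat.{u} R // Module.Finite R A}
  | 0 => A
  | n + 1 =>
    haveI := (finZ A n).2
    ⟨ModuleCat.of R (LinearMap.ker (cover (R := R) (finZ A n).1)),
      inferInstanceAs (Module.Finite R (LinearMap.ker (cover (R := R) (finZ A n).1)))⟩

instance finZ_finite (A : {A : ModuleCat.{u} R // Module.Finite R A}) (n : ℕ) :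
    Module.Finite R (finZ A n).1 := (finZ A n).2

variable (A : Type u) [AddCommGroup A] [Module R A] [hA : Module.Finite R A]

/-- A resolution of a finite module by finite free modules. -/
noncomputable def fin : FlatRes R where
  Z n := (finZ ⟨ModuleCat.of R A, hA⟩ n).1
  Q n := ModuleCat.of R (Fin (coverRank (R := R) (finZ ⟨ModuleCat.of R A, hA⟩ n).1) → R)
  ι n := (LinearMap.ker (cover (R := R) (finZ ⟨ModuleCat.of R A, hA⟩ n).1)).subtype
  π n := cover (R := R) (finZ ⟨ModuleCat.of R A, hA⟩ n).1
  ι_injective _ := Submodule.injective_subtype _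
  π_surjective _ := cover_surjective _
  exact _ := LinearMap.exact_subtype_ker_map _
  flat _ := inferInstanceAs (Module.Flat R (Fin _ → R))

instance fin_projective (n : ℕ) : Module.Projective R ((fin (R := R) A).Q n) :=
  inferInstanceAs (Module.Projective R (Fin _ → R))

instance fin_finite_Q (n : ℕ) : Module.Finite R ((fin (R := R) A).Q n) :=
  inferInstanceAs (Module.Finite R (Fin _ → R))

instance fin_finite (n : ℕ) : Module.Finite R ((fin (R := R) A).Z n) :=
  (finZ ⟨ModuleCat.of R A, hA⟩ n).2

end Canonical

end FlatRes

/-! ### Comparison with the derived functors -/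

section Comparison

variable {R : Type u} [CommRing R]

lemma homology_equiv_ker (K : ShortComplex (ModuleCat.{u} R)) {W : Type u} [AddCommGroup W]
    [Module R W] (p : K.X₂ →ₗ[R] W) (hp : Function.Surjective p)
    (hker : ∀ x, p x = 0 ↔ ∃ y, K.f y = x) (j : W →ₗ[R] K.X₃)
    (hj : ∀ x, j (p x) = K.g x) :
    Nonempty (K.homology ≃ₗ[R] LinearMap.ker j) := by
  let φ : LinearMap.ker K.g.hom →ₗ[R] LinearMap.ker j :=
    p.restrict fun x hx => by
      rw [LinearMap.mem_ker, hj]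
      exact hx
  have hφ : Function.Surjective φ := by
    rintro ⟨w, hw⟩
    obtain ⟨x, rfl⟩ := hp w
    exact ⟨⟨x, (hj x).symm.trans hw⟩, rfl⟩
  have hk : LinearMap.range K.moduleCatToCycles = LinearMap.ker φ := by
    ext ⟨x, hx⟩
    constructor
    · rintro ⟨y, hy⟩
      exact Subtype.ext ((hker x).2 ⟨y, congrArg Subtype.val hy⟩)
    · intro h
      obtain ⟨y, hy⟩ := (hker x).1 (congrArg Subtype.val h)
      exact ⟨y, Subtype.ext hy⟩
  exact ⟨K.moduleCatHomologyIso.toLinearEquiv ≪≫ₗ Submodule.quotEquivOfEq _ _ hk ≪≫ₗ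
    φ.quotKerEquivOfSurjective hφ⟩

namespace FlatRes

variable (S : FlatRes R)

/-- The chain complex of a flat resolution. -/
noncomputable def complex : ChainComplex (ModuleCat.{u} R) ℕ :=
  ChainComplex.of S.Q (fun n => ModuleCat.ofHom (S.ι n ∘ₗ S.π (n + 1))) fun n => by
    ext x
    have := (S.exact (n + 1)).apply_apply_eq_zero (S.π (n + 2) x)
    change S.ι n (S.π (n + 1) (S.ι (n + 1) (S.π (n + 2) x))) = 0
    rw [this, map_zero]

lemma complex_d (n : ℕ) : S.complex.d (n + 1) n = ModuleCat.ofHom (S.ι n ∘ₗ S.π (n + 1)) :=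
  ChainComplex.of_d S.Q (fun n => ModuleCat.ofHom (S.ι n ∘ₗ S.π (n + 1))) n

lemma complex_exactAt_succ (n : ℕ) : S.complex.ExactAt (n + 1) := by
  rw [HomologicalComplex.exactAt_iff' _ (n + 1 + 1) (n + 1) n (by simp) (by simp),
    ShortComplex.moduleCat_exact_iff]
  intro x hx
  change S.complex.d (n + 1) n x = 0 at hx
  rw [complex_d] at hx
  change S.ι n (S.π (n + 1) x) = 0 at hx
  have hx := (S.exact (n + 1) x).1 (S.ι_injective n (hx.trans (map_zero _).symm))
  obtain ⟨y, rfl⟩ := hx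
  obtain ⟨z, rfl⟩ := S.π_surjective (n + 2) y
  refine ⟨z, ?_⟩
  change S.complex.d (n + 1 + 1) (n + 1) z = _
  rw [complex_d]
  rfl

variable [hQ : ∀ n, Module.Projective R (S.Q n)]

/-- The projective resolution attached to a flat resolution with projective terms. -/
noncomputable def projRes : ProjectiveResolution (S.Z 0) where
  complex := S.complex
  projective n := (IsProjective.iff_projective (R := R) (S.Q n)).1 (hQ n)
  π := (ChainComplex.toSingle₀Equiv _ _).symm ⟨ModuleCat.ofHom (S.π 0), by
    rw [complex_d]
    ext x
    exact (S.exact 0).apply_apply_eq_zero (S.π 1 x)⟩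
  quasiIso := ⟨fun n => by
    cases n
    · rw [ChainComplex.quasiIsoAt₀_iff, ShortComplex.quasiIso_iff_of_zeros']
      · constructor
        · rw [ShortComplex.moduleCat_exact_iff]
          intro x hx
          obtain ⟨y, rfl⟩ := (S.exact 0 x).1 hx
          obtain ⟨z, rfl⟩ := S.π_surjective 1 y
          refine ⟨z, ?_⟩
          change S.complex.d (0 + 1) 0 z = _
          rw [complex_d]
          rfl
        · exact (ModuleCat.epi_iff_surjective _).2 (S.π_surjective 0)
      all_goals rfl
    · rw [quasiIsoAt_iff_exactAt']
      · apply complex_exactAt_succ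
      · apply ChainComplex.exactAt_succ_single_obj⟩

lemma torM_equiv (k : ℕ) (F : Type u) [AddCommGroup F] [Module R F] :
    Nonempty (TorM R k F (S.Z 0) ≃ₗ[R] S.tor k F) := by
  have e₁ := S.projRes.isoLeftDerivedObj
    ((MonoidalCategory.tensoringLeft (ModuleCat.{u} R)).obj (ModuleCat.of R F)) k
  set K := (((MonoidalCategory.tensoringLeft (ModuleCat.{u} R)).obj
    (ModuleCat.of R F)).mapHomologicalComplex _).obj S.projRes.complex with hK
  have hd : ∀ n (x : F ⊗[R] S.Q (n + 1)), K.d (n + 1) n x =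
      (S.ι n).lTensor F ((S.π (n + 1)).lTensor F x) := by
    intro n x
    change (S.complex.d (n + 1) n).hom.lTensor F x = _
    rw [complex_d]
    exact LinearMap.congr_fun (LinearMap.lTensor_comp F (S.ι n) (S.π (n + 1))) x
  obtain ⟨e₃⟩ := ker_lTensor_equiv_ker_rTensor (N := F) (S.inc k)
  have hsurj : Function.Surjective ((S.π k).lTensor F) :=
    LinearMap.lTensor_surjective F (S.π_surjective k)
  have hker : ∀ x : F ⊗[R] S.Q k, (S.π k).lTensor F x = 0 ↔
      ∃ y, K.d (k + 1) k y = x := by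
    intro x
    rw [lTensor_exact F (S.exact k) (S.π_surjective k) x]
    constructor
    · rintro ⟨y, rfl⟩
      obtain ⟨z, rfl⟩ := LinearMap.lTensor_surjective F (S.π_surjective (k + 1)) y
      exact ⟨z, hd k z⟩
    · rintro ⟨y, rfl⟩
      exact ⟨(S.π (k + 1)).lTensor F y, (hd k y).symm⟩
  cases k with
  | zero =>
    obtain ⟨e₂⟩ := homology_equiv_ker (K.sc' 1 0 0) ((S.π 0).lTensor F) hsurj hker 0
      (fun x => by
        change _ = K.d 0 0 x
        rw [K.shape 0 0 (by simp)]
        rfl)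
    have h₀ : (S.inc 0).lTensor F = 0 := LinearMap.lTensor_zero F
    exact ⟨e₁.toLinearEquiv ≪≫ₗ (K.homologyIsoSc' 1 0 0 (by simp)
      (by simp)).toLinearEquiv ≪≫ₗ e₂ ≪≫ₗ LinearEquiv.ofTop _ LinearMap.ker_zero ≪≫ₗ
      (LinearEquiv.ofTop _ (by rw [h₀, LinearMap.ker_zero])).symm ≪≫ₗ e₃⟩
  | succ k =>
    obtain ⟨e₂⟩ := homology_equiv_ker (K.sc' (k + 2) (k + 1) k) ((S.π (k + 1)).lTensor F) hsurj
      hker ((S.inc (k + 1)).lTensor F) (fun x => (hd k x).symm)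
    exact ⟨e₁.toLinearEquiv ≪≫ₗ (K.homologyIsoSc' (k + 2) (k + 1) k (by simp)
      (by simp)).toLinearEquiv ≪≫ₗ e₂ ≪≫ₗ e₃⟩

lemma exists_extension_of_extM (i : ℕ) (Y : Type u) [AddCommGroup Y] [Module R Y]
    (h : Subsingleton (ExtM R (i + 1) (S.Z 0) Y)) (g : S.Z (i + 1) →ₗ[R] Y) :
    ∃ g' : S.Q i →ₗ[R] Y, g' ∘ₗ S.ι i = g := by
  have e := S.projRes.isoExt (R := R) (i + 1) (ModuleCat.of R Y)
  have hz : IsZero ((S.projRes.complex.linearYonedaObj R (ModuleCat.of R Y)).homology (i + 1)) :=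
    (@ModuleCat.isZero_of_subsingleton R _ (ExtM R (i + 1) (S.Z 0) Y) h).of_iso e.symm
  rw [← HomologicalComplex.exactAt_iff_isZero_homology,
    HomologicalComplex.exactAt_iff' _ i (i + 1) (i + 2) (by simp) (by simp),
    ShortComplex.moduleCat_exact_iff] at hz
  obtain ⟨g', hg'⟩ := hz (ModuleCat.ofHom (g ∘ₗ S.π (i + 1))) (by
    change S.complex.d (i + 2) (i + 1) ≫ ModuleCat.ofHom (g ∘ₗ S.π (i + 1)) = 0
    rw [complex_d]
    ext x
    have := (S.exact (i + 1)).apply_apply_eq_zero (S.π (i + 2) x)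
    change g (S.π (i + 1) (S.ι (i + 1) (S.π (i + 2) x))) = 0
    rw [this, map_zero])
  refine ⟨ModuleCat.Hom.hom g', ?_⟩
  change S.complex.d (i + 1) i ≫ g' = ModuleCat.ofHom (g ∘ₗ S.π (i + 1)) at hg'
  rw [complex_d] at hg'
  ext z
  obtain ⟨x, rfl⟩ := S.π_surjective (i + 1) z
  exact LinearMap.congr_fun (congrArg ModuleCat.Hom.hom hg') x

end FlatRes

end Comparison

/-! ### The structure of injective modules over a noetherian ring -/

section Matlis

variable {R : Type u} [CommRing R]

lemma exists_comp_eq_of_ker_le {A B C : Type u} [AddCommGroup A] [Module R A] [AddCommGroup B]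
    [Module R B] [AddCommGroup C] [Module R C] [hC : Module.Injective R C] (f : A →ₗ[R] B)
    (g : A →ₗ[R] C) (h : LinearMap.ker f ≤ LinearMap.ker g) : ∃ h : B →ₗ[R] C, h ∘ₗ f = g := by
  obtain ⟨k, hk⟩ := Module.Injective.extension_property R C _ _ ((LinearMap.ker f).liftQ f le_rfl)
    (LinearMap.ker_eq_bot.1 (Submodule.ker_liftQ_eq_bot _ _ _ le_rfl))
    ((LinearMap.ker f).liftQ g h)
  refine ⟨k, ?_⟩
  ext x
  exact LinearMap.congr_fun hk (Submodule.Quotient.mk x)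

lemma injective_of_retract {A B : Type u} [AddCommGroup A] [Module R A] [AddCommGroup B]
    [Module R B] [hB : Module.Injective R B] (i : A →ₗ[R] B) (r : B →ₗ[R] A)
    (h : ∀ a, r (i a) = a) : Module.Injective R A :=
  ⟨fun X Y _ _ _ _ f hf g => by
    obtain ⟨k, hk⟩ := hB.out f hf (i ∘ₗ g)
    exact ⟨r ∘ₗ k, fun x => by rw [LinearMap.comp_apply, hk, LinearMap.comp_apply, h]⟩⟩

lemma injective_of_equiv {A B : Type u} [AddCommGroup A] [Module R A] [AddCommGroup B]
    [Module R B] (hB : Module.Injective R B) (e : A ≃ₗ[R] B) : Module.Injective R A :=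
  injective_of_retract (e : A →ₗ[R] B) e.symm e.symm_apply_apply

lemma injective_of_subsingleton (A : Type u) [AddCommGroup A] [Module R A] [Subsingleton A] :
    Module.Injective R A :=
  ⟨fun _ _ _ _ _ _ _ _ _ => ⟨0, fun _ => Subsingleton.elim _ _⟩⟩

lemma PropT.of_equiv {p : Ideal R} {A B : Type u} [AddCommGroup A] [Module R A] [AddCommGroup B]
    [Module R B] (hA : PropT R p A) (e : A ≃ₗ[R] B) : PropT R p B := by
  refine ⟨fun r hr => ?_, fun x => ?_⟩
  · have : (fun s : B => r • s) = e ∘ (fun s : A => r • s) ∘ e.symm := by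
      ext x; simp
    rw [this]
    exact e.bijective.comp ((hA.1 r hr).comp e.symm.bijective)
  · obtain ⟨m, hm, h⟩ := hA.2 (e.symm x)
    exact ⟨m, hm, fun a ha => e.symm.injective (by rw [map_smul, h a ha, map_zero])⟩

open Classical in
lemma exists_finset_sum_lof_component {κ : Type u} (X : κ → Type u)
    [∀ j, AddCommGroup (X j)] [∀ j, Module R (X j)] (D : Type u) [AddCommGroup D] [Module R D]
    [Module.Finite R D] (f : D →ₗ[R] ⨁ j, X j) : ∃ J : Finset κ,
      ∑ j ∈ J, DirectSum.lof R κ X j ∘ₗ DirectSum.component R κ X j ∘ₗ f = f := by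
  obtain ⟨s, hs⟩ := Module.Finite.fg_top (R := R) (M := D)
  choose J hJ using directSum_exists_finset (R := R) X
  refine ⟨s.biUnion fun d => J (f d), ?_⟩
  apply LinearMap.ext_on hs
  intro d hd
  rw [LinearMap.sum_apply]
  exact hJ (f d) _ (Finset.subset_biUnion_of_mem (fun d => J (f d)) hd)

/-- The submodule of elements killed by some ideal in a multiplicative family. -/
def idealTorsion (𝒥 : Submonoid (Ideal R)) (C : Type u) [AddCommGroup C] [Module R C] :
    Submodule R C where
  carrier := {y | ∃ J ∈ 𝒥, ∀ a ∈ J, a • y = 0}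
  add_mem' := by
    rintro x y ⟨J, hJ, hx⟩ ⟨K, hK, hy⟩
    refine ⟨J * K, 𝒥.mul_mem hJ hK, fun a ha => ?_⟩
    rw [smul_add, hx a ((Ideal.mul_le_left : J * K ≤ J) ha),
      hy a ((Ideal.mul_le_right : J * K ≤ K) ha), add_zero]
  zero_mem' := ⟨1, 𝒥.one_mem, fun a _ => smul_zero a⟩
  smul_mem' := by
    rintro r x ⟨J, hJ, hx⟩
    exact ⟨J, hJ, fun a ha => by rw [smul_comm, hx a ha, smul_zero]⟩

lemma exists_ideal_smul_eq_zero (𝒥 : Submonoid (Ideal R)) {C : Type u} [AddCommGroup C]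
    [Module R C] (P : Submodule R C) (hP : P.FG) (h : P ≤ idealTorsion 𝒥 C) :
    ∃ J ∈ 𝒥, ∀ a ∈ J, ∀ y ∈ P, a • y = 0 := by
  induction P, hP using Submodule.fg_induction with
  | singleton x =>
    obtain ⟨J, hJ, hx⟩ := h (Submodule.mem_span_singleton_self x)
    refine ⟨J, hJ, fun a ha y hy => ?_⟩
    obtain ⟨r, rfl⟩ := Submodule.mem_span_singleton.1 hy
    rw [smul_comm, hx a ha, smul_zero]
  | sup P Q _ _ hP hQ =>
    obtain ⟨J, hJ, hx⟩ := hP (le_sup_left.trans h)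
    obtain ⟨K, hK, hy⟩ := hQ (le_sup_right.trans h)
    refine ⟨J * K, 𝒥.mul_mem hJ hK, fun a ha z hz => ?_⟩
    obtain ⟨x, hx', y, hy', rfl⟩ := Submodule.mem_sup.1 hz
    rw [smul_add, hx a ((Ideal.mul_le_left : J * K ≤ J) ha) x hx',
      hy a ((Ideal.mul_le_right : J * K ≤ K) ha) y hy', add_zero]

variable [IsNoetherianRing R]

open Classical in
/-- Over a noetherian ring, direct sums of injective modules are injective. -/
lemma injective_directSum {κ : Type u} (X : κ → Type u) [∀ j, AddCommGroup (X j)]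
    [∀ j, Module R (X j)] (h : ∀ j, Module.Injective R (X j)) :
    Module.Injective R (⨁ j, X j) := by
  refine Module.Baer.injective fun I g => ?_
  obtain ⟨J, hJ⟩ := exists_finset_sum_lof_component X I g
  choose k hk using fun j => Module.Baer.of_injective (h j) I (DirectSum.component R κ X j ∘ₗ g)
  refine ⟨∑ j ∈ J, DirectSum.lof R κ X j ∘ₗ k j, fun x hx => ?_⟩
  conv_rhs => rw [← hJ]
  simp only [LinearMap.sum_apply, LinearMap.comp_apply, hk _ x hx]

lemma injective_idealTorsion (𝒥 : Submonoid (Ideal R)) (C : Type u) [AddCommGroup C] [Module R C]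
    [hC : Module.Injective R C] : Module.Injective R (idealTorsion 𝒥 C) := by
  refine Module.Baer.injective fun I g => ?_
  let g' : I →ₗ[R] C := (idealTorsion 𝒥 C).subtype ∘ₗ g
  obtain ⟨J, hJ, h⟩ := exists_ideal_smul_eq_zero 𝒥 (LinearMap.range g')
    (IsNoetherian.noetherian (R := R) (⊤ : Submodule R I) |>.map g' |> fun h => by
      rwa [Submodule.map_top] at h) (by
      rintro _ ⟨x, rfl⟩
      exact (g x).2)
  obtain ⟨k, hk⟩ := J.exists_pow_inf_eq_pow_smul (M := R) I
  have hle : ∀ x : I, (x : R) ∈ J ^ (k + 1) → g' x = 0 := by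
    intro x hx
    have hx' : (x : R) ∈ J • (J ^ k • ⊤ ⊓ I : Submodule R R) := by
      have := hk (k + 1) (Nat.le_succ k)
      rw [Nat.add_sub_cancel_left, pow_one] at this
      rw [← this]
      exact ⟨by simpa using hx, x.2⟩
    have hx'' : x ∈ J • (⊤ : Submodule R I) := by
      have h₁ : (J • (⊤ : Submodule R I)).map I.subtype = J • I := by
        rw [Submodule.map_smul'', Submodule.map_top, Submodule.range_subtype]
      have : (x : R) ∈ (J • (⊤ : Submodule R I)).map I.subtype := by
        rw [h₁]
        exact Submodule.smul_mono le_rfl inf_le_right hx'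
      obtain ⟨y, hy, hyx⟩ := this
      rwa [← Subtype.ext hyx]
    refine Submodule.smul_induction_on hx'' (fun a ha n _ => ?_) fun a b ha hb => ?_
    · rw [map_smul]
      exact h a ha _ ⟨n, rfl⟩
    · rw [map_add, ha, hb, add_zero]
  obtain ⟨l, hl⟩ := exists_comp_eq_of_ker_le ((J ^ (k + 1)).mkQ ∘ₗ I.subtype) g' fun x hx =>
    hle x ((Submodule.Quotient.mk_eq_zero _).1 hx)
  refine ⟨(l ∘ₗ (J ^ (k + 1)).mkQ).codRestrict _ fun r => ?_, fun x hx => ?_⟩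
  · refine ⟨J ^ (k + 1), 𝒥.pow_mem hJ _, fun a ha => ?_⟩
    rw [LinearMap.comp_apply, ← map_smul, ← map_smul, Submodule.mkQ_apply, smul_eq_mul,
      (Submodule.Quotient.mk_eq_zero _).2 ((J ^ (k + 1)).mul_mem_right r ha), map_zero]
  · exact Subtype.ext (LinearMap.congr_fun hl ⟨x, hx⟩)

/-- The ideals containing a power of `p`. -/
def powFamily (p : Ideal R) : Submonoid (Ideal R) where
  carrier := {J | ∃ n, p ^ n ≤ J}
  mul_mem' := by
    rintro J K ⟨n, hn⟩ ⟨m, hm⟩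
    exact ⟨n + m, by rw [pow_add]; exact Ideal.mul_mono hn hm⟩
  one_mem' := ⟨0, by simp⟩

/-- The ideals which contain a power of `p` and are not contained in `p`. -/
def powFamily' (p : Ideal R) [hp : p.IsPrime] : Submonoid (Ideal R) where
  carrier := {J | (∃ n, p ^ n ≤ J) ∧ ∃ s ∉ p, s ∈ J}
  mul_mem' := by
    rintro J K ⟨⟨n, hn⟩, s, hs, hs'⟩ ⟨⟨m, hm⟩, t, ht, ht'⟩
    exact ⟨⟨n + m, by rw [pow_add]; exact Ideal.mul_mono hn hm⟩, s * t,
      fun h => (hp.mem_or_mem h).elim hs ht, Ideal.mul_mem_mul hs' ht'⟩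
  one_mem' := ⟨⟨0, by simp⟩, 1, fun h => hp.ne_top ((Ideal.eq_top_iff_one p).2 h), by simp⟩

/-- Every nonzero injective module contains a nonzero injective submodule with property `t(p)`
for some prime `p`. -/
lemma exists_injective_propT (C : Type u) [AddCommGroup C] [Module R C]
    [hC : Module.Injective R C] [Nontrivial C] : ∃ L : Submodule R C, L ≠ ⊥ ∧
      Module.Injective R L ∧ ∃ p : Ideal R, p.IsPrime ∧ PropT R p L := by
  obtain ⟨p, hp⟩ := associatedPrimes.nonempty R C
  obtain ⟨hp, f, hf⟩ := (isAssociatedPrime_iff_exists_injective_linearMap _ _).1 hp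
  have hT := injective_idealTorsion (powFamily p) C
  have hS := injective_idealTorsion (powFamily' p) C
  set T := idealTorsion (powFamily p) C with hTdef
  set S := idealTorsion (powFamily' p) C with hSdef
  have hST : S ≤ T := fun y ⟨J, hJ, hy⟩ => ⟨J, hJ.1, hy⟩
  obtain ⟨r, hr⟩ := Module.Injective.extension_property R S _ _ S.subtype S.injective_subtype
    LinearMap.id
  have hr' : ∀ y : S, r y = y := fun y => LinearMap.congr_fun hr y
  have hinj : Module.Injective R (T ⊓ LinearMap.ker r : Submodule R C) := by
    refine injective_of_retract (B := T) (Submodule.inclusion inf_le_left)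
      (((LinearMap.id - S.subtype ∘ₗ r) ∘ₗ T.subtype).codRestrict _ fun y =>
        ⟨T.sub_mem y.2 (hST (r y).2), ?_⟩) fun y => ?_
    · change r (y - r y) = 0
      rw [map_sub, hr', sub_self]
    · ext
      change (y : C) - r y = y
      rw [(LinearMap.mem_ker.1 y.2.2 : r y = 0), Submodule.coe_zero, sub_zero]
  have hpow : ∀ y ∈ T, ∃ n, 0 < n ∧ ∀ a ∈ p ^ n, a • y = 0 := by
    rintro y ⟨J, ⟨n, hn⟩, hy⟩
    exact ⟨n + 1, n.succ_pos, fun a ha => hy a (hn (Ideal.pow_le_pow_right n.le_succ ha))⟩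
  have hreg : ∀ s ∉ p, Function.Injective fun y : (T ⊓ LinearMap.ker r : Submodule R C) =>
      s • y := by
    intro s hs y z hyz
    have hyz : s • (y - z) = 0 := by rw [smul_sub]; exact sub_eq_zero.2 hyz
    set w := y - z with hw
    have hwS : (w : C) ∈ S := by
      obtain ⟨n, -, hn⟩ := hpow w w.2.1
      refine ⟨p ^ n ⊔ Ideal.span {s}, ⟨⟨n, le_sup_left⟩, s, hs,
        Ideal.mem_sup_right (Ideal.mem_span_singleton_self s)⟩, fun a ha => ?_⟩
      obtain ⟨b, hb, c, hc, rfl⟩ := Submodule.mem_sup.1 ha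
      obtain ⟨d, rfl⟩ := Ideal.mem_span_singleton'.1 hc
      rw [add_smul, hn b hb, mul_smul, ← Submodule.coe_smul, hyz, Submodule.coe_zero, smul_zero,
        add_zero]
    have h0 : r w = 0 := w.2.2
    have h1 : r w = ⟨w, hwS⟩ := hr' ⟨w, hwS⟩
    have : (w : C) = 0 := congrArg Subtype.val (h1.symm.trans h0)
    exact sub_eq_zero.1 (Subtype.ext this)
  refine ⟨T ⊓ LinearMap.ker r, fun hbot => ?_, hinj, p, hp, fun s hs => ⟨hreg s hs, ?_⟩,
    fun y => ?_⟩
  · have h1 : f 1 ∈ T := ⟨p, ⟨1, by simp⟩, fun a ha => by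
      rw [← map_smul, Algebra.smul_def, mul_one]
      exact (congrArg f (Ideal.Quotient.eq_zero_iff_mem.2 ha)).trans (map_zero f)⟩
    have h2 : f 1 - r (f 1) ∈ (T ⊓ LinearMap.ker r : Submodule R C) :=
      ⟨T.sub_mem h1 (hST (r (f 1)).2), by
        change r (f 1 - r (f 1)) = 0
        rw [map_sub, hr', sub_self]⟩
    rw [hbot, Submodule.mem_bot, sub_eq_zero] at h2
    obtain ⟨J, ⟨-, s, hs, hsJ⟩, hJ⟩ := (r (f 1)).2
    have h3 := hJ s hsJ
    rw [← h2, ← map_smul, Algebra.smul_def, mul_one] at h3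
    exact hs (Ideal.Quotient.eq_zero_iff_mem.1 (hf (h3.trans (map_zero f).symm)))
  · obtain ⟨k, hk⟩ := Module.Injective.extension_property R _ _ _
      (s • LinearMap.id : (T ⊓ LinearMap.ker r : Submodule R C) →ₗ[R] _) (hreg s hs)
      LinearMap.id
    intro y
    refine ⟨k y, ?_⟩
    have := LinearMap.congr_fun hk y
    simpa using this
  · obtain ⟨n, hn, h⟩ := hpow y y.2.1
    exact ⟨n, hn, fun a ha => Subtype.ext (h a ha)⟩

end Matlis

section Zorn

lemma sSupIndep_insert {α : Type*} [CompleteLattice α] [IsModularLattice α] {s : Set α} {a : α}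
    (hs : sSupIndep s) (ha : Disjoint a (sSup s)) : sSupIndep (insert a s) := by
  intro x hx
  by_cases hxa : x = a
  · subst hxa
    refine ha.mono_right (sSup_le_sSup ?_)
    rintro y ⟨rfl | hy, hy'⟩
    · exact absurd rfl hy'
    · exact hy
  · have hxs : x ∈ s := hx.resolve_left hxa
    rw [Set.insert_sdiff_of_notMem _ (by simpa using Ne.symm hxa), sSup_insert, sup_comm]
    apply (hs hxs).disjoint_sup_right_of_disjoint_sup_left
    rw [← sSup_insert, Set.insert_sdiff_singleton, Set.insert_eq_of_mem hxs]
    exact ha.symm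

variable {R : Type u} [CommRing R]

lemma directSum_equiv_sSup {C : Type u} [AddCommGroup C] [Module R C] {s : Set (Submodule R C)}
    (hs : sSupIndep s) : Nonempty ((⨁ L : s, L.1) ≃ₗ[R] ↥(sSup s)) := by
  classical
  have h : iSupIndep fun L : s => L.1 := (sSupIndep_iff s).1 hs
  refine ⟨LinearEquiv.ofInjective _ h.dfinsupp_lsum_injective ≪≫ₗ LinearEquiv.ofEq _ _ ?_⟩
  rw [sSup_eq_iSup', Submodule.iSup_eq_range_dfinsupp_lsum]

/-- **Matlis**: an injective module over a noetherian ring is a direct sum of injective modules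
each of which has property `t(p)` for some prime `p`. -/
lemma exists_directSum_propT [IsNoetherianRing R] (C : Type u) [AddCommGroup C] [Module R C]
    [hC : Module.Injective R C] : ∃ (κ : Type u) (X : κ → ModuleCat.{u} R),
      (∀ j, Module.Injective R (X j)) ∧ (∀ j, ∃ p : Ideal R, p.IsPrime ∧ PropT R p (X j)) ∧
      Nonempty (C ≃ₗ[R] ⨁ j, X j) := by
  obtain ⟨s, hs⟩ := zorn_subset {s : Set (Submodule R C) | sSupIndep s ∧
      ∀ L ∈ s, L ≠ ⊥ ∧ Module.Injective R L ∧ ∃ p : Ideal R, p.IsPrime ∧ PropT R p L}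
    fun c hc hc' => ⟨⋃₀ c, ⟨iSupIndep_sUnion_of_directed hc'.directedOn fun s hs => (hc hs).1,
      fun L ⟨s, hs, hL⟩ => (hc hs).2 L hL⟩, fun _ => Set.subset_sUnion_of_mem⟩
  obtain ⟨e⟩ := directSum_equiv_sSup hs.prop.1
  have hinj : Module.Injective R ↥(sSup s) :=
    injective_of_equiv (injective_directSum (fun L : s => L.1) fun L => (hs.prop.2 L L.2).2.1)
      e.symm
  obtain ⟨r, hr⟩ := Module.Injective.extension_property R _ _ _ (sSup s).subtype
    (sSup s).injective_subtype LinearMap.id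
  have hr' : ∀ y : ↥(sSup s), r y = y := fun y => LinearMap.congr_fun hr y
  have htop : sSup s = ⊤ := by
    by_contra hne
    have hK : Module.Injective R (LinearMap.ker r) :=
      injective_of_retract (LinearMap.ker r).subtype
        ((LinearMap.id - (sSup s).subtype ∘ₗ r).codRestrict _ fun y => by
          change r (y - r y) = 0
          rw [map_sub, hr', sub_self]) fun y => by
        ext
        change (y : C) - r y = y
        rw [(LinearMap.mem_ker.1 y.2 : r y = 0), Submodule.coe_zero, sub_zero]
    have hnt : Nontrivial (LinearMap.ker r) := by
      rw [Submodule.nontrivial_iff_ne_bot]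
      intro hbot
      refine hne (Submodule.eq_top_iff'.2 fun y => ?_)
      have h : y - r y ∈ LinearMap.ker r := by rw [LinearMap.mem_ker, map_sub, hr', sub_self]
      rw [hbot, Submodule.mem_bot, sub_eq_zero] at h
      rw [h]
      exact (r y).2
    have hbot (L : Submodule R (LinearMap.ker r)) :
        L.map (LinearMap.ker r).subtype = ⊥ ↔ L = ⊥ := by
      rw [← Submodule.map_bot (LinearMap.ker r).subtype,
        (Submodule.map_injective_of_injective (Submodule.injective_subtype _)).eq_iff]
    obtain ⟨L, hL0, hLi, p, hp, hLp⟩ := exists_injective_propT (R := R) (LinearMap.ker r)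
    let e' : L ≃ₗ[R] L.map (LinearMap.ker r).subtype :=
      L.equivMapOfInjective _ (Submodule.injective_subtype _)
    have hdisj : Disjoint (L.map (LinearMap.ker r).subtype) (sSup s) := by
      rw [Submodule.disjoint_def]
      rintro _ ⟨x, -, rfl⟩ hx
      have h0 : r x = 0 := x.2
      exact congrArg Subtype.val ((hr' ⟨x, hx⟩).symm.trans h0)
    have hmem : L.map (LinearMap.ker r).subtype ∈ s := by
      have := hs.le_of_ge (y := insert (L.map (LinearMap.ker r).subtype) s)
        ⟨sSupIndep_insert hs.prop.1 hdisj, ?_⟩ (Set.subset_insert _ _)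
      · exact this (Set.mem_insert _ _)
      · rintro M (rfl | hM)
        · exact ⟨fun h => hL0 ((hbot L).1 h), injective_of_equiv hLi e'.symm, p, hp,
            hLp.of_equiv e'⟩
        · exact hs.prop.2 M hM
    have := hdisj.eq_bot_of_le (le_sSup hmem)
    exact hL0 ((hbot L).1 this)
  exact ⟨s, fun L => ModuleCat.of R L.1, fun L => (hs.prop.2 L L.2).2.1,
    fun L => (hs.prop.2 L L.2).2.2,
    ⟨(e ≪≫ₗ LinearEquiv.ofTop _ htop).symm⟩⟩

end Zorn

/-! ### Duality and vanishing of torsion modules -/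

section Duality

variable {R : Type u} [CommRing R]

lemma exists_comp_eq_of_surjective {A B C : Type u} [AddCommGroup A] [Module R A] [AddCommGroup B]
    [Module R B] [AddCommGroup C] [Module R C] (f : A →ₗ[R] B) (hf : Function.Surjective f)
    (g : A →ₗ[R] C) (h : LinearMap.ker f ≤ LinearMap.ker g) : ∃ h : B →ₗ[R] C, h ∘ₗ f = g := by
  refine ⟨(LinearMap.ker f).liftQ g h ∘ₗ (f.quotKerEquivOfSurjective hf).symm,
    LinearMap.ext fun v => ?_⟩
  have : (f.quotKerEquivOfSurjective hf).symm (f v) = Submodule.Quotient.mk v := by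
    rw [LinearEquiv.symm_apply_eq]; rfl
  exact congrArg ((LinearMap.ker f).liftQ g h) this

section

variable (N D E : Type u) [AddCommGroup N] [Module R N] [AddCommGroup D] [Module R D]
  [AddCommGroup E] [Module R E]

/-- The Hom-evaluation map `N ⊗ Hom(D, E) → Hom(Hom(N, D), E)`. -/
noncomputable def homEval : N ⊗[R] (D →ₗ[R] E) →ₗ[R] ((N →ₗ[R] D) →ₗ[R] E) :=
  TensorProduct.lift (LinearMap.mk₂ R (fun n φ => φ ∘ₗ LinearMap.applyₗ n)
    (fun _ _ _ => by ext; simp) (fun _ _ _ => by ext; simp) (fun _ _ _ => by ext; simp)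
    (fun _ _ _ => by ext; simp))

variable {N D E}

@[simp] lemma homEval_tmul (n : N) (φ : D →ₗ[R] E) (g : N →ₗ[R] D) :
    homEval N D E (n ⊗ₜ φ) g = φ (g n) := rfl

lemma homEval_rTensor {N' : Type u} [AddCommGroup N'] [Module R N'] (f : N →ₗ[R] N')
    (x : N ⊗[R] (D →ₗ[R] E)) (g : N' →ₗ[R] D) :
    homEval N' D E (f.rTensor _ x) g = homEval N D E x (g ∘ₗ f) := by
  induction x with
  | zero => simp
  | tmul n φ => simp
  | add x y hx hy => simp [hx, hy]

lemma exists_sum_single_tmul {m : ℕ} {H : Type u} [AddCommGroup H] [Module R H]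
    (x : (Fin m → R) ⊗[R] H) : ∃ φ : Fin m → H, ∑ i, (Pi.single i (1 : R)) ⊗ₜ φ i = x := by
  induction x with
  | zero => exact ⟨0, by simp⟩
  | tmul v φ =>
    refine ⟨fun i => v i • φ, ?_⟩
    simp_rw [← TensorProduct.smul_tmul, ← TensorProduct.sum_tmul]
    congr 1
    ext j
    simp [Pi.single_apply]
  | add x y hx hy =>
    obtain ⟨φ, rfl⟩ := hx
    obtain ⟨ψ, rfl⟩ := hy
    exact ⟨φ + ψ, by simp [TensorProduct.tmul_add, Finset.sum_add_distrib]⟩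

lemma homEval_pi_injective (m : ℕ) : Function.Injective (homEval (R := R) (Fin m → R) D E) := by
  rw [injective_iff_map_eq_zero]
  intro x hx
  obtain ⟨φ, rfl⟩ := exists_sum_single_tmul x
  have : φ = 0 := by
    ext i d
    have := LinearMap.congr_fun hx ((LinearMap.proj i : (Fin m → R) →ₗ[R] R).smulRight d)
    simpa [Pi.single_apply, ite_smul, apply_ite] using this
  simp [this]

lemma homEval_pi_surjective (m : ℕ) : Function.Surjective (homEval (R := R) (Fin m → R) D E) := by
  intro w
  refine ⟨∑ i, (Pi.single i (1 : R)) ⊗ₜ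
    (w ∘ₗ LinearMap.smulRightₗ (LinearMap.proj i : (Fin m → R) →ₗ[R] R)), ?_⟩
  ext g
  simp only [map_sum, LinearMap.sum_apply, homEval_tmul, LinearMap.comp_apply]
  rw [← map_sum]
  congr 1
  refine LinearMap.pi_ext' fun j => ?_
  ext
  simp [Pi.single_apply, ite_smul]

variable [hE : Module.Injective R E]

lemma homEval_surjective [Module.Finite R N] : Function.Surjective (homEval (R := R) N D E) := by
  intro w
  obtain ⟨m, p, hp⟩ := Module.Finite.exists_fin' R N
  obtain ⟨w', hw'⟩ := exists_comp_eq_of_ker_le (LinearMap.lcomp R D p) w fun g hg => by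
    have : g = 0 := by
      ext n
      obtain ⟨v, rfl⟩ := hp n
      exact LinearMap.congr_fun hg v
    rw [this]
    exact Submodule.zero_mem _
  obtain ⟨x, hx⟩ := homEval_pi_surjective m w'
  refine ⟨p.rTensor _ x, ?_⟩
  ext g
  rw [homEval_rTensor, hx, ← hw']
  rfl

lemma homEval_injective [IsNoetherianRing R] [Module.Finite R N] :
    Function.Injective (homEval (R := R) N D E) := by
  rw [injective_iff_map_eq_zero]
  intro x hx
  obtain ⟨m, p, hp⟩ := Module.Finite.exists_fin' R N
  obtain ⟨x, rfl⟩ := p.rTensor_surjective _ hp x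
  obtain ⟨w, hw⟩ := exists_comp_eq_of_ker_le (LinearMap.lcomp R D (LinearMap.ker p).subtype)
    (homEval (R := R) (Fin m → R) D E x) fun g hg => by
      have hg' : ∀ v, p v = 0 → g v = 0 := fun v hv => LinearMap.congr_fun hg ⟨v, hv⟩
      obtain ⟨g', hg''⟩ : ∃ g' : N →ₗ[R] D, g' ∘ₗ p = g :=
        exists_comp_eq_of_surjective p hp g hg'
      rw [LinearMap.mem_ker, ← hg'', ← homEval_rTensor, hx, LinearMap.zero_apply]
  obtain ⟨y, rfl⟩ := homEval_surjective w
  have : (LinearMap.ker p).subtype.rTensor _ y = x := by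
    apply homEval_pi_injective
    ext1 g
    rw [homEval_rTensor, ← hw]
    rfl
  rw [← this, ← LinearMap.comp_apply, ← LinearMap.rTensor_comp, LinearMap.comp_ker_subtype,
    LinearMap.rTensor_zero, LinearMap.zero_apply]

lemma rTensor_hom_injective [IsNoetherianRing R] {Z Q : Type u} [AddCommGroup Z] [Module R Z]
    [AddCommGroup Q] [Module R Q] [Module.Finite R Z] (f : Z →ₗ[R] Q)
    (h : ∀ g : Z →ₗ[R] D, ∃ g' : Q →ₗ[R] D, g' ∘ₗ f = g) :
    Function.Injective (f.rTensor (D →ₗ[R] E)) := by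
  rw [injective_iff_map_eq_zero]
  intro x hx
  refine (injective_iff_map_eq_zero _).1 homEval_injective x ?_
  ext1 g
  obtain ⟨g', rfl⟩ := h g
  rw [← homEval_rTensor, hx, map_zero]
  rfl

end

namespace FlatRes

lemma exists_extension_of_injDimLE (S : FlatRes R) [∀ n, Module.Projective R (S.Q n)] (n : ℕ) :
    ∀ (i : ℕ) (D : ModuleCat.{u} R), n ≤ i → InjDimLE R n D → ∀ g : S.Z (i + 1) →ₗ[R] D,
      ∃ g' : S.Q i →ₗ[R] D, g' ∘ₗ S.ι i = g := by
  induction n with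
  | zero =>
    intro i D _ hD g
    exact Module.Injective.extension_property (inj := hD) R D _ _ (S.ι i) (S.ι_injective i) g
  | succ n ih =>
    intro i D hi hD g
    obtain ⟨j, rfl⟩ : ∃ j, i = j + 1 := ⟨i - 1, by omega⟩
    obtain ⟨I, hI, κ, hκ, hD'⟩ := hD
    obtain ⟨h, hh⟩ := Module.Injective.extension_property R I _ _ (S.ι (j + 1))
      (S.ι_injective (j + 1)) (κ ∘ₗ g)
    have hker : LinearMap.ker (S.π (j + 1)) ≤
        LinearMap.ker ((LinearMap.range κ).mkQ ∘ₗ h) := by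
      intro q hq
      obtain ⟨z, rfl⟩ := (S.exact (j + 1) q).1 hq
      rw [LinearMap.mem_ker, LinearMap.comp_apply, Submodule.mkQ_apply,
        Submodule.Quotient.mk_eq_zero]
      exact ⟨g z, (LinearMap.congr_fun hh z).symm⟩
    obtain ⟨g', hg'⟩ : ∃ g' : S.Z (j + 1) →ₗ[R] (I ⧸ LinearMap.range κ),
        g' ∘ₗ S.π (j + 1) = (LinearMap.range κ).mkQ ∘ₗ h :=
      exists_comp_eq_of_surjective _ (S.π_surjective _) _ hker
    obtain ⟨g'', hg''⟩ := ih j _ (by omega) hD' g'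
    obtain ⟨l, hl⟩ := Module.projective_lifting_property (LinearMap.range κ).mkQ g''
      (Submodule.mkQ_surjective _)
    let m : S.Q (j + 1) →ₗ[R] I := h - l ∘ₗ S.ι j ∘ₗ S.π (j + 1)
    have hm : ∀ q, m q ∈ LinearMap.range κ := by
      intro q
      rw [← Submodule.Quotient.mk_eq_zero, ← Submodule.mkQ_apply]
      change (LinearMap.range κ).mkQ (h q - l (S.ι j (S.π (j + 1) q))) = 0
      rw [map_sub, sub_eq_zero]
      have h1 := LinearMap.congr_fun hg' q
      have h2 := LinearMap.congr_fun hg'' (S.π (j + 1) q)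
      have h3 := LinearMap.congr_fun hl (S.ι j (S.π (j + 1) q))
      exact h1.symm.trans (h2.symm.trans h3.symm)
    refine ⟨(LinearEquiv.ofInjective κ hκ).symm ∘ₗ m.codRestrict _ hm, ?_⟩
    ext1 z
    rw [LinearMap.comp_apply, LinearMap.comp_apply, LinearEquiv.coe_coe,
      LinearEquiv.symm_apply_eq]
    ext1
    change h (S.ι (j + 1) z) - l (S.ι j (S.π (j + 1) (S.ι (j + 1) z))) = κ (g z)
    rw [(S.exact (j + 1)).apply_apply_eq_zero, map_zero, map_zero, sub_zero]
    exact LinearMap.congr_fun hh z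

variable [IsNoetherianRing R] {D E : Type u} [AddCommGroup D] [Module R D] [AddCommGroup E]
  [Module R E] [Module.Injective R E]

lemma can_hom_tor_succ_eq_bot (i : ℕ) (N : Type u) [AddCommGroup N] [Module R N]
    [Module.Finite R N] (h : ∀ g : (fin (R := R) N).Z (i + 1) →ₗ[R] D,
      ∃ g' : (fin (R := R) N).Q i →ₗ[R] D, g' ∘ₗ (fin (R := R) N).ι i = g) :
    (can (R := R) (D →ₗ[R] E)).tor (i + 1) N = ⊥ := by
  obtain ⟨e⟩ := tor_balance (fin (R := R) N) (can (R := R) (D →ₗ[R] E)) (i + 1)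
  have h₁ : (fin (R := R) N).tor (i + 1) (D →ₗ[R] E) = ⊥ :=
    LinearMap.ker_eq_bot.2 (rTensor_hom_injective _ h)
  have : Subsingleton ((fin (R := R) N).tor (i + 1) ((can (R := R) (D →ₗ[R] E)).Z 0)) :=
    Submodule.subsingleton_iff_eq_bot.2 h₁
  exact Submodule.subsingleton_iff_eq_bot.1 e.symm.toEquiv.subsingleton

lemma can_hom_tor_eq_bot_of_injDimLE {n : ℕ} (h : InjDimLE R n (ModuleCat.of R D)) (k : ℕ)
    (hk : n < k) (M : Type u) [AddCommGroup M] [Module R M] :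
    (can (R := R) (D →ₗ[R] E)).tor k M = ⊥ := by
  obtain ⟨i, rfl⟩ : ∃ i, k = i + 1 := ⟨k - 1, by omega⟩
  refine tor_eq_bot_of_fg _ _ fun P hP => ?_
  have : Module.Finite R P := Module.Finite.iff_fg.2 hP
  exact can_hom_tor_succ_eq_bot i P
    ((fin (R := R) P).exists_extension_of_injDimLE n i (ModuleCat.of R D) (by omega) h)

lemma can_hom_tor_self_eq_bot [Module.Finite R D]
    (h : ∀ i, 1 ≤ i → Subsingleton (ExtM R i D D)) (k : ℕ) (hk : 1 ≤ k) :
    (can (R := R) (D →ₗ[R] E)).tor k D = ⊥ := by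
  obtain ⟨i, rfl⟩ : ∃ i, k = i + 1 := ⟨k - 1, by omega⟩
  exact can_hom_tor_succ_eq_bot i D
    ((fin (R := R) D).exists_extension_of_extM i D (h (i + 1) hk))

end FlatRes

end Duality

/-! ### Torsion modules with property `t(p)` are concentrated in one degree -/

section PropT

variable {R : Type u} [CommRing R] {p : Ideal R}

section

variable {A B : Type u} [AddCommGroup A] [Module R A] [AddCommGroup B] [Module R B]

lemma PropT.tensor (hA : PropT R p A) (Z : Type u) [AddCommGroup Z] [Module R Z] :
    PropT R p (Z ⊗[R] A) := by
  refine ⟨fun s hs => ?_, fun x => ?_⟩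
  · let e : A ≃ₗ[R] A := LinearEquiv.ofBijective (s • LinearMap.id) (hA.1 s hs)
    have : (fun x : Z ⊗[R] A => s • x) = e.lTensor Z := by
      ext x
      change s • x = (s • (LinearMap.id : A →ₗ[R] A)).lTensor Z x
      simp
    rw [this]
    exact (e.lTensor Z).bijective
  · have : x ∈ idealTorsion (powFamily p) (Z ⊗[R] A) := by
      induction x with
      | zero => exact Submodule.zero_mem _
      | add x y hx hy => exact Submodule.add_mem _ hx hy
      | tmul z a =>
        obtain ⟨m, -, hm⟩ := hA.2 a
        exact ⟨p ^ m, ⟨m, le_rfl⟩, fun r hr => by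
          rw [← TensorProduct.tmul_smul, hm r hr, TensorProduct.tmul_zero]⟩
    obtain ⟨J, ⟨m, hm⟩, hJ⟩ := this
    exact ⟨m + 1, m.succ_pos, fun a ha => hJ a (hm (Ideal.pow_le_pow_right m.le_succ ha))⟩

lemma PropT.ker (hA : PropT R p A) (hB : PropT R p B) (f : A →ₗ[R] B) :
    PropT R p (LinearMap.ker f) := by
  refine ⟨fun s hs => ⟨fun x y hxy => Subtype.ext ((hA.1 s hs).1 (congrArg Subtype.val hxy)),
    fun y => ?_⟩, fun x => ?_⟩
  · obtain ⟨x, hx⟩ := (hA.1 s hs).2 y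
    refine ⟨⟨x, (hB.1 s hs).1 ?_⟩, Subtype.ext hx⟩
    change s • f x = s • 0
    rw [← map_smul, smul_zero]
    exact (congrArg f hx).trans y.2
  · obtain ⟨m, hm, h⟩ := hA.2 x
    exact ⟨m, hm, fun a ha => Subtype.ext (h a ha)⟩

lemma PropT.hom [Module.Finite R B] (hA : PropT R p A) : PropT R p (B →ₗ[R] A) := by
  refine ⟨fun s hs => ⟨fun f g hfg => ?_, fun f => ?_⟩, fun f => ?_⟩
  · ext b
    exact (hA.1 s hs).1 (LinearMap.congr_fun hfg b)
  · let e : A ≃ₗ[R] A := LinearEquiv.ofBijective (s • LinearMap.id) (hA.1 s hs)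
    refine ⟨e.symm ∘ₗ f, ?_⟩
    ext b
    exact e.apply_symm_apply (f b)
  · have hf : (LinearMap.range f).FG := by
      rw [LinearMap.range_eq_map]
      exact Module.Finite.fg_top.map f
    obtain ⟨J, ⟨m, hm⟩, hJ⟩ := exists_ideal_smul_eq_zero (powFamily p) _ hf fun x _ => by
      obtain ⟨m, -, hm⟩ := hA.2 x
      exact ⟨p ^ m, ⟨m, le_rfl⟩, hm⟩
    refine ⟨m + 1, m.succ_pos, fun a ha => ?_⟩
    ext b
    exact hJ a (hm (Ideal.pow_le_pow_right m.le_succ ha)) _ ⟨b, rfl⟩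

lemma PropT.subsingleton_of_smul_eq_zero (hA : PropT R p A) {s : R} (hs : s ∉ p)
    (h : ∀ a : A, s • a = 0) : Subsingleton A :=
  ⟨fun a b => (hA.1 s hs).1 (by simp [h])⟩

lemma PropT.subsingleton_of_smul_injective (hA : PropT R p A) {x : R} (hx : x ∈ p)
    (h : Function.Injective fun a : A => x • a) : Subsingleton A := by
  refine subsingleton_of_forall_eq 0 fun a => ?_
  obtain ⟨m, -, hm⟩ := hA.2 a
  have := hm _ (Ideal.pow_mem_pow hx m)
  clear hm
  induction m with
  | zero => simpa using this
  | succ m ih =>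
    rw [pow_succ', mul_smul] at this
    exact ih (h (by simpa using this))

end

namespace FlatRes

lemma torMap_smul_id (S : FlatRes R) (k : ℕ) (r : R) (M : Type u) [AddCommGroup M] [Module R M] :
    S.torMap k (r • (LinearMap.id : M →ₗ[R] M)) = r • LinearMap.id := by
  rw [torMap_smul, torMap_id]

lemma tor_propT (S : FlatRes R) (k : ℕ) {A : Type u} [AddCommGroup A] [Module R A]
    (hA : PropT R p A) : PropT R p (S.tor k A) :=
  (hA.tensor _).ker (hA.tensor _) _

lemma tor_balance_can (A B : Type u) [AddCommGroup A] [Module R A] [AddCommGroup B] [Module R B]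
    (k : ℕ) : Nonempty ((can (R := R) A).tor k B ≃ₗ[R] (can (R := R) B).tor k A) :=
  tor_balance (can (R := R) A) (can (R := R) B) k

lemma can_tor_propT (k : ℕ) {A : Type u} [AddCommGroup A] [Module R A]
    (hA : PropT R p A) (M : Type u) [AddCommGroup M] [Module R M] :
    PropT R p ((can (R := R) A).tor k M) := by
  obtain ⟨e⟩ := tor_balance_can (R := R) M A k
  exact ((can (R := R) M).tor_propT k hA).of_equiv e

variable (S : FlatRes R)
  (hS : ∀ (k : ℕ) (M : Type u) [AddCommGroup M] [Module R M], PropT R p (S.tor k M))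
  {M : Type u} [AddCommGroup M] [Module R M]

include hS

lemma tor_eq_bot_of_smul_eq_zero (k : ℕ) {s : R} (hs : s ∉ p) (h : ∀ m : M, s • m = 0) :
    S.tor k M = ⊥ := by
  refine Submodule.subsingleton_iff_eq_bot.1 ((hS k M).subsingleton_of_smul_eq_zero hs fun a => ?_)
  have h0 : s • (LinearMap.id : M →ₗ[R] M) = 0 := LinearMap.ext h
  have := LinearMap.congr_fun (S.torMap_smul_id k s M) a
  rw [h0, torMap_zero] at this
  exact this.symm

lemma tor_eq_bot_of_smul_injective (k : ℕ) {x : R} (hx : x ∈ p)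
    (h : Function.Injective (S.torMap k (x • (LinearMap.id : M →ₗ[R] M)))) : S.tor k M = ⊥ := by
  refine Submodule.subsingleton_iff_eq_bot.1 ((hS k M).subsingleton_of_smul_injective hx ?_)
  rw [torMap_smul_id] at h
  exact h

lemma tor_eq_bot_of_propT_ne [hp : p.IsPrime] (k : ℕ) {q : Ideal R} (hqp : q ≠ p)
    (hM : PropT R q M) : S.tor k M = ⊥ := by
  by_cases hle : q ≤ p
  · obtain ⟨x, hxp, hxq⟩ := SetLike.exists_of_lt (lt_of_le_of_ne hle hqp)
    refine S.tor_eq_bot_of_smul_injective hS k hxp ?_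
    let e : M ≃ₗ[R] M := LinearEquiv.ofBijective (x • LinearMap.id) (hM.1 x hxq)
    have he : e.symm.toLinearMap ∘ₗ (x • LinearMap.id) = LinearMap.id :=
      LinearMap.ext fun m => e.symm_apply_apply m
    refine Function.LeftInverse.injective (g := S.torMap k e.symm.toLinearMap) fun a => ?_
    rw [torMap_comp_apply, he, torMap_id, LinearMap.id_apply]
  · obtain ⟨s, hsq, hsp⟩ := SetLike.not_le_iff_exists.1 hle
    refine S.tor_eq_bot_of_fg k fun P hP => ?_
    obtain ⟨J, ⟨m, hm⟩, hJ⟩ := exists_ideal_smul_eq_zero (powFamily q) P hP fun x _ => by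
      obtain ⟨m, -, hm⟩ := hM.2 x
      exact ⟨q ^ m, ⟨m, le_rfl⟩, hm⟩
    exact S.tor_eq_bot_of_smul_eq_zero hS k (s := s ^ m) (fun h => hsp (hp.mem_of_pow_mem m h))
      fun x => Subtype.ext (hJ _ (hm (Ideal.pow_mem_pow hsq m)) x x.2)

omit hS in
/-- Vanishing on the modules killed by an ideal is detected on quotients by primes. -/
lemma tor_eq_bot_of_quotient_prime [IsNoetherianRing R] (k : ℕ) (I : Ideal R)
    (h : ∀ q : Ideal R, q.IsPrime → I ≤ q → S.tor k (R ⧸ q) = ⊥) [hM : Module.Finite R M]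
    (hI : ∀ a ∈ I, ∀ m : M, a • m = 0) : S.tor k M = ⊥ := by
  induction hM using IsNoetherianRing.induction_on_isQuotientEquivQuotientPrime R with
  | subsingleton N =>
    refine (Submodule.eq_bot_iff _).2 fun x _ => ?_
    have := LinearMap.lTensor_id_apply (S.Z k) N x
    rw [Subsingleton.elim (LinearMap.id : N →ₗ[R] N) 0, LinearMap.lTensor_zero] at this
    exact this.symm
  | quotient N q e =>
    refine S.tor_eq_bot_of_equiv k e.symm (h q.1 q.2 fun a ha => ?_)
    have := hI a ha (e.symm 1)
    rw [← map_smul, e.symm.map_eq_zero_iff, Algebra.smul_def, mul_one] at this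
    exact Ideal.Quotient.eq_zero_iff_mem.1 this
  | exact N₁ N₂ N₃ f g hf hg hfg h₁ h₃ =>
    refine S.tor_eq_bot_of_exact k hf hg hfg (h₁ fun a ha m => hf ?_) (h₃ fun a ha m => ?_)
    · rw [map_smul, hI a ha, map_zero]
    · obtain ⟨m, rfl⟩ := hg m
      rw [← map_smul, hI a ha, map_zero]

lemma tor_quotient_eq_bot_of_not_le (k : ℕ) {q : Ideal R} (h : ¬ q ≤ p) :
    S.tor k (R ⧸ q) = ⊥ := by
  obtain ⟨s, hsq, hsp⟩ := SetLike.not_le_iff_exists.1 h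
  refine S.tor_eq_bot_of_smul_eq_zero hS k hsp fun m => ?_
  rw [Algebra.smul_def]
  erw [Ideal.Quotient.eq_zero_iff_mem.2 hsq]
  exact zero_mul m

/-- In the top nonvanishing degree, `tor` only sees the prime `p`. -/
lemma tor_quotient_eq_bot_of_ne (r : ℕ)
    (hr : ∀ (M : Type u) [AddCommGroup M] [Module R M], S.tor (r + 1) M = ⊥)
    {q : Ideal R} [hq : q.IsPrime] (hqp : q ≠ p) : S.tor r (R ⧸ q) = ⊥ := by
  by_cases hle : q ≤ p
  · obtain ⟨x, hxp, hxq⟩ := SetLike.exists_of_lt (lt_of_le_of_ne hle hqp)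
    refine S.tor_eq_bot_of_smul_injective hS r hxp ?_
    have hx : Function.Injective (x • (LinearMap.id : (R ⧸ q) →ₗ[R] _)) := by
      rw [injective_iff_map_eq_zero]
      intro y hy
      obtain ⟨y, rfl⟩ := Ideal.Quotient.mk_surjective y
      have hy' : Ideal.Quotient.mk q (x * y) = 0 := hy
      rw [Ideal.Quotient.eq_zero_iff_mem] at hy' ⊢
      exact (hq.mem_or_mem hy').resolve_left hxq
    exact S.torMap_injective r hx (Submodule.mkQ_surjective _)
      (LinearMap.exact_map_mkQ_range _) (hr _)
  · exact S.tor_quotient_eq_bot_of_not_le hS r hle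

omit hS in
/-- An element of `p` which is regular on `M` locally at `p`. -/
lemma _root_.exists_mem_smul_ker [IsNoetherianRing R] [hp : p.IsPrime] [Module.Finite R M]
    (h : p ∉ associatedPrimes R M) :
    ∃ x ∈ p, ∃ s ∉ p, ∀ m : M, x • m = 0 → s • m = 0 := by
  have hfin : {q ∈ associatedPrimes R M | q ≤ p}.Finite :=
    (associatedPrimes.finite R M).subset fun _ h => h.1
  obtain ⟨x, hxp, hx⟩ : ∃ x ∈ p, ∀ q ∈ associatedPrimes R M, q ≤ p → x ∉ q := by
    by_contra! hcon
    obtain ⟨q, hq, hpq⟩ := (Ideal.subset_union_prime (s := hfin.toFinset) (f := id) p p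
      (fun q hq _ _ => (hfin.mem_toFinset.1 hq).1.isPrime) (I := p)).1 fun x hx => by
        obtain ⟨q, hq, hqp, hxq⟩ := hcon x hx
        exact Set.mem_biUnion (hfin.mem_toFinset.2 ⟨hq, hqp⟩) hxq
    obtain ⟨hq, hqp⟩ := hfin.mem_toFinset.1 hq
    exact h (le_antisymm hqp hpq ▸ hq)
  refine ⟨x, hxp, ?_⟩
  let K := LinearMap.ker (x • (LinearMap.id : M →ₗ[R] M))
  have hK : ¬ Module.annihilator R K ≤ p := by
    intro hle
    obtain ⟨q, hq, hqp⟩ := Ideal.exists_minimalPrimes_le hle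
    have hqK := Module.associatedPrimes.minimalPrimes_annihilator_subset_associatedPrimes R K hq
    refine hx q (associatedPrimes.subset_of_injective K.injective_subtype hqK) hqp
      (hq.1.2 (Module.mem_annihilator.2 fun m => Subtype.ext m.2))
  obtain ⟨s, hs, hsp⟩ := SetLike.not_le_iff_exists.1 hK
  exact ⟨s, hsp, fun m hm => congrArg Subtype.val (Module.mem_annihilator.1 hs ⟨m, hm⟩)⟩

omit hS in
lemma torMap_smul_quotient_eq_zero (i : ℕ) {x : R} (hx : x ∈ p) :
    (can (R := R) (R ⧸ p)).torMap i (x • (LinearMap.id : M →ₗ[R] M)) = 0 := by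
  rw [torMap_smul_id]
  obtain ⟨e⟩ := tor_balance_can (R := R) M (R ⧸ p) i
  ext1 y
  apply e.symm.injective
  have h0 : x • (LinearMap.id : (R ⧸ p) →ₗ[R] (R ⧸ p)) = 0 := by
    ext
    change Ideal.Quotient.mk p (x * 1) = 0
    rw [mul_one]
    exact Ideal.Quotient.eq_zero_iff_mem.2 hx
  have := LinearMap.congr_fun ((can (R := R) M).torMap_smul_id i x (R ⧸ p)) (e.symm y)
  rw [h0, torMap_zero] at this
  rw [LinearMap.smul_apply, LinearMap.id_apply, map_smul, LinearMap.zero_apply, map_zero]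
  exact this.symm

/-- Vanishing below the top degree. -/
lemma tor_hom_quotient_eq_bot [IsNoetherianRing R] [hp : p.IsPrime] {E : Type u} [AddCommGroup E]
    [Module R E] [Module.Injective R E] (hE : PropT R p E) (r : ℕ) (hr : S.tor r (R ⧸ p) ≠ ⊥)
    (hr' : ∀ (M : Type u) [AddCommGroup M] [Module R M], S.tor (r + 1) M = ⊥) (d : ℕ) :
    ∀ (M : ModuleCat.{u} R) [Module.Finite R M] (j : ℕ), j + d = r →
      (∀ i, j < i → S.tor i M = ⊥) →
      ∀ i < d, (can (R := R) (R ⧸ p)).tor i (M →ₗ[R] E) = ⊥ := by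
  induction d with
  | zero => intro M _ j _ _ i hi; omega
  | succ d ih =>
    intro M _ j hj hM i hi
    have hass : p ∉ associatedPrimes R M := by
      intro h
      obtain ⟨-, f, hf⟩ := (isAssociatedPrime_iff_exists_injective_linearMap _ _).1 h
      refine hr (S.tor_left_eq_bot r hf (Submodule.mkQ_surjective _)
        (LinearMap.exact_map_mkQ_range f) (hM r (by omega)) (hr' _))
    obtain ⟨x, hxp, s, hs, hxs⟩ := exists_mem_smul_ker hass
    set μ : M →ₗ[R] M := x • LinearMap.id with hμ
    have hK : ∀ i, S.tor i (LinearMap.ker μ) = ⊥ := fun i =>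
      S.tor_eq_bot_of_smul_eq_zero hS i hs fun m => Subtype.ext (hxs m m.2)
    have hrange : ∀ i, j < i → S.tor i (LinearMap.range μ) = ⊥ := by
      intro i hi
      obtain ⟨i, rfl⟩ : ∃ i', i = i' + 1 := ⟨i - 1, by omega⟩
      refine S.tor_eq_bot_of_surjective (i + 1) (S.torMap_succ_surjective i
        (f := (LinearMap.ker μ).subtype) (g := μ.rangeRestrict) (Submodule.injective_subtype _)
        μ.surjective_rangeRestrict ?_ (S.torMap_injective_of_eq_bot i _ (hK i))) (hM _ hi)
      intro m
      constructor
      · intro h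
        exact ⟨⟨m, congrArg Subtype.val h⟩, rfl⟩
      · rintro ⟨m, rfl⟩
        exact Subtype.ext m.2
    have hquot : ∀ i, j + 1 < i → S.tor i (M ⧸ LinearMap.range μ) = ⊥ := by
      intro i hi
      obtain ⟨i, rfl⟩ : ∃ i', i = i' + 1 := ⟨i - 1, by omega⟩
      exact S.tor_eq_bot_of_surjective (i + 1) (S.torMap_succ_surjective i
        (f := (LinearMap.range μ).subtype) (g := (LinearMap.range μ).mkQ)
        (Submodule.injective_subtype _) (Submodule.mkQ_surjective _)
        (LinearMap.exact_subtype_mkQ _)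
        (S.torMap_injective_of_eq_bot i _ (hrange i (by omega)))) (hM _ (by omega))
    have hsurj : Function.Surjective (x • (LinearMap.id : (M →ₗ[R] E) →ₗ[R] (M →ₗ[R] E))) := by
      intro φ
      obtain ⟨ψ, hψ⟩ := exists_comp_eq_of_ker_le μ φ fun m hm => (hE.1 s hs).1 <| by
        change s • φ m = s • 0
        rw [← map_smul, hxs m hm, map_zero, smul_zero]
      refine ⟨ψ, ?_⟩
      rw [← hψ]
      ext m
      simp [hμ]
    have hinj : Function.Injective (LinearMap.lcomp R E (LinearMap.range μ).mkQ) :=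
      fun f g hfg => LinearMap.ext fun y => by
        obtain ⟨y, rfl⟩ := Submodule.mkQ_surjective _ y
        exact LinearMap.congr_fun hfg y
    have hex : Function.Exact (LinearMap.lcomp R E (LinearMap.range μ).mkQ)
        (x • (LinearMap.id : (M →ₗ[R] E) →ₗ[R] (M →ₗ[R] E))) := by
      intro φ
      constructor
      · intro h
        obtain ⟨ψ, hψ⟩ := exists_comp_eq_of_surjective (LinearMap.range μ).mkQ
          (Submodule.mkQ_surjective _) φ (by
            rw [Submodule.ker_mkQ]
            rintro _ ⟨m, rfl⟩
            have := LinearMap.congr_fun h m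
            simpa [hμ] using this)
        exact ⟨ψ, hψ⟩
      · rintro ⟨ψ, rfl⟩
        ext m
        change x • ψ (Submodule.Quotient.mk m) = 0
        rw [← map_smul, ← Submodule.Quotient.mk_smul, (Submodule.Quotient.mk_eq_zero _).2, map_zero]
        exact ⟨m, rfl⟩
    have hzero := torMap_smul_quotient_eq_zero (p := p) (M := M →ₗ[R] E) i hxp
    have hsurj' : Function.Surjective ((can (R := R) (R ⧸ p)).torMap i
        (x • (LinearMap.id : (M →ₗ[R] E) →ₗ[R] (M →ₗ[R] E)))) := by
      cases i with
      | zero => exact torMap_zero_surjective _ hsurj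
      | succ i =>
        exact torMap_succ_surjective _ i hinj hsurj hex (torMap_injective_of_eq_bot _ i _
          (ih (ModuleCat.of R (M ⧸ LinearMap.range μ)) (j + 1) (by omega) hquot i (by omega)))
    rw [hzero] at hsurj'
    refine Submodule.subsingleton_iff_eq_bot.1 (subsingleton_of_forall_eq 0 fun y => ?_)
    obtain ⟨z, rfl⟩ := hsurj' y
    rfl

end FlatRes

end PropT

/-! ### Torsion modules of injective modules are injective -/

section Injectivity

variable {R : Type u} [CommRing R] [IsNoetherianRing R]

namespace FlatRes

/-- If `D` is a dualizing module and `E` is injective with property `t(p)`, then the torsion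
functors of `Hom(D, E)` vanish outside a single degree on modules with property `t(q)`. -/
lemma exists_degree {D E : Type u} [AddCommGroup D] [Module R D] [Module.Finite R D]
    [AddCommGroup E] [Module R E] [Module.Injective R E]
    (hD : ∀ i, 1 ≤ i → Subsingleton (ExtM R i D D)) {n : ℕ} (hn : InjDimLE R n (ModuleCat.of R D))
    {p : Ideal R} [hp : p.IsPrime] (hE : PropT R p E) :
    ∃ r, ∀ k ≠ r, ∀ (q : Ideal R) (M : Type u) [AddCommGroup M] [Module R M],
      PropT R q M → (can (R := R) (D →ₗ[R] E)).tor k M = ⊥ := by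
  classical
  set S := can (R := R) (D →ₗ[R] E) with hSdef
  have hS : ∀ (k : ℕ) (M : Type u) [AddCommGroup M] [Module R M], PropT R p (S.tor k M) :=
    fun k M _ _ => can_tor_propT k hE.hom M
  have hex : ∃ r, ∀ k > r, ∀ (M : Type u) [AddCommGroup M] [Module R M], S.tor k M = ⊥ :=
    ⟨n, fun k hk M _ _ => can_hom_tor_eq_bot_of_injDimLE hn k hk M⟩
  obtain ⟨r, hr, hmin⟩ : ∃ r,
      (∀ k > r, ∀ (M : Type u) [AddCommGroup M] [Module R M], S.tor k M = ⊥) ∧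
      ∀ r' < r, ¬ ∀ k > r', ∀ (M : Type u) [AddCommGroup M] [Module R M], S.tor k M = ⊥ :=
    ⟨Nat.find hex, Nat.find_spec hex, fun r' hr' => Nat.find_min hex hr'⟩
  have hr₁ : ∀ (M : Type u) [AddCommGroup M] [Module R M], S.tor (r + 1) M = ⊥ :=
    fun M _ _ => hr (r + 1) (by omega) M
  refine ⟨r, fun k hk q M _ _ hM => ?_⟩
  by_cases hqp : q ≠ p
  · exact S.tor_eq_bot_of_propT_ne hS k hqp hM
  obtain rfl := not_not.1 hqp
  have hlow : ∀ k < r, S.tor k (R ⧸ q) = ⊥ := by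
    intro k hk
    have hrp : S.tor r (R ⧸ q) ≠ ⊥ := by
      intro h0
      refine hmin (r - 1) (by omega) fun l hl N _ _ => ?_
      rcases (show r ≤ l by omega).eq_or_lt with rfl | hl
      · refine S.tor_eq_bot_of_fg _ fun P hP => ?_
        have : Module.Finite R P := Module.Finite.iff_fg.2 hP
        refine S.tor_eq_bot_of_quotient_prime r ⊥ (fun q' hq' _ => ?_) fun a ha m => by
          rw [(Submodule.mem_bot R).1 ha, zero_smul]
        by_cases hqq : q' = q
        · rw [hqq]; exact h0
        · exact S.tor_quotient_eq_bot_of_ne hS r hr₁ hqq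
      · exact hr l hl N
    have := S.tor_hom_quotient_eq_bot hS hE r hrp hr₁ r (ModuleCat.of R D) 0 (zero_add r)
      (fun i hi => can_hom_tor_self_eq_bot hD i hi) k hk
    obtain ⟨e⟩ := tor_balance_can (R := R) (R ⧸ q) (D →ₗ[R] E) k
    have : Subsingleton ((can (R := R) (R ⧸ q)).tor k (D →ₗ[R] E)) :=
      Submodule.subsingleton_iff_eq_bot.2 this
    exact Submodule.subsingleton_iff_eq_bot.1 e.symm.toEquiv.subsingleton
  refine S.tor_eq_bot_of_fg k fun P hP => ?_
  obtain ⟨J, ⟨m, hm⟩, hJ⟩ := exists_ideal_smul_eq_zero (powFamily q) P hP fun x _ => by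
    obtain ⟨m, -, hm⟩ := hM.2 x
    exact ⟨q ^ m, ⟨m, le_rfl⟩, hm⟩
  have : Module.Finite R P := Module.Finite.iff_fg.2 hP
  refine S.tor_eq_bot_of_quotient_prime k (q ^ m) (fun q' hq' hle => ?_) fun a ha x =>
    Subtype.ext (hJ a (hm ha) x x.2)
  have hqq' : q ≤ q' := Ideal.IsPrime.le_of_pow_le hle
  by_cases hle' : q' ≤ q
  · obtain rfl := le_antisymm hqq' hle'
    rcases lt_or_gt_of_ne hk with hk | hk
    · exact hlow k hk
    · exact hr k hk _
  · exact S.tor_quotient_eq_bot_of_not_le hS k hle'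

omit [IsNoetherianRing R] in
lemma tor_directSum_eq_bot (S : FlatRes R) (k : ℕ) {κ : Type u} (X : κ → Type u)
    [∀ j, AddCommGroup (X j)] [∀ j, Module R (X j)] (h : ∀ j, S.tor k (X j) = ⊥) :
    S.tor k (⨁ j, X j) = ⊥ := by
  obtain ⟨e⟩ := S.tor_directSum_equiv X k
  have : ∀ j, Subsingleton (S.tor k (X j)) := fun j => Submodule.subsingleton_iff_eq_bot.2 (h j)
  have : Subsingleton (⨁ j, S.tor k (X j)) := ⟨fun x y => DFinsupp.ext fun j =>
    Subsingleton.elim _ _⟩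
  exact Submodule.subsingleton_iff_eq_bot.1 e.symm.toEquiv.subsingleton

variable (S : FlatRes R) {r : ℕ}

lemma tor_hom_injective_eq_bot (hS : ∀ k ≠ r, ∀ (q : Ideal R) (M : Type u) [AddCommGroup M]
    [Module R M], PropT R q M → S.tor k M = ⊥) (k : ℕ) (hk : k ≠ r) (N I : Type u)
    [AddCommGroup N] [Module R N] [Module.Finite R N] [AddCommGroup I] [Module R I]
    [Module.Injective R I] : S.tor k (N →ₗ[R] I) = ⊥ := by
  obtain ⟨κ, X, -, hX, ⟨e⟩⟩ := exists_directSum_propT (R := R) I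
  obtain ⟨e'⟩ := linearMap_directSum_equiv (fun j => (X j : Type u)) N (R := R)
  refine S.tor_eq_bot_of_equiv k (e' ≪≫ₗ LinearEquiv.congrRight e.symm)
    (S.tor_directSum_eq_bot k (fun j => N →ₗ[R] X j) fun j => ?_)
  obtain ⟨q, -, hq⟩ := hX j
  exact hS k hk q _ hq.hom

end FlatRes

section lcomp

omit [IsNoetherianRing R]

variable {L M N I : Type u} [AddCommGroup L] [Module R L] [AddCommGroup M] [Module R M]
  [AddCommGroup N] [Module R N] [AddCommGroup I] [Module R I] {f : L →ₗ[R] M} {g : M →ₗ[R] N}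

lemma lcomp_injective (hg : Function.Surjective g) : Function.Injective (LinearMap.lcomp R I g) :=
  fun φ ψ h => LinearMap.ext fun y => by
    obtain ⟨y, rfl⟩ := hg y
    exact LinearMap.congr_fun h y

lemma lcomp_surjective [hI : Module.Injective R I] (hf : Function.Injective f) :
    Function.Surjective (LinearMap.lcomp R I f) := fun φ =>
  Module.Injective.extension_property R I _ _ f hf φ

lemma lcomp_exact (hg : Function.Surjective g) (hfg : Function.Exact f g) :
    Function.Exact (LinearMap.lcomp R I g) (LinearMap.lcomp R I f) := by
  intro φ
  constructor
  · intro h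
    exact exists_comp_eq_of_surjective g hg φ fun m hm => by
      obtain ⟨l, rfl⟩ := (hfg m).1 hm
      exact LinearMap.congr_fun h l
  · rintro ⟨ψ, rfl⟩
    ext l
    change ψ (g (f l)) = 0
    rw [hfg.apply_apply_eq_zero, map_zero]

end lcomp

namespace FlatRes

variable (S : FlatRes R) {r : ℕ} {I : Type u} [AddCommGroup I] [Module R I]

omit [IsNoetherianRing R] in
lemma eq_zero_of_torMap_eval {m : ℕ} (t : S.tor r ((Fin m → R) →ₗ[R] I))
    (ht : ∀ v, S.torMap r (LinearMap.applyₗ v) t = 0) : t = 0 := by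
  have hid : ∑ j, LinearMap.smulRightₗ (LinearMap.proj j : (Fin m → R) →ₗ[R] R) ∘ₗ
      LinearMap.applyₗ (Pi.single j 1) = (LinearMap.id : ((Fin m → R) →ₗ[R] I) →ₗ[R] _) := by
    refine LinearMap.ext fun φ => LinearMap.pi_ext' fun i => ?_
    ext
    simp [Pi.single_apply, ite_smul]
  have := S.torMap_id (M := (Fin m → R) →ₗ[R] I) r
  rw [← hid, torMap_sum] at this
  rw [← LinearMap.id_apply (R := R) t, ← this, LinearMap.sum_apply]
  refine Finset.sum_eq_zero fun j _ => ?_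
  rw [torMap_comp, LinearMap.comp_apply, ht, map_zero]

lemma injective_tor [Module.Injective R I] (h : ∀ k ≠ r, ∀ (N : Type u) [AddCommGroup N]
    [Module R N] [Module.Finite R N], S.tor k (N →ₗ[R] I) = ⊥) :
    Module.Injective R (S.tor r I) := by
  refine Module.Baer.injective fun 𝔞 f => ?_
  obtain ⟨n, π, hπ⟩ := Module.Finite.exists_fin' R 𝔞
  let K := LinearMap.ker π
  obtain ⟨m, ρ, hρ⟩ := Module.Finite.exists_fin' R K
  let ins (i : Fin n) : I →ₗ[R] ((Fin n → R) →ₗ[R] I) :=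
    LinearMap.smulRightₗ (LinearMap.proj i : (Fin n → R) →ₗ[R] R)
  let t : S.tor r ((Fin n → R) →ₗ[R] I) := ∑ i, S.torMap r (ins i) (f (π (Pi.single i 1)))
  have ht : ∀ v, S.torMap r (LinearMap.applyₗ v) t = f (π v) := by
    intro v
    have hv : v = ∑ i, v i • Pi.single i (1 : R) := by
      ext j
      simp [Pi.single_apply]
    have hins : ∀ i, LinearMap.applyₗ v ∘ₗ ins i = v i • LinearMap.id := by
      intro i
      ext x
      simp [ins]
    rw [map_sum]
    conv_rhs => rw [hv, map_sum, map_sum]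
    refine Finset.sum_congr rfl fun i _ => ?_
    rw [torMap_comp_apply, hins, torMap_smul_id, map_smul, map_smul]
    rfl
  have hK : S.torMap r (LinearMap.lcomp R I K.subtype) t = 0 := by
    have hinj : Function.Injective (S.torMap r (LinearMap.lcomp R I ρ)) :=
      S.torMap_injective r (lcomp_injective hρ)
        (lcomp_surjective (LinearMap.ker ρ).injective_subtype)
        (lcomp_exact hρ (LinearMap.exact_subtype_ker_map ρ)) (h (r + 1) (by omega) _)
    refine (injective_iff_map_eq_zero _).1 hinj _ (S.eq_zero_of_torMap_eval _ fun v => ?_)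
    rw [torMap_comp_apply, torMap_comp_apply]
    exact (ht (ρ v)).trans (by rw [(ρ v).2, map_zero])
  obtain ⟨t', ht'⟩ := (S.torMap_exact r (lcomp_injective hπ)
    (lcomp_surjective K.injective_subtype) (lcomp_exact hπ (LinearMap.exact_subtype_ker_map π))
    t).1 hK
  have hsurj : Function.Surjective (S.torMap r (LinearMap.lcomp R I 𝔞.subtype)) := by
    have hs := lcomp_surjective (I := I) 𝔞.injective_subtype
    cases r with
    | zero => exact S.torMap_zero_surjective hs
    | succ r =>
      exact S.torMap_succ_surjective r (lcomp_injective 𝔞.mkQ_surjective) hs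
        (lcomp_exact 𝔞.mkQ_surjective (LinearMap.exact_subtype_mkQ 𝔞))
        (S.torMap_injective_of_eq_bot r _ (h r (by omega) _))
  obtain ⟨t'', rfl⟩ := hsurj t'
  refine ⟨LinearMap.toSpanSingleton R _ (S.torMap r (LinearMap.applyₗ (1 : R)) t''),
    fun a ha => ?_⟩
  obtain ⟨v, hv⟩ := hπ ⟨a, ha⟩
  have hev : LinearMap.applyₗ v ∘ₗ LinearMap.lcomp R I π ∘ₗ LinearMap.lcomp R I 𝔞.subtype =
      a • LinearMap.applyₗ (1 : R) := by
    ext φ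
    change φ (π v) = a • φ 1
    rw [hv, ← map_smul, smul_eq_mul, mul_one]
  rw [LinearMap.toSpanSingleton_apply, ← hv, ← ht v, ← ht', torMap_comp_apply, torMap_comp_apply,
    LinearMap.comp_assoc, hev, torMap_smul, LinearMap.smul_apply]

end FlatRes

end Injectivity

/-! ### Gorenstein injective modules as syzygies -/

section Gorenstein

variable {R : Type u} [CommRing R]

/-- There is a short exact sequence `0 → A → I → B → 0` with `I` injective. -/
def IsInjSyzygy (A B : ModuleCat.{u} R) : Prop :=
  ∃ (I : ModuleCat.{u} R) (f : A →ₗ[R] I) (g : I →ₗ[R] B), Module.Injective R I ∧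
    Function.Injective f ∧ Function.Surjective g ∧ Function.Exact f g

/-- `G` is a member of a doubly infinite family of consecutive syzygies of injective modules. -/
def HasInjSyzygies (R : Type u) [CommRing R] (G : Type u) [AddCommGroup G] [Module R G] : Prop :=
  ∃ f : ℤ → ModuleCat.{u} R, (∀ i, IsInjSyzygy (f i) (f (i + 1))) ∧ Nonempty (G ≃ₗ[R] f 1)

variable {G H : Type u} [AddCommGroup G] [Module R G] [AddCommGroup H] [Module R H]

lemma HasInjSyzygies.gorensteinInjective (h : HasInjSyzygies R G) : GorensteinInjective R G := by
  obtain ⟨f, hf, ⟨e⟩⟩ := h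
  choose I ι π hI hι hπ hιπ using hf
  have hker : ∀ i, LinearMap.ker (ι (i + 1) ∘ₗ π i) = LinearMap.ker (π i) := fun i =>
    LinearMap.ker_comp_of_ker_eq_bot _ (LinearMap.ker_eq_bot.2 (hι _))
  have hrange : ∀ i, LinearMap.range (ι (i + 1) ∘ₗ π i) = LinearMap.range (ι (i + 1)) := fun i =>
    LinearMap.range_comp_of_range_eq_top _ (LinearMap.range_eq_top.2 (hπ _))
  have hex : ∀ i, LinearMap.range (ι (i + 1) ∘ₗ π i) =
      LinearMap.ker (ι (i + 1 + 1) ∘ₗ π (i + 1)) := fun i => by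
    rw [hker, hrange, (hιπ (i + 1)).linearMap_ker_eq]
  refine ⟨⟨fun i => I i, fun i => ι (i + 1) ∘ₗ π i, hI, hex, fun J _ _ _ i g hg => ?_⟩,
    ⟨e ≪≫ₗ LinearEquiv.ofInjective (ι 1) (hι 1) ≪≫ₗ LinearEquiv.ofEq _ _ (hrange 0).symm⟩⟩
  refine exists_comp_eq_of_ker_le _ g ?_
  rw [← hex]
  exact LinearMap.range_le_ker_iff.2 hg

lemma GorensteinInjective.hasInjSyzygies (h : GorensteinInjective R G) : HasInjSyzygies R G := by
  obtain ⟨X, ⟨e⟩⟩ := h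
  refine ⟨fun i => ModuleCat.of R (LinearMap.ker (X.d i)), fun i => ⟨ModuleCat.of R (X.E i),
    (LinearMap.ker (X.d i)).subtype, (X.d i).codRestrict (LinearMap.ker (X.d (i + 1)))
      fun x => (X.exct i).le ⟨x, rfl⟩, X.inj i, Submodule.injective_subtype _, ?_, ?_⟩,
    ⟨e ≪≫ₗ LinearEquiv.ofEq _ _ (X.exct 0)⟩⟩
  · rintro ⟨y, hy⟩
    obtain ⟨x, rfl⟩ := (X.exct i).ge hy
    exact ⟨x, rfl⟩
  · rw [LinearMap.exact_iff, LinearMap.ker_codRestrict, Submodule.range_subtype]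

lemma HasInjSyzygies.of_equiv (h : HasInjSyzygies R G) (e : H ≃ₗ[R] G) : HasInjSyzygies R H := by
  obtain ⟨f, hf, ⟨e'⟩⟩ := h
  exact ⟨f, hf, ⟨e ≪≫ₗ e'⟩⟩

lemma hasInjSyzygies_of_subsingleton [Subsingleton G] : HasInjSyzygies R G :=
  have : Module.Injective R (ModuleCat.of R G) := injective_of_subsingleton G
  ⟨fun _ => ModuleCat.of R G, fun _ => ⟨ModuleCat.of R G, LinearMap.id, 0, this,
    Function.injective_id, fun _ => ⟨0, Subsingleton.elim _ _⟩,
    fun x => ⟨fun _ => ⟨x, rfl⟩, fun _ => rfl⟩⟩, ⟨LinearEquiv.refl R G⟩⟩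

lemma IsInjSyzygy.directSum [IsNoetherianRing R] {κ : Type u} {A B : κ → ModuleCat.{u} R}
    (h : ∀ j, IsInjSyzygy (A j) (B j)) :
    IsInjSyzygy (ModuleCat.of R (⨁ j, A j)) (ModuleCat.of R (⨁ j, B j)) := by
  classical
  choose I f g hI hf hg hfg using h
  refine ⟨ModuleCat.of R (⨁ j, I j), DirectSum.lmap f, DirectSum.lmap g,
    injective_directSum (fun j => (I j : Type u)) hI, (DirectSum.lmap_injective f).2 hf,
    (DirectSum.lmap_surjective g).2 hg, ?_⟩
  rw [LinearMap.exact_iff, DirectSum.ker_lmap, DirectSum.range_lmap]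
  simp_rw [fun j => (hfg j).linearMap_ker_eq]

lemma HasInjSyzygies.directSum [IsNoetherianRing R] {κ : Type u} (X : κ → Type u)
    [∀ j, AddCommGroup (X j)] [∀ j, Module R (X j)] (h : ∀ j, HasInjSyzygies R (X j)) :
    HasInjSyzygies R (⨁ j, X j) := by
  choose f hf e using h
  exact ⟨fun i => ModuleCat.of R (⨁ j, f j i), fun i => .directSum fun j => hf j i,
    ⟨DFinsupp.mapRange.linearEquiv fun j => (e j).some⟩⟩

namespace FlatRes

variable (S : FlatRes R) {r n : ℕ} {f : ℤ → ModuleCat.{u} R}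

lemma tor_injSyzygy_eq_bot (hI : ∀ k ≠ r, ∀ (I : Type u) [AddCommGroup I] [Module R I]
    [Module.Injective R I], S.tor k I = ⊥)
    (hn : ∀ k > n, ∀ (M : Type u) [AddCommGroup M] [Module R M], S.tor k M = ⊥)
    (hf : ∀ i, IsInjSyzygy (f i) (f (i + 1))) {k : ℕ} (hk : k ≠ r) (i : ℤ) :
    S.tor k (f i) = ⊥ := by
  rcases lt_or_gt_of_ne hk with hk | hk
  · induction k generalizing i with
    | zero =>
      obtain ⟨i, rfl⟩ : ∃ j, i = j + 1 := ⟨i - 1, by omega⟩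
      obtain ⟨I, ι, π, _, hι, hπ, hιπ⟩ := hf i
      exact S.tor_eq_bot_of_surjective 0 (S.torMap_zero_surjective hπ) (hI 0 hk.ne I)
    | succ k ih =>
      obtain ⟨i, rfl⟩ : ∃ j, i = j + 1 := ⟨i - 1, by omega⟩
      obtain ⟨I, ι, π, _, hι, hπ, hιπ⟩ := hf i
      have hk' : k < r := (Nat.lt_succ_self k).trans hk
      exact S.tor_eq_bot_of_surjective (k + 1) (S.torMap_succ_surjective k hι hπ hιπ
        (S.torMap_injective_of_eq_bot k ι (ih hk'.ne i hk'))) (hI _ hk.ne I)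
  · obtain ⟨m, hm⟩ : ∃ m, n < k + m := ⟨n + 1, by omega⟩
    induction m generalizing i k with
    | zero => exact hn k hm _
    | succ m ih =>
      obtain ⟨I, ι, π, _, hι, hπ, hιπ⟩ := hf i
      exact S.tor_left_eq_bot k hι hπ hιπ (hI k hk.ne' I)
        (ih (hk.trans k.lt_succ_self).ne' (i + 1) (hk.trans k.lt_succ_self)
          (hm.trans_eq (Nat.add_right_comm k m 1)))

lemma hasInjSyzygies_tor (hI : ∀ k ≠ r, ∀ (I : Type u) [AddCommGroup I] [Module R I]
    [Module.Injective R I], S.tor k I = ⊥)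
    (hn : ∀ k > n, ∀ (M : Type u) [AddCommGroup M] [Module R M], S.tor k M = ⊥)
    (hr : ∀ (I : Type u) [AddCommGroup I] [Module R I] [Module.Injective R I],
      Module.Injective R (S.tor r I)) (hG : HasInjSyzygies R G) (k : ℕ) :
    HasInjSyzygies R (S.tor k G) := by
  obtain ⟨f, hf, ⟨e⟩⟩ := hG
  have h0 : ∀ k ≠ r, ∀ i, S.tor k (f i) = ⊥ := fun k hk i => S.tor_injSyzygy_eq_bot hI hn hf hk i
  by_cases hk : k = r
  · subst hk
    refine ⟨fun i => ModuleCat.of R (S.tor k (f i)), fun i => ?_, ⟨S.torCongr k e⟩⟩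
    obtain ⟨I, ι, π, _, hι, hπ, hιπ⟩ := hf i
    refine ⟨ModuleCat.of R (S.tor k I), S.torMap k ι, S.torMap k π, hr I,
      S.torMap_injective k hι hπ hιπ (h0 _ (by omega) _), ?_, S.torMap_exact k hι hπ hιπ⟩
    cases k with
    | zero => exact S.torMap_zero_surjective hπ
    | succ k =>
      exact S.torMap_succ_surjective k hι hπ hιπ
        (S.torMap_injective_of_eq_bot k ι (h0 _ (by omega) _))
  · have := Submodule.subsingleton_iff_eq_bot.2 (S.tor_eq_bot_of_equiv k e.symm (h0 k hk 1))
    exact hasInjSyzygies_of_subsingleton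

/-- If `D` is dualizing and `E` is injective with property `t(p)`, then the torsion functors of
`Hom(D, E)` preserve syzygies of injective modules. -/
lemma hasInjSyzygies_can_hom_tor [IsNoetherianRing R] {D E : Type u} [AddCommGroup D] [Module R D]
    (hD : IsDualizing R D) [AddCommGroup E] [Module R E] [Module.Injective R E] {p : Ideal R}
    [p.IsPrime] (hE : PropT R p E) (hG : HasInjSyzygies R G) (k : ℕ) :
    HasInjSyzygies R ((can (R := R) (D →ₗ[R] E)).tor k G) := by
  obtain ⟨⟨_, -, hext⟩, n, hn⟩ := hD
  obtain ⟨r, hr⟩ := exists_degree hext hn hE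
  have hI := fun k hk N I [AddCommGroup N] [Module R N] [Module.Finite R N] [AddCommGroup I]
    [Module R I] [Module.Injective R I] => tor_hom_injective_eq_bot _ hr k hk N I
  exact hasInjSyzygies_tor _ (fun k hk I _ _ _ => tor_eq_bot_of_equiv _ k
    (LinearMap.ringLmapEquivSelf R R I) (hI k hk R I))
    (fun k hk M _ _ => can_hom_tor_eq_bot_of_injDimLE hn k hk M)
    (fun I _ _ _ => injective_tor _ fun k hk N _ _ _ => hI k hk N I) hG k

end FlatRes

end Gorenstein

/-- Over a Cohen-Macaulay noetherian ring with dualizing module `D`, if `G` is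
Gorenstein injective and `E` is injective then `Tor_k^R(Hom_R(D,E), G)` is Gorenstein injective
for all `k ≥ 0`. -/
theorem statement13 (R : Type u) [CommRing R] [IsNoetherianRing R]
    (hCM : IsCohenMacaulayRing R)
    (D : Type u) [AddCommGroup D] [Module R D] (hD : IsDualizing R D)
    (G : Type u) [AddCommGroup G] [Module R G] (hG : GorensteinInjective R G)
    (E : Type u) [AddCommGroup E] [Module R E] (hE : Module.Injective R E) :
    ∀ k : ℕ, GorensteinInjective R (TorM R k (D →ₗ[R] E) G) := by
  intro k
  have := hD.1.1
  obtain ⟨κ, X, hX, hXp, ⟨e⟩⟩ := exists_directSum_propT (R := R) E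
  obtain ⟨e₁⟩ := (FlatRes.can (R := R) G).torM_equiv k (D →ₗ[R] E)
  obtain ⟨e₂⟩ := linearMap_directSum_equiv (fun j => (X j : Type u)) D (R := R)
  obtain ⟨e₃⟩ := (FlatRes.can (R := R) G).tor_directSum_equiv (fun j => D →ₗ[R] X j) k
  refine (HasInjSyzygies.of_equiv
    (.directSum (fun j => (FlatRes.can (R := R) G).tor k (D →ₗ[R] X j)) fun j => ?_)
    (e₁ ≪≫ₗ FlatRes.torCongr _ k (LinearEquiv.congrRight e ≪≫ₗ e₂.symm) ≪≫ₗ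
      e₃.symm)).gorensteinInjective
  obtain ⟨p, _, hp⟩ := hXp j
  have := hX j
  obtain ⟨e₄⟩ := FlatRes.tor_balance_can (R := R) G (D →ₗ[R] X j) k
  exact (FlatRes.hasInjSyzygies_can_hom_tor hD hp hG.hasInjSyzygies k).of_equiv e₄
end

section
/- Let R be a commutative noetherian ring, let M and N be R-modules, and let p ∈ Spec(R) be such that M satisfies property t(p). Let X_1, …, X_t be pairwise disjoint subsets of Spec(R), and suppose N has a filtration 0 = N_{t+1} ⊆ N_t ⊆ ⋯ ⊆ N_1 = N such that each quotient N_j/N_{j+1} decomposes as a direct sum ⊕_{q ∈ X_j} N_{j,q}, where each N_{j,q} satisfies property t(q). Then: (a) if p ∉ ⋃_{j=1}^t X_j, then Tor_i^R(M,N) = 0 for all i; (b) if p ∈ X_j for some j, then Tor_i^R(M,N) ≅ Tor_i^R(M, N_{j,p}) for all i; and (c) supp_R(N) = {q ∈ ⋃_{j=1}^t X_j | N_{j,q} ≠ 0}. -/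
/-!
Common definitions: property t(p), injective hulls, (C-)Gorenstein injective modules,
(C-)Gorenstein injective / injective / flat dimensions, small support, torsion functor,
Tor and Ext modules, semidualizing and dualizing modules, depth, Cohen-Macaulay rings,
Serre's condition (S₁), Gorenstein local rings, minimal injective resolutions.
-/

universe u

open CategoryTheory Limits DirectSum

open MonoidalCategory in
/-- The functor sending `M` to `M ⊗ P`, where `P` is a projective resolution of `N`. -/
noncomputable def tensorResolution {R : Type u} [CommRing R] (N : ModuleCat.{u} R) :
    ModuleCat.{u} R ⥤ ChainComplex (ModuleCat.{u} R) ℕ where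
  obj M := (((tensoringLeft (ModuleCat.{u} R)).obj M).mapHomologicalComplex _).obj
    (projectiveResolution N).complex
  map f := (NatTrans.mapHomologicalComplex
    ((tensoringLeft (ModuleCat.{u} R)).map f) _).app (projectiveResolution N).complex

lemma homologyMap_smul {R : Type u} [CommRing R] {K L : ChainComplex (ModuleCat.{u} R) ℕ}
    (r : R) (f : K ⟶ L) (i : ℕ) : HomologicalComplex.homologyMap (r • f) i =
      r • HomologicalComplex.homologyMap f i :=
  ShortComplex.homologyMap_smul ((HomologicalComplex.shortComplexFunctor _ _ i).map f) r

section TorMap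

variable {R : Type u} [CommRing R] (i : ℕ) {A B C : Type u} [AddCommGroup A] [Module R A]
  [AddCommGroup B] [Module R B] [AddCommGroup C] [Module R C]
  (N : Type u) [AddCommGroup N] [Module R N]

/-- Functoriality of `Tor` in the first variable. -/
noncomputable def torMap (f : A →ₗ[R] B) : TorM R i A N →ₗ[R] TorM R i B N :=
  (((Tor (ModuleCat.{u} R) i).map (ModuleCat.ofHom f)).app (ModuleCat.of R N)).hom

/-- `Tor` is the homology of the first variable tensored with a resolution of the second. -/
noncomputable def torIso (A : Type u) [AddCommGroup A] [Module R A] : TorM R i A N ≅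
    ((tensorResolution (ModuleCat.of R N)).obj (ModuleCat.of R A)).homology i :=
  ProjectiveResolution.isoLeftDerivedObj _ _ i

lemma torMap_eq (f : A →ₗ[R] B) : torMap i N f = ((torIso i N A).hom ≫
    HomologicalComplex.homologyMap
      ((tensorResolution (ModuleCat.of R N)).map (ModuleCat.ofHom f)) i ≫
    (torIso i N B).inv).hom := by
  unfold torMap
  congr 1
  exact ProjectiveResolution.leftDerived_app_eq _ _ i

lemma torMap_id : torMap i N (LinearMap.id : A →ₗ[R] A) = LinearMap.id := by
  exact congrArg (fun α => (α.app (ModuleCat.of R N)).hom)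
    ((Tor (ModuleCat.{u} R) i).map_id (ModuleCat.of R A))

lemma torMap_comp (g : B →ₗ[R] C) (f : A →ₗ[R] B) :
    torMap i N (g ∘ₗ f) = torMap i N g ∘ₗ torMap i N f := by
  exact congrArg (fun α => (α.app (ModuleCat.of R N)).hom)
    ((Tor (ModuleCat.{u} R) i).map_comp (ModuleCat.ofHom f) (ModuleCat.ofHom g))

open MonoidalCategory in
lemma torMap_add (f g : A →ₗ[R] B) : torMap i N (f + g) = torMap i N f + torMap i N g := by
  have : (tensorResolution (ModuleCat.of R N)).map (ModuleCat.ofHom (f + g)) =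
      (tensorResolution (ModuleCat.of R N)).map (ModuleCat.ofHom f) +
      (tensorResolution (ModuleCat.of R N)).map (ModuleCat.ofHom g) := by
    ext n : 1
    exact MonoidalPreadditive.add_whiskerRight (ModuleCat.ofHom f) (ModuleCat.ofHom g)
  simp only [torMap_eq, this, HomologicalComplex.homologyMap_add, Preadditive.add_comp,
    Preadditive.comp_add, ModuleCat.hom_add]

open MonoidalCategory in
lemma torMap_smul (r : R) (f : A →ₗ[R] B) : torMap i N (r • f) = r • torMap i N f := by
  have : (tensorResolution (ModuleCat.of R N)).map (ModuleCat.ofHom (r • f)) =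
      r • (tensorResolution (ModuleCat.of R N)).map (ModuleCat.ofHom f) := by
    ext n : 1
    exact MonoidalLinear.smul_whiskerRight r (ModuleCat.ofHom f) _
  simp only [torMap_eq, this, homologyMap_smul, Linear.smul_comp, Linear.comp_smul,
    ModuleCat.hom_smul]

/-- The bijection on `Tor` induced by a linear equivalence. -/
noncomputable def torCongr (e : A ≃ₗ[R] B) : TorM R i A N ≃ₗ[R] TorM R i B N :=
  LinearEquiv.ofLinearMap (torMap i N e) (torMap i N e.symm)
    (by rw [← torMap_comp, LinearEquiv.comp_symm, torMap_id])
    (by rw [← torMap_comp, LinearEquiv.symm_comp, torMap_id])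

instance (n : ℕ) : Module.Flat R
    ((projectiveResolution (ModuleCat.of R N)).complex.X n) :=
  have := (IsProjective.iff_projective _).2
    ((projectiveResolution (ModuleCat.of R N)).projective n)
  Module.Flat.of_projective

lemma function_exact_of_iso {X Y Z X' Y' Z' : ModuleCat.{u} R} (a : X ⟶ Y) (b : Y ⟶ Z)
    (w : a ≫ b = 0) (h : (ShortComplex.mk a b w).Exact) (x : X' ≅ X) (y : Y' ≅ Y) (z : Z' ≅ Z) :
    Function.Exact (x.hom ≫ a ≫ y.inv).hom (y.hom ≫ b ≫ z.inv).hom := by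
  have w' : (x.hom ≫ a ≫ y.inv) ≫ (y.hom ≫ b ≫ z.inv) = 0 := by simp [reassoc_of% w]
  refine (ShortComplex.ShortExact.moduleCat_exact_iff_function_exact
    (ShortComplex.mk _ _ w')).1 ((ShortComplex.exact_iff_of_iso
      (ShortComplex.isoMk x.symm y.symm z.symm ?_ ?_)).1 h) <;> simp

/-- The long exact sequence of `Tor` in the first variable. -/
lemma exists_tor_connecting {f : A →ₗ[R] B} {g : B →ₗ[R] C} (hf : Function.Injective f)
    (hfg : Function.Exact f g) (hg : Function.Surjective g) :
    (∀ i, Function.Exact (torMap i N f) (torMap i N g)) ∧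
    ∃ δ : ∀ i, TorM R (i + 1) C N →ₗ[R] TorM R i A N, ∀ i,
      Function.Exact (torMap (i + 1) N g) (δ i) ∧ Function.Exact (δ i) (torMap i N f) := by
  let T := tensorResolution (ModuleCat.of R N)
  have w : T.map (ModuleCat.ofHom f) ≫ T.map (ModuleCat.ofHom g) = 0 := by
    rw [← T.map_comp, ← ModuleCat.ofHom_comp, hfg.linearMap_comp_eq_zero]
    ext n : 1
    exact MonoidalPreadditive.zero_whiskerRight
  let S := ShortComplex.mk _ _ w
  have hS : S.ShortExact := by
    apply HomologicalComplex.shortExact_of_degreewise_shortExact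
    intro n
    let P : ModuleCat.{u} R := (projectiveResolution (ModuleCat.of R N)).complex.X n
    refine ModuleCat.shortComplex_shortExact _ ?_ ?_ ?_
    · exact rTensor_exact P hfg hg
    · exact Module.Flat.rTensor_preserves_injective_linearMap f hf
    · exact LinearMap.rTensor_surjective P hg
  refine ⟨fun i => ?_, fun i => ((torIso (i + 1) N C).hom ≫ hS.δ (i + 1) i (by simp) ≫
    (torIso i N A).inv).hom, fun i => ⟨?_, ?_⟩⟩
  · rw [torMap_eq, torMap_eq]
    exact function_exact_of_iso _ _ _ (hS.homology_exact₂ i) _ _ _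
  · rw [torMap_eq]
    exact function_exact_of_iso _ _ _ (hS.homology_exact₃ (i + 1) i (by simp)) _ _ _
  · rw [torMap_eq]
    exact function_exact_of_iso _ _ _ (hS.homology_exact₁ (i + 1) i (by simp)) _ _ _

end TorMap

section TorZeroAndFlat

lemma exists_finset_rTensor_eq_zero {R : Type u} [CommRing R] {A P : Type u} [AddCommGroup A]
    [Module R A] [AddCommGroup P] [Module R P] (x : TensorProduct R A P) :
    ∃ s : Finset A, ∀ (B : Type u) [AddCommGroup B] [Module R B] (f : A →ₗ[R] B),
      (∀ a ∈ s, f a = 0) → f.rTensor P x = 0 := by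
  classical
  induction x using TensorProduct.induction_on with
  | zero => exact ⟨∅, fun B _ _ f _ => map_zero _⟩
  | tmul a y => exact ⟨{a}, fun B _ _ f hf => by simp [hf a]⟩
  | add x y hx hy =>
    obtain ⟨s, hs⟩ := hx
    obtain ⟨t, ht⟩ := hy
    refine ⟨s ∪ t, fun B _ _ f hf => ?_⟩
    rw [map_add, hs B f fun a ha => hf a (Finset.mem_union_left _ ha),
      ht B f fun a ha => hf a (Finset.mem_union_right _ ha), add_zero]

/-- The homology of `X ⟶ Y ⟶ W` when the second map factors through the cokernel `Z` of the
first one. -/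
noncomputable def homologyEquivKer {R : Type u} [CommRing R] (S : ShortComplex (ModuleCat.{u} R))
    {Z : Type u} [AddCommGroup Z] [Module R Z] (b : S.X₂ →ₗ[R] Z) (c : Z →ₗ[R] S.X₃)
    (hb : Function.Surjective b) (hab : Function.Exact S.f.hom b) (hc : S.g.hom = c ∘ₗ b) :
    S.homology ≃ₗ[R] LinearMap.ker c :=
  have hmem : ∀ x ∈ LinearMap.ker S.g.hom, b x ∈ LinearMap.ker c := fun x hx => by
    rw [LinearMap.mem_ker, ← hx, hc, LinearMap.comp_apply]
  S.moduleCatHomologyIso.toLinearEquiv ≪≫ₗ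
    Submodule.quotEquivOfEq (LinearMap.range S.moduleCatToCycles)
      (LinearMap.ker (b.restrict hmem)) (by
        ext ⟨y, hy⟩
        rw [LinearMap.mem_ker, LinearMap.mem_range, Subtype.ext_iff]
        refine Iff.trans ?_ (hab y).symm
        exact ⟨fun ⟨x, hx⟩ => ⟨x, congrArg Subtype.val hx⟩, fun ⟨x, hx⟩ => ⟨x, Subtype.ext hx⟩⟩) ≪≫ₗ
    LinearMap.quotKerEquivOfSurjective (b.restrict hmem) (fun ⟨z, hz⟩ => by
      obtain ⟨y, rfl⟩ := hb z
      exact ⟨⟨y, by rw [LinearMap.mem_ker, hc]; exact hz⟩, rfl⟩)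

variable {R : Type u} [CommRing R] (i : ℕ) {A B C : Type u} [AddCommGroup A] [Module R A]
  [AddCommGroup B] [Module R B] [AddCommGroup C] [Module R C]
  (N : Type u) [AddCommGroup N] [Module R N]

/-- A class in `Tor` only involves finitely many elements of the first variable. -/
lemma exists_finset_torMap_eq_zero (z : TorM R i A N) :
    ∃ s : Finset A, ∀ (B : Type u) [AddCommGroup B] [Module R B] (f : A →ₗ[R] B),
      (∀ a ∈ s, f a = 0) → torMap i N f z = 0 := by
  let K (D : Type u) [AddCommGroup D] [Module R D] :=
    (tensorResolution (ModuleCat.of R N)).obj (ModuleCat.of R D)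
  obtain ⟨c, hc⟩ := (ModuleCat.epi_iff_surjective ((K A).homologyπ i)).1 inferInstance
    ((torIso i N A).hom z)
  obtain ⟨s, hs⟩ := exists_finset_rTensor_eq_zero (R := R) (A := A)
    (P := (projectiveResolution (ModuleCat.of R N)).complex.X i) ((K A).iCycles i c)
  refine ⟨s, fun B _ _ f hf => ?_⟩
  let φ : K A ⟶ K B := (tensorResolution (ModuleCat.of R N)).map (ModuleCat.ofHom f)
  have h0 : HomologicalComplex.cyclesMap φ i c = 0 := by
    apply (ModuleCat.mono_iff_injective ((K B).iCycles i)).1 inferInstance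
    rw [map_zero, ← ModuleCat.comp_apply, HomologicalComplex.cyclesMap_i, ModuleCat.comp_apply]
    exact hs B f hf
  have h1 : HomologicalComplex.homologyMap φ i ((K A).homologyπ i c) = 0 := by
    rw [← ModuleCat.comp_apply, HomologicalComplex.homologyπ_naturality, ModuleCat.comp_apply,
      h0, map_zero]
  have h2 : torMap i N f z =
      (torIso i N B).inv (HomologicalComplex.homologyMap φ i ((torIso i N A).hom z)) :=
    LinearMap.congr_fun (torMap_eq i N f) z
  rw [h2, ← hc, h1, map_zero]

lemma exactAt_tensorResolution (A N : ModuleCat.{u} R) [Module.Flat R A] (i : ℕ) :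
    ((tensorResolution N).obj A).ExactAt (i + 1) := by
  rw [HomologicalComplex.exactAt_iff' _ (i + 2) (i + 1) i (by simp) (by simp),
    ShortComplex.ShortExact.moduleCat_exact_iff_function_exact]
  have h := (ShortComplex.ShortExact.moduleCat_exact_iff_function_exact _).1
    ((projectiveResolution N).exact_succ i)
  exact Module.Flat.lTensor_exact A h

lemma subsingleton_tor_succ_of_flat [Module.Flat R A] : Subsingleton (TorM R (i + 1) A N) := by
  have := ModuleCat.subsingleton_of_isZero
    (exactAt_tensorResolution (ModuleCat.of R A) (ModuleCat.of R N) i).isZero_homology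
  exact (torIso (i + 1) N A).toLinearEquiv.injective.subsingleton

/-- `Tor₀` is the tensor product. -/
noncomputable def torZeroIso (A : Type u) [AddCommGroup A] [Module R A] :
    TorM R 0 A N ≅ ModuleCat.of R (TensorProduct R A N) :=
  (((MonoidalCategory.tensoringLeft (ModuleCat.{u} R)).obj
    (ModuleCat.of R A)).leftDerivedZeroIsoSelf).app (ModuleCat.of R N)

open MonoidalCategory in
lemma torZeroIso_naturality (f : A →ₗ[R] B) :
    ((Tor (ModuleCat.{u} R) 0).map (ModuleCat.ofHom f)).app (ModuleCat.of R N) ≫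
      (torZeroIso N B).hom = (torZeroIso N A).hom ≫ ModuleCat.ofHom (f.rTensor N) := by
  let P := projectiveResolution (ModuleCat.of R N)
  let FA := (tensoringLeft (ModuleCat.{u} R)).obj (ModuleCat.of R A)
  let FB := (tensoringLeft (ModuleCat.{u} R)).obj (ModuleCat.of R B)
  let α : FA ⟶ FB := (tensoringLeft (ModuleCat.{u} R)).map (ModuleCat.ofHom f)
  change (NatTrans.leftDerived α 0).app (ModuleCat.of R N) ≫
    FB.fromLeftDerivedZero.app (ModuleCat.of R N) =
    FA.fromLeftDerivedZero.app (ModuleCat.of R N) ≫ α.app (ModuleCat.of R N)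
  rw [P.fromLeftDerivedZero_eq, P.fromLeftDerivedZero_eq, P.leftDerived_app_eq]
  simp only [Category.assoc, Iso.inv_hom_id_assoc, Iso.cancel_iso_hom_left]
  have h : HomologicalComplex.opcyclesMap ((NatTrans.mapHomologicalComplex α _).app P.complex) 0 ≫
      P.fromLeftDerivedZero' FB = P.fromLeftDerivedZero' FA ≫ α.app (ModuleCat.of R N) := by
    rw [← cancel_epi (HomologicalComplex.pOpcycles _ _),
      HomologicalComplex.p_opcyclesMap_assoc,
      ProjectiveResolution.pOpcycles_comp_fromLeftDerivedZero',
      ProjectiveResolution.pOpcycles_comp_fromLeftDerivedZero'_assoc]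
    exact (α.naturality (P.π.f 0)).symm
  exact (HomologicalComplex.homologyι_naturality_assoc
    ((NatTrans.mapHomologicalComplex α _).app P.complex) 0 _).trans
    ((congrArg (HomologicalComplex.homologyι _ 0 ≫ ·) h).trans (Category.assoc _ _ _).symm)

end TorZeroAndFlat

section DimensionShift

variable {R : Type u} [CommRing R] (i : ℕ) {A B C : Type u} [AddCommGroup A] [Module R A]
  [AddCommGroup B] [Module R B] [AddCommGroup C] [Module R C]
  (N : Type u) [AddCommGroup N] [Module R N]

/-- An injective linear map identifies its source with the kernel of the next map in an exact
sequence. -/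
noncomputable def equivKerOfExact {X Y Z : Type*} [AddCommGroup X] [Module R X] [AddCommGroup Y]
    [Module R Y] [AddCommGroup Z] [Module R Z] {f : X →ₗ[R] Y} {g : Y →ₗ[R] Z}
    (hf : Function.Injective f) (hfg : Function.Exact f g) : X ≃ₗ[R] LinearMap.ker g :=
  LinearEquiv.ofInjective f hf ≪≫ₗ LinearEquiv.ofEq _ _ (LinearMap.exact_iff.1 hfg).symm

lemma injective_of_exact_of_subsingleton {X Y Z : Type*} [AddCommGroup X] [Module R X]
    [AddCommGroup Y] [Module R Y] [AddCommGroup Z] [Module R Z] [Subsingleton X] {f : X →ₗ[R] Y}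
    {g : Y →ₗ[R] Z} (hfg : Function.Exact f g) : Function.Injective g := by
  rw [injective_iff_map_eq_zero]
  intro y hy
  obtain ⟨x, rfl⟩ := (hfg y).1 hy
  rw [Subsingleton.elim x 0, map_zero]

lemma surjective_of_exact_of_subsingleton {X Y Z : Type*} [AddCommGroup X] [Module R X]
    [AddCommGroup Y] [Module R Y] [AddCommGroup Z] [Module R Z] [Subsingleton Z] {f : X →ₗ[R] Y}
    {g : Y →ₗ[R] Z} (hfg : Function.Exact f g) : Function.Surjective f :=
  fun y => (hfg y).1 (Subsingleton.elim _ _)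

section FirstVariable

variable [Module.Flat R B] {f : A →ₗ[R] B} {g : B →ₗ[R] C} (hf : Function.Injective f)
  (hfg : Function.Exact f g) (hg : Function.Surjective g)

include hf hfg hg

lemma nonempty_tor_one_equiv_ker :
    Nonempty (TorM R 1 C N ≃ₗ[R] LinearMap.ker (f.rTensor N)) := by
  obtain ⟨-, δ, hδ⟩ := exists_tor_connecting N hf hfg hg
  have := subsingleton_tor_succ_of_flat (R := R) (A := B) 0 N
  have hnat : (torZeroIso N B).toLinearEquiv.toLinearMap ∘ₗ torMap 0 N f =
      f.rTensor N ∘ₗ (torZeroIso N A).toLinearEquiv.toLinearMap :=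
    congrArg ModuleCat.Hom.hom (torZeroIso_naturality N f)
  refine ⟨equivKerOfExact (f := (torZeroIso N A).toLinearEquiv.toLinearMap ∘ₗ δ 0)
    ((torZeroIso N A).toLinearEquiv.injective.comp
      (injective_of_exact_of_subsingleton (hδ 0).1)) fun x => ?_⟩
  obtain ⟨x, rfl⟩ := (torZeroIso N A).toLinearEquiv.surjective x
  have h1 : f.rTensor N ((torZeroIso N A).toLinearEquiv x) =
    (torZeroIso N B).toLinearEquiv (torMap 0 N f x) := (LinearMap.congr_fun hnat x).symm
  rw [h1, LinearEquiv.map_eq_zero_iff, (hδ 0).2 x]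
  exact exists_congr fun y => ((torZeroIso N A).toLinearEquiv.injective.eq_iff).symm

lemma nonempty_tor_add_two_equiv :
    Nonempty (TorM R (i + 2) C N ≃ₗ[R] TorM R (i + 1) A N) := by
  obtain ⟨-, δ, hδ⟩ := exists_tor_connecting N hf hfg hg
  have := subsingleton_tor_succ_of_flat (R := R) (A := B) i N
  have := subsingleton_tor_succ_of_flat (R := R) (A := B) (i + 1) N
  exact ⟨LinearEquiv.ofBijective (δ (i + 1))
    ⟨injective_of_exact_of_subsingleton (hδ (i + 1)).1,
      surjective_of_exact_of_subsingleton (hδ (i + 1)).2⟩⟩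

end FirstVariable

/-- The projective resolution obtained by augmenting a complex of projective modules. -/
noncomputable def augmentedResolution {B C : ModuleCat.{u} R} [hB : Projective B]
    (K : ChainComplex (ModuleCat.{u} R) ℕ) (hK : ∀ n, Projective (K.X n))
    (e : K.X 0 ⟶ B) (w : K.d 1 0 ≫ e = 0) (g : B ⟶ C) (hg : Function.Surjective g.hom)
    (heg : Function.Exact e.hom g.hom) (hde : Function.Exact (K.d 1 0).hom e.hom)
    (hd : ∀ n, Function.Exact (K.d (n + 2) (n + 1)).hom (K.d (n + 1) n).hom) :
    ProjectiveResolution C where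
  complex := ChainComplex.augment K e w
  projective n := by
    cases n with
    | zero => exact hB
    | succ n => exact hK n
  π := (ChainComplex.toSingle₀Equiv _ _).symm ⟨g, by
    rw [ChainComplex.augment_d_one_zero]
    exact ModuleCat.hom_ext heg.linearMap_comp_eq_zero⟩
  quasiIso := ⟨fun n => by
    cases n with
    | zero =>
      rw [ChainComplex.quasiIsoAt₀_iff, ShortComplex.quasiIso_iff_of_zeros']
      · refine ⟨?_, (ModuleCat.epi_iff_surjective _).2 ?_⟩
        · rw [ShortComplex.ShortExact.moduleCat_exact_iff_function_exact]
          exact heg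
        · exact hg
      all_goals rfl
    | succ n =>
      rw [quasiIsoAt_iff_exactAt' _ _ (ChainComplex.exactAt_succ_single_obj _ _),
        HomologicalComplex.exactAt_iff' _ (n + 2) (n + 1) n (by simp) (by simp),
        ShortComplex.ShortExact.moduleCat_exact_iff_function_exact]
      cases n with
      | zero => exact hde
      | succ n => exact hd n⟩

end DimensionShift

section Symmetry

variable {R : Type u} [CommRing R] (i : ℕ) {A B C : Type u} [AddCommGroup A] [Module R A]
  [AddCommGroup B] [Module R B] [AddCommGroup C] [Module R C]
  (M : Type u) [AddCommGroup M] [Module R M]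

lemma exact_projectiveResolution_π (A : ModuleCat.{u} R) :
    Function.Exact ((projectiveResolution A).complex.d 1 0).hom
      ((projectiveResolution A).π.f 0).hom :=
  (ShortComplex.ShortExact.moduleCat_exact_iff_function_exact _).1 (projectiveResolution A).exact₀

lemma surjective_projectiveResolution_π (A : ModuleCat.{u} R) :
    Function.Surjective ((projectiveResolution A).π.f 0).hom :=
  (ModuleCat.epi_iff_surjective ((projectiveResolution A).π.f 0)).1 inferInstance

/-- The resolution of the cokernel of `f : A → B` obtained by splicing a resolution of `A`
with `f`. -/
noncomputable def splicedResolution [Module.Projective R B] {f : A →ₗ[R] B} {g : B →ₗ[R] C}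
    (hf : Function.Injective f) (hfg : Function.Exact f g) (hg : Function.Surjective g) :
    ProjectiveResolution (ModuleCat.of R C) :=
  augmentedResolution (B := ModuleCat.of R B) (C := ModuleCat.of R C)
    (hB := (IsProjective.iff_projective _).1 inferInstance)
    (projectiveResolution (ModuleCat.of R A)).complex
    (projectiveResolution (ModuleCat.of R A)).projective
    (ModuleCat.ofHom (f ∘ₗ ((projectiveResolution (ModuleCat.of R A)).π.f 0).hom))
    (ModuleCat.hom_ext (LinearMap.ext fun x => (congrArg f
      ((exact_projectiveResolution_π (ModuleCat.of R A)).apply_apply_eq_zero x)).trans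
        (map_zero f)))
    (ModuleCat.ofHom g) hg
    (by
      intro y
      refine (hfg y).trans ⟨?_, ?_⟩
      · rintro ⟨x, rfl⟩
        obtain ⟨z, rfl⟩ := surjective_projectiveResolution_π (ModuleCat.of R A) x
        exact ⟨z, rfl⟩
      · rintro ⟨z, rfl⟩
        exact ⟨_, rfl⟩)
    (by
      intro y
      refine Iff.trans ?_ (exact_projectiveResolution_π (ModuleCat.of R A) y)
      exact map_eq_zero_iff f hf)
    fun n => (ShortComplex.ShortExact.moduleCat_exact_iff_function_exact _).1
      ((projectiveResolution (ModuleCat.of R A)).exact_succ n)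

section

variable [Module.Projective R B] {f : A →ₗ[R] B} {g : B →ₗ[R] C} (hf : Function.Injective f)
  (hfg : Function.Exact f g) (hg : Function.Surjective g)

include hf hfg hg

open MonoidalCategory in
lemma nonempty_tor_one_right_equiv_ker :
    Nonempty (TorM R 1 M C ≃ₗ[R] LinearMap.ker (f.lTensor M)) := by
  let F := (tensoringLeft (ModuleCat.{u} R)).obj (ModuleCat.of R M)
  let Q := projectiveResolution (ModuleCat.of R A)
  let P := splicedResolution hf hfg hg
  let e : TorM R 1 M C ≅ _ := P.isoLeftDerivedObj F 1 ≪≫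
    HomologicalComplex.homologyIsoSc' ((F.mapHomologicalComplex _).obj P.complex) 2 1 0
      (by simp) (by simp)
  let b : TensorProduct R M (Q.complex.X 0) →ₗ[R] TensorProduct R M A :=
    LinearMap.lTensor M (Q.π.f 0).hom
  have hb : Function.Exact (LinearMap.lTensor M (Q.complex.d 1 0).hom) b :=
    lTensor_exact M (exact_projectiveResolution_π _) (surjective_projectiveResolution_π _)
  let S : ShortComplex (ModuleCat.{u} R) := ShortComplex.mk
    (ModuleCat.ofHom (LinearMap.lTensor M (Q.complex.d 1 0).hom))
    (ModuleCat.ofHom (f.lTensor M ∘ₗ b)) (ModuleCat.hom_ext (LinearMap.ext fun x =>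
      (congrArg (f.lTensor M) (hb.apply_apply_eq_zero x)).trans (map_zero _)))
  let s : HomologicalComplex.sc' ((F.mapHomologicalComplex _).obj P.complex) 2 1 0 ≅ S :=
    ShortComplex.isoMk (Iso.refl (F.obj (Q.complex.X 1)))
      (Iso.refl (F.obj (Q.complex.X 0))) (Iso.refl (F.obj (ModuleCat.of R B)))
      ((Category.id_comp _).trans (Category.comp_id _).symm)
      ((Category.id_comp _).trans ((congrArg ModuleCat.ofHom
        (LinearMap.lTensor_comp M f (Q.π.f 0).hom).symm).trans (Category.comp_id _).symm))
  exact ⟨(e ≪≫ ShortComplex.homologyMapIso s).toLinearEquiv ≪≫ₗ homologyEquivKer S b (f.lTensor M)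
    (LinearMap.lTensor_surjective M (surjective_projectiveResolution_π _)) hb rfl⟩

open MonoidalCategory in
lemma nonempty_tor_add_two_right_equiv :
    Nonempty (TorM R (i + 2) M C ≃ₗ[R] TorM R (i + 1) M A) := by
  let F := (tensoringLeft (ModuleCat.{u} R)).obj (ModuleCat.of R M)
  let Q := projectiveResolution (ModuleCat.of R A)
  let P := splicedResolution hf hfg hg
  let e : TorM R (i + 2) M C ≅ _ := P.isoLeftDerivedObj F (i + 2) ≪≫
    HomologicalComplex.homologyIsoSc' ((F.mapHomologicalComplex _).obj P.complex)
      (i + 3) (i + 2) (i + 1) (by simp) (by simp)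
  let e' : TorM R (i + 1) M A ≅ _ := Q.isoLeftDerivedObj F (i + 1) ≪≫
    HomologicalComplex.homologyIsoSc' ((F.mapHomologicalComplex _).obj Q.complex)
      (i + 2) (i + 1) i (by simp) (by simp)
  let K := (F.mapHomologicalComplex (ComplexShape.down ℕ)).obj P.complex
  let L := (F.mapHomologicalComplex (ComplexShape.down ℕ)).obj Q.complex
  let s : K.sc' (i + 3) (i + 2) (i + 1) ≅ L.sc' (i + 2) (i + 1) i :=
    ShortComplex.isoMk (Iso.refl (F.obj (Q.complex.X (i + 2))))
      (Iso.refl (F.obj (Q.complex.X (i + 1)))) (Iso.refl (F.obj (Q.complex.X i)))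
      ((Category.id_comp _).trans (Category.comp_id _).symm)
      ((Category.id_comp _).trans (Category.comp_id _).symm)
  exact ⟨(e ≪≫ ShortComplex.homologyMapIso s ≪≫ e'.symm).toLinearEquiv⟩

end

/-- `Tor` is symmetric in its two arguments. -/
lemma nonempty_tor_comm (M N : Type u) [AddCommGroup M] [Module R M] [AddCommGroup N]
    [Module R N] : Nonempty (TorM R i M N ≃ₗ[R] TorM R i N M) := by
  induction i generalizing M with
  | zero => exact ⟨(torZeroIso N M).toLinearEquiv ≪≫ₗ TensorProduct.comm R M N ≪≫ₗ
      (torZeroIso M N).symm.toLinearEquiv⟩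
  | succ i ih =>
    let g : (M →₀ R) →ₗ[R] M := Finsupp.linearCombination R id
    have hg : Function.Surjective g := Finsupp.linearCombination_id_surjective R M
    have hf : Function.Injective (LinearMap.ker g).subtype := (LinearMap.ker g).injective_subtype
    have hfg : Function.Exact (LinearMap.ker g).subtype g := LinearMap.exact_subtype_ker_map g
    cases i with
    | zero =>
      obtain ⟨e₁⟩ := nonempty_tor_one_equiv_ker (A := LinearMap.ker g) N hf hfg hg
      obtain ⟨e₂⟩ := nonempty_tor_one_right_equiv_ker (A := LinearMap.ker g) N hf hfg hg
      refine ⟨e₁ ≪≫ₗ LinearEquiv.ofSubmodules (TensorProduct.comm R _ N) _ _ ?_ ≪≫ₗ e₂.symm⟩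
      rw [← LinearMap.comm_comp_rTensor_comp_comm_eq]
      ext x
      simp [Submodule.mem_map_equiv]
    | succ i =>
      obtain ⟨e₁⟩ := nonempty_tor_add_two_equiv (A := LinearMap.ker g) i N hf hfg hg
      obtain ⟨e₂⟩ := nonempty_tor_add_two_right_equiv (A := LinearMap.ker g) i N hf hfg hg
      obtain ⟨e⟩ := ih (LinearMap.ker g)
      exact ⟨e₁ ≪≫ₗ e ≪≫ₗ e₂.symm⟩

end Symmetry

section Vanishing

variable {R : Type u} [CommRing R] (i : ℕ) {A B C : Type u} [AddCommGroup A] [Module R A]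
  [AddCommGroup B] [Module R B] [AddCommGroup C] [Module R C]
  {N : Type u} [AddCommGroup N] [Module R N]

lemma subsingleton_tor_comm (h : Subsingleton (TorM R i A N)) : Subsingleton (TorM R i N A) := by
  obtain ⟨e⟩ := nonempty_tor_comm (R := R) i A N
  exact e.symm.injective.subsingleton

lemma torMap_smul_id_apply (r : R) (z : TorM R i A N) :
    torMap i N (r • (LinearMap.id : A →ₗ[R] A)) z = r • z := by
  rw [torMap_smul, torMap_id]
  rfl

lemma bijective_smul_tor_left {r : R} (h : Function.Bijective fun a : A => r • a) :
    Function.Bijective fun z : TorM R i A N => r • z := by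
  have := (torCongr i N (LinearEquiv.ofBijective (r • LinearMap.id : A →ₗ[R] A) h)).bijective
  convert this using 1
  ext z
  exact (torMap_smul_id_apply i r z).symm

lemma bijective_smul_tor_right {r : R} (h : Function.Bijective fun x : N => r • x) :
    Function.Bijective fun z : TorM R i A N => r • z := by
  obtain ⟨e⟩ := nonempty_tor_comm (R := R) i A N
  convert e.symm.bijective.comp ((bijective_smul_tor_left (N := A) i h).comp e.bijective) using 1
  ext z
  simp

lemma exists_smul_tor_eq_zero (P : Submonoid R) (h : ∀ a : A, ∃ r ∈ P, r • a = 0)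
    (z : TorM R i A N) : ∃ r ∈ P, r • z = 0 := by
  classical
  obtain ⟨s, hs⟩ := exists_finset_torMap_eq_zero i N z
  choose r hrP hr using h
  refine ⟨∏ a ∈ s, r a, P.prod_mem fun a _ => hrP a, ?_⟩
  rw [← torMap_smul_id_apply]
  refine hs A _ fun a ha => ?_
  rw [LinearMap.smul_apply, LinearMap.id_apply, ← Finset.prod_erase_mul s r ha, mul_smul, hr,
    smul_zero]

/-- `Tor` vanishes if each element of the first variable is killed by a scalar acting bijectively
on the second variable. -/
lemma subsingleton_tor_of_forall_exists_smul_eq_zero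
    (h : ∀ a : A, ∃ r : R, r • a = 0 ∧ Function.Bijective fun x : N => r • x) :
    Subsingleton (TorM R i A N) := by
  refine subsingleton_of_forall_eq 0 fun z => ?_
  obtain ⟨r, hr, hz⟩ := exists_smul_tor_eq_zero i
    ((IsUnit.submonoid (Module.End R N)).comap (algebraMap R (Module.End R N)))
    (fun a => (h a).imp fun r hr => ⟨(Module.End.isUnit_iff _).2 hr.2, hr.1⟩) z
  exact (bijective_smul_tor_right (A := A) i ((Module.End.isUnit_iff _).1 hr)).1
    (hz.trans (smul_zero _).symm)

variable (N)

lemma subsingleton_tor_of_subsingleton [Subsingleton A] : Subsingleton (TorM R i A N) :=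
  subsingleton_tor_of_forall_exists_smul_eq_zero i fun a =>
    ⟨1, Subsingleton.elim _ _, by simp [Function.bijective_id, ← Function.id_def]⟩

section LongExactSequence

variable {f : A →ₗ[R] B} {g : B →ₗ[R] C} (hf : Function.Injective f)
  (hfg : Function.Exact f g) (hg : Function.Surjective g)

include hf hfg hg

lemma subsingleton_tor_middle (hA : ∀ i, Subsingleton (TorM R i A N))
    (hC : ∀ i, Subsingleton (TorM R i C N)) : Subsingleton (TorM R i B N) :=
  have := hA i
  have := hC i
  (injective_of_exact_of_subsingleton
    ((exists_tor_connecting N hf hfg hg).1 i)).subsingleton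

lemma bijective_torMap_left (hC : ∀ i, Subsingleton (TorM R i C N)) :
    Function.Bijective (torMap i N f) := by
  obtain ⟨h, δ, hδ⟩ := exists_tor_connecting N hf hfg hg
  have := hC i
  have := hC (i + 1)
  exact ⟨injective_of_exact_of_subsingleton (hδ i).2,
    surjective_of_exact_of_subsingleton (h i)⟩

lemma bijective_torMap_right (hA : ∀ i, Subsingleton (TorM R i A N)) :
    Function.Bijective (torMap i N g) := by
  obtain ⟨h, δ, hδ⟩ := exists_tor_connecting N hf hfg hg
  have := hA i
  refine ⟨injective_of_exact_of_subsingleton (h i), ?_⟩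
  cases i with
  | zero =>
    have hnat (x) : (torZeroIso N C).toLinearEquiv (torMap 0 N g x) =
        g.rTensor N ((torZeroIso N B).toLinearEquiv x) :=
      LinearMap.congr_fun (congrArg ModuleCat.Hom.hom (torZeroIso_naturality N g)) x
    intro y
    obtain ⟨x, hx⟩ := LinearMap.rTensor_surjective N hg ((torZeroIso N C).toLinearEquiv y)
    refine ⟨(torZeroIso N B).toLinearEquiv.symm x, (torZeroIso N C).toLinearEquiv.injective ?_⟩
    rw [hnat, LinearEquiv.apply_symm_apply, hx]
  | succ i =>
    have := hA i
    exact surjective_of_exact_of_subsingleton (hδ i).1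

end LongExactSequence

section DirectSum

variable {ι : Type u} {S : ι → Type u} [∀ q, AddCommGroup (S q)] [∀ q, Module R (S q)]

lemma exists_finset_tor_directSum [DecidableEq ι] (z : TorM R i (⨁ q, S q) N) :
    ∃ s : Finset ι, z = ∑ q ∈ s, torMap i N (DirectSum.lof R ι S q)
      (torMap i N (DirectSum.component R ι S q) z) := by
  obtain ⟨t, ht⟩ := exists_finset_torMap_eq_zero i N z
  classical
  let s := t.biUnion fun x => DFinsupp.support x
  refine ⟨s, ?_⟩
  let φ : (⨁ q, S q) →ₗ[R] (⨁ q, S q) :=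
    ∑ q ∈ s, DirectSum.lof R ι S q ∘ₗ DirectSum.component R ι S q
  have hφ : ∀ x ∈ t, (LinearMap.id + (-1 : R) • φ : (⨁ q, S q) →ₗ[R] (⨁ q, S q)) x = 0 := by
    intro x hx
    have : φ x = x := by
      simp only [φ, LinearMap.sum_apply, LinearMap.comp_apply]
      refine (Finset.sum_subset (Finset.subset_biUnion_of_mem _ hx) fun q _ hq => ?_).symm.trans
        (DirectSum.sum_support_of x)
      rw [← DirectSum.apply_eq_component, DFinsupp.notMem_support_iff.1 hq, map_zero]
    simp [this]
  have h := ht _ _ hφ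
  let T : ((⨁ q, S q) →ₗ[R] (⨁ q, S q)) →+ (TorM R i (⨁ q, S q) N →ₗ[R] TorM R i (⨁ q, S q) N) :=
    AddMonoidHom.mk' (torMap i N) (torMap_add i N)
  have hT : torMap i N φ = ∑ q ∈ s, torMap i N (DirectSum.lof R ι S q) ∘ₗ
      torMap i N (DirectSum.component R ι S q) := by
    simp only [← torMap_comp]
    exact map_sum T _ s
  rw [torMap_add, torMap_smul, torMap_id, hT] at h
  simpa [← sub_eq_add_neg, sub_eq_zero] using h

lemma subsingleton_tor_directSum (h : ∀ q, Subsingleton (TorM R i (S q) N)) :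
    Subsingleton (TorM R i (⨁ q, S q) N) := by
  classical
  refine subsingleton_of_forall_eq 0 fun z => ?_
  obtain ⟨s, hs⟩ := exists_finset_tor_directSum i N z
  rw [hs]
  refine Finset.sum_eq_zero fun q _ => ?_
  rw [Subsingleton.elim (torMap i N (DirectSum.component R ι S q) z) 0, map_zero]

lemma nonempty_tor_directSum_equiv (p : ι) (h : ∀ q ≠ p, Subsingleton (TorM R i (S q) N)) :
    Nonempty (TorM R i (⨁ q, S q) N ≃ₗ[R] TorM R i (S p) N) := by
  classical
  have hπ : torMap i N (DirectSum.component R ι S p) ∘ₗ torMap i N (DirectSum.lof R ι S p) =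
      LinearMap.id := by
    rw [← torMap_comp, ← torMap_id]
    congr 1
    ext x
    simp
  refine ⟨LinearEquiv.ofBijective (torMap i N (DirectSum.component R ι S p)) ⟨?_, fun y =>
    ⟨torMap i N (DirectSum.lof R ι S p) y, LinearMap.congr_fun hπ y⟩⟩⟩
  rw [injective_iff_map_eq_zero]
  intro z hz
  obtain ⟨s, hs⟩ := exists_finset_tor_directSum i N z
  rw [hs]
  refine Finset.sum_eq_zero fun q _ => ?_
  by_cases hq : q = p
  · rw [hq, hz, map_zero]
  · have := h q hq
    rw [Subsingleton.elim (torMap i N (DirectSum.component R ι S q) z) 0, map_zero]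

end DirectSum

end Vanishing

section Filtration

variable {R : Type u} [CommRing R] (i : ℕ) {N : Type u} [AddCommGroup N] [Module R N]
  (A : Type u) [AddCommGroup A] [Module R A] {t : ℕ} {F : Fin (t + 1) → Submodule R N}
  (hF : Antitone F) (hlast : F (Fin.last t) = ⊥)

lemma exact_inclusion_mkQ_comap_subtype {P Q : Submodule R N} (h : P ≤ Q) :
    Function.Exact (Submodule.inclusion h) (Submodule.comap Q.subtype P).mkQ := by
  rw [LinearMap.exact_iff, Submodule.ker_mkQ, Submodule.range_inclusion]

include hF hlast

lemma subsingleton_tor_filtration (k : Fin (t + 1))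
    (h : ∀ j : Fin t, k ≤ j.castSucc → ∀ i, Subsingleton
      (TorM R i (F j.castSucc ⧸ Submodule.comap (F j.castSucc).subtype (F j.succ)) A)) :
    Subsingleton (TorM R i (F k) A) := by
  induction k using Fin.reverseInduction generalizing i with
  | last =>
    rw [hlast]
    exact subsingleton_tor_of_subsingleton i A
  | cast j ih =>
    have hle := hF (Fin.castSucc_lt_succ (i := j)).le
    exact subsingleton_tor_middle i A (Submodule.inclusion_injective hle)
      (exact_inclusion_mkQ_comap_subtype hle) (Submodule.mkQ_surjective _)
      (fun i => ih i fun j' hj' => h j' (Fin.castSucc_lt_succ.le.trans hj')) (h j le_rfl)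

lemma nonempty_tor_filtration_equiv (k : Fin (t + 1)) (j : Fin t) (hk : k ≤ j.castSucc)
    (h : ∀ j' ≠ j, ∀ i, Subsingleton
      (TorM R i (F j'.castSucc ⧸ Submodule.comap (F j'.castSucc).subtype (F j'.succ)) A)) :
    Nonempty (TorM R i (F k) A ≃ₗ[R]
      TorM R i (F j.castSucc ⧸ Submodule.comap (F j.castSucc).subtype (F j.succ)) A) := by
  induction k using Fin.reverseInduction with
  | last => exact absurd hk (Fin.castSucc_lt_last j).not_ge
  | cast l ih =>
    have hle := hF (Fin.castSucc_lt_succ (i := l)).le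
    have hinj := Submodule.inclusion_injective hle
    have hex := exact_inclusion_mkQ_comap_subtype hle
    by_cases hl : l = j
    · subst hl
      exact ⟨LinearEquiv.ofBijective _ (bijective_torMap_right i A hinj hex
        (Submodule.mkQ_surjective _) fun i => subsingleton_tor_filtration i A hF hlast _
          fun j' hj' => h j' fun hj => (Fin.castSucc_lt_succ.trans_le hj').ne (by rw [hj]))⟩
    · obtain ⟨e⟩ := ih (Fin.succ_le_castSucc_iff.2
        (lt_of_le_of_ne (Fin.castSucc_le_castSucc_iff.1 hk) hl))
      exact ⟨(LinearEquiv.ofBijective _ (bijective_torMap_left i A hinj hex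
        (Submodule.mkQ_surjective _) (h l hl))).symm ≪≫ₗ e⟩

end Filtration

section PropT

variable {R : Type u} [CommRing R] (i : ℕ)

lemma subsingleton_tor_of_propT_of_ne {A N : Type u} [AddCommGroup A] [Module R A]
    [AddCommGroup N] [Module R N] {p q : Ideal R} (hp : p.IsPrime) (hq : q.IsPrime) (hpq : p ≠ q)
    (hA : PropT R p A) (hN : PropT R q N) : Subsingleton (TorM R i A N) := by
  have key {A N : Type u} [AddCommGroup A] [Module R A] [AddCommGroup N] [Module R N]
      {p q : Ideal R} (hq : q.IsPrime) (hpq : ¬ p ≤ q)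
      (hA : PropT R p A) (hN : PropT R q N) : Subsingleton (TorM R i A N) := by
    obtain ⟨r, hrp, hrq⟩ := SetLike.not_le_iff_exists.1 hpq
    refine subsingleton_tor_of_forall_exists_smul_eq_zero i fun a => ?_
    obtain ⟨m, -, hm⟩ := hA.2 a
    exact ⟨r ^ m, hm _ (Ideal.pow_mem_pow hrp m), hN.1 _ fun h => hrq (hq.mem_of_pow_mem m h)⟩
  by_cases h : p ≤ q
  · exact subsingleton_tor_comm i (key hp (fun h' => hpq (h.antisymm h')) hN hA)
  · exact key hq h hA hN

lemma propT_residueField (p : Ideal R) [p.IsPrime] : PropT R p p.ResidueField := by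
  refine ⟨fun r hr => ?_, fun x => ⟨1, one_pos, fun a ha => ?_⟩⟩
  · have hr' : algebraMap R p.ResidueField r ≠ 0 := by
      rwa [Ne, Ideal.algebraMap_residueField_eq_zero]
    simpa only [Algebra.smul_def] using mulLeft_bijective₀ _ hr'
  · rw [pow_one] at ha
    rw [Algebra.smul_def, Ideal.algebraMap_residueField_eq_zero.2 ha, zero_mul]

/-- The exact sequence `0 → R ⧸ (I : x) → R ⧸ I → R ⧸ (I + (x)) → 0`. -/
lemma exists_exact_quotient_colon {I J : Ideal R} (x : R) (hJ : ∀ y, y ∈ J ↔ x * y ∈ I) :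
    ∃ (f : (R ⧸ J) →ₗ[R] (R ⧸ I)) (g : (R ⧸ I) →ₗ[R] (R ⧸ (I ⊔ Ideal.span {x}))),
      (∀ y : R, f (Ideal.Quotient.mk J y) = x • Ideal.Quotient.mk I y) ∧
      Function.Injective f ∧ Function.Exact f g ∧ Function.Surjective g := by
  refine ⟨Submodule.mapQ J I (LinearMap.mulLeft R x) fun y hy => (hJ y).1 hy,
    Submodule.factor le_sup_left, fun y => rfl, ?_, ?_, Submodule.factor_surjective _⟩
  · rw [injective_iff_map_eq_zero]
    intro y hy
    obtain ⟨y, rfl⟩ := Ideal.Quotient.mk_surjective y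
    exact Ideal.Quotient.eq_zero_iff_mem.2 ((hJ y).2 (Ideal.Quotient.eq_zero_iff_mem.1 hy))
  · intro y
    obtain ⟨y, rfl⟩ := Ideal.Quotient.mk_surjective y
    refine Iff.trans (Ideal.Quotient.eq_zero_iff_mem (I := I ⊔ Ideal.span {x}) (a := y)) ?_
    rw [Submodule.mem_sup]
    constructor
    · rintro ⟨a, ha, b, hb, rfl⟩
      obtain ⟨c, rfl⟩ := Ideal.mem_span_singleton'.1 hb
      refine ⟨Ideal.Quotient.mk J c, Ideal.Quotient.eq.2 ?_⟩
      have : x • c - (a + c * x) = -a := by rw [smul_eq_mul]; ring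
      exact this ▸ I.neg_mem ha
    · rintro ⟨c, hc⟩
      obtain ⟨c, rfl⟩ := Ideal.Quotient.mk_surjective c
      have h : x * c - y ∈ I := Ideal.Quotient.eq.1 hc
      exact ⟨-(x * c - y), I.neg_mem h, c * x,
        Ideal.mul_mem_left _ _ (Ideal.mem_span_singleton_self x), by ring⟩

variable {S : Type u} [AddCommGroup S] [Module R S]

lemma subsingleton_tor_quotient_of_residueField {q : Ideal R} [q.IsPrime] (hS : PropT R q S)
    (h : ∀ i, Subsingleton (TorM R i q.ResidueField S)) : Subsingleton (TorM R i (R ⧸ q) S) := by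
  have hker : LinearMap.ker (Algebra.linearMap R q.ResidueField) = q :=
    Submodule.ext fun r => Ideal.algebraMap_residueField_eq_zero
  let f : (R ⧸ q) →ₗ[R] q.ResidueField := q.liftQ (Algebra.linearMap R q.ResidueField) hker.ge
  have hf : Function.Injective f :=
    LinearMap.ker_eq_bot.1 (Submodule.ker_liftQ_eq_bot _ _ _ hker.le)
  refine (bijective_torMap_left i S hf (LinearMap.exact_map_mkQ_range f)
    (Submodule.mkQ_surjective _) fun i => ?_).1.subsingleton
  refine subsingleton_tor_of_forall_exists_smul_eq_zero i fun c => ?_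
  obtain ⟨c, rfl⟩ := Submodule.mkQ_surjective _ c
  obtain ⟨c, rfl⟩ := IsLocalRing.residue_surjective c
  obtain ⟨⟨a, s⟩, hs⟩ := IsLocalization.surj q.primeCompl c
  refine ⟨s, ?_, hS.1 s s.2⟩
  rw [← map_smul, Submodule.mkQ_apply, Submodule.Quotient.mk_eq_zero]
  refine ⟨Ideal.Quotient.mk q a, ?_⟩
  have := congrArg (IsLocalRing.residue (Localization.AtPrime q)) hs
  rw [map_mul, mul_comm] at this
  exact this.symm.trans (Algebra.smul_def (s : R) (IsLocalRing.residue _ c)).symm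

/-- Over a noetherian ring, the derived fibre at `q` detects modules with property `t(q)`. -/
lemma subsingleton_of_tor_residueField [IsNoetherianRing R] {q : Ideal R} [q.IsPrime]
    (hS : PropT R q S) (h : ∀ i, Subsingleton (TorM R i q.ResidueField S)) : Subsingleton S := by
  have hI : ∀ I : Ideal R, ∀ i, Subsingleton (TorM R i (R ⧸ I) S) := by
    intro I
    induction I using WellFoundedGT.induction with
    | ind I ih =>
    have hsup {x : R} (hx : x ∉ I) (i : ℕ) :
        Subsingleton (TorM R i (R ⧸ (I ⊔ Ideal.span {x})) S) :=
      ih _ (left_lt_sup.2 fun hle => hx (hle (Ideal.mem_span_singleton_self x))) i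
    intro i
    by_cases htop : I = ⊤
    · have := Ideal.Quotient.subsingleton_iff.2 htop
      exact subsingleton_tor_of_subsingleton i S
    by_cases hprime : I.IsPrime
    swap
    · obtain ⟨a, ha, b, hb, hab⟩ := (Ideal.not_isPrime_iff.1 hprime).resolve_left htop
      obtain ⟨f, g, -, hf, hfg, hg⟩ := exists_exact_quotient_colon (I := I)
        (J := Submodule.comap (LinearMap.mulLeft R a) I) a fun y => Iff.rfl
      refine subsingleton_tor_middle i S hf hfg hg (ih _ (lt_of_le_of_ne ?_ ?_)) (hsup ha)
      · exact fun y hy => I.mul_mem_left a hy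
      · exact fun heq => hb (heq ▸ hab)
    by_cases hIq : I ≤ q
    swap
    · obtain ⟨r, hrI, hrq⟩ := SetLike.not_le_iff_exists.1 hIq
      refine subsingleton_tor_of_forall_exists_smul_eq_zero i fun y => ⟨r, ?_, hS.1 r hrq⟩
      obtain ⟨y, rfl⟩ := Ideal.Quotient.mk_surjective y
      exact Ideal.Quotient.eq_zero_iff_mem.2 (I.mul_mem_right y hrI)
    by_cases heq : I = q
    · subst heq
      exact subsingleton_tor_quotient_of_residueField i hS h
    obtain ⟨x, hxq, hxI⟩ := SetLike.exists_of_lt (lt_of_le_of_ne hIq heq)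
    obtain ⟨f, g, hfx, hf, hfg, hg⟩ := exists_exact_quotient_colon (I := I) (J := I) x
      fun y => ⟨I.mul_mem_left x, fun hy => (hprime.mem_or_mem hy).resolve_left hxI⟩
    have hfx : f = x • LinearMap.id := by
      ext
      exact hfx 1
    have hbij := bijective_torMap_left i S hf hfg hg (hsup hxI)
    have hpow (n : ℕ) (z : TorM R i (R ⧸ I) S) (hz : x ^ n • z = 0) : z = 0 := by
      induction n with
      | zero => simpa using hz
      | succ n ihn =>
        refine ihn (hbij.1 ?_)
        rw [map_zero, hfx, torMap_smul_id_apply, ← mul_smul, ← pow_succ', hz]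
    refine subsingleton_of_forall_eq 0 fun z => ?_
    obtain ⟨e⟩ := nonempty_tor_comm (R := R) i (R ⧸ I) S
    obtain ⟨_, ⟨n, rfl⟩, hn⟩ := exists_smul_tor_eq_zero i (Submonoid.powers x) (fun s => by
      obtain ⟨m, -, hm⟩ := hS.2 s
      exact ⟨x ^ m, ⟨m, rfl⟩, hm _ (Ideal.pow_mem_pow hxq m)⟩) (e z)
    refine hpow n z (e.injective ?_)
    rw [map_smul, hn, map_zero]
  have := hI ⊥ 0
  let e : TorM R 0 (R ⧸ (⊥ : Ideal R)) S ≃ₗ[R] S :=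
    torCongr 0 S (Submodule.quotEquivOfEqBot ⊥ rfl) ≪≫ₗ (torZeroIso S R).toLinearEquiv ≪≫ₗ
      TensorProduct.lid R S
  exact e.symm.injective.subsingleton

end PropT

/-- Let `M` satisfy `t(p)` and let `N` have a filtration with subsequent
quotients decomposing as direct sums of modules `N_{j,q}` satisfying `t(q)`, for `q` ranging
over pairwise disjoint sets `X j` of primes. Then: (a) if `p` lies in no `X j` then
`Tor_i(M,N) = 0` for all `i`; (b) if `p ∈ X j` then `Tor_i(M,N) ≅ Tor_i(M, N_{j,p})` for
all `i`; (c) `supp_R N = {q ∈ ⋃ j, X j | N_{j,q} ≠ 0}`. -/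
theorem statement14 (R : Type u) [CommRing R] [IsNoetherianRing R]
    (M N : Type u) [AddCommGroup M] [Module R M] [AddCommGroup N] [Module R N]
    (p : Ideal R) (hp : p.IsPrime) (hM : PropT R p M)
    (t : ℕ) (X : Fin t → Set (PrimeSpectrum R))
    (hX : ∀ j j' : Fin t, j ≠ j' → Disjoint (X j) (X j'))
    (Nsub : Fin (t + 1) → Submodule R N)
    (hanti : Antitone Nsub) (hfirst : Nsub 0 = ⊤) (hlast : Nsub (Fin.last t) = ⊥)
    (Nq : (j : Fin t) → X j → Type u)
    [∀ j q, AddCommGroup (Nq j q)] [∀ j q, Module R (Nq j q)]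
    (hNq : ∀ (j : Fin t) (q : X j), PropT R (q.1.asIdeal) (Nq j q))
    (hdecomp : ∀ j : Fin t,
      Nonempty ((↥(Nsub j.castSucc) ⧸
          Submodule.comap (Nsub j.castSucc).subtype (Nsub j.succ)) ≃ₗ[R]
        (⨁ q : X j, Nq j q))) :
    ((∀ j : Fin t, (⟨p, hp⟩ : PrimeSpectrum R) ∉ X j) →
      ∀ i : ℕ, Subsingleton (TorM R i M N)) ∧
    (∀ (j : Fin t) (hj : (⟨p, hp⟩ : PrimeSpectrum R) ∈ X j),
      ∀ i : ℕ, Nonempty ((TorM R i M N) ≃ₗ[R]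
        (TorM R i M (Nq j ⟨⟨p, hp⟩, hj⟩)))) ∧
    (smallSupport R N =
      {q : PrimeSpectrum R | ∃ (j : Fin t) (hq : q ∈ X j), Nontrivial (Nq j ⟨q, hq⟩)}) := by
  have quot_zero {M : Type u} [AddCommGroup M] [Module R M] {p : PrimeSpectrum R}
      (hM : PropT R p.asIdeal M) (j : Fin t) (hj : p ∉ X j) (i : ℕ) : Subsingleton (TorM R i
        (Nsub j.castSucc ⧸ Submodule.comap (Nsub j.castSucc).subtype (Nsub j.succ)) M) := by
    obtain ⟨e⟩ := hdecomp j
    have := subsingleton_tor_directSum i M fun q : X j =>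
      subsingleton_tor_of_propT_of_ne i q.1.2 p.2
        (fun h => hj (PrimeSpectrum.ext h ▸ q.2)) (hNq j q) hM
    exact (torCongr i M e).injective.subsingleton
  have eN : N ≃ₗ[R] Nsub 0 := (LinearEquiv.ofTop _ hfirst).symm
  have vanish {M : Type u} [AddCommGroup M] [Module R M] {p : PrimeSpectrum R}
      (hM : PropT R p.asIdeal M) (hp : ∀ j, p ∉ X j) (i : ℕ) : Subsingleton (TorM R i M N) := by
    have := subsingleton_tor_filtration i M hanti hlast 0 fun j _ => quot_zero hM j (hp j)
    exact subsingleton_tor_comm i (torCongr i M eN).injective.subsingleton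
  have isom {M : Type u} [AddCommGroup M] [Module R M] {p : PrimeSpectrum R}
      (hM : PropT R p.asIdeal M) (j : Fin t) (hj : p ∈ X j) (i : ℕ) :
      Nonempty (TorM R i M N ≃ₗ[R] TorM R i M (Nq j ⟨p, hj⟩)) := by
    obtain ⟨e₁⟩ := nonempty_tor_comm (R := R) i M N
    obtain ⟨e₂⟩ := nonempty_tor_filtration_equiv i M hanti hlast 0 j (Fin.zero_le _)
      fun j' hne => quot_zero hM j' fun hj' => (hX j' j hne).le_bot ⟨hj', hj⟩
    obtain ⟨e⟩ := hdecomp j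
    obtain ⟨e₃⟩ := nonempty_tor_directSum_equiv i M (⟨p, hj⟩ : X j) fun q hq =>
      subsingleton_tor_of_propT_of_ne i q.1.2 p.2
        (fun h => hq (Subtype.ext (PrimeSpectrum.ext h))) (hNq j q) hM
    obtain ⟨e₄⟩ := nonempty_tor_comm (R := R) i (Nq j ⟨p, hj⟩) M
    exact ⟨e₁ ≪≫ₗ torCongr i M eN ≪≫ₗ e₂ ≪≫ₗ torCongr i M e ≪≫ₗ e₃ ≪≫ₗ e₄⟩
  refine ⟨vanish (p := ⟨p, hp⟩) hM, isom (p := ⟨p, hp⟩) hM, ?_⟩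
  ext q
  have hκ := propT_residueField q.asIdeal
  constructor
  · rintro ⟨i, hi⟩
    by_cases hj : ∃ j, q ∈ X j
    · obtain ⟨j, hj⟩ := hj
      obtain ⟨e⟩ := isom hκ j hj i
      refine ⟨j, hj, not_subsingleton_iff_nontrivial.1 fun hsub => ?_⟩
      have := subsingleton_tor_comm i (subsingleton_tor_of_subsingleton (R := R) i
        q.asIdeal.ResidueField (A := Nq j ⟨q, hj⟩))
      exact not_nontrivial_iff_subsingleton.2 e.injective.subsingleton hi
    · exact absurd hi (not_nontrivial_iff_subsingleton.2 (vanish hκ (not_exists.1 hj) i))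
  · rintro ⟨j, hj, hne⟩
    by_contra hq
    refine not_subsingleton_iff_nontrivial.2 hne
      (subsingleton_of_tor_residueField (hNq j ⟨q, hj⟩) fun i => ?_)
    obtain ⟨e⟩ := isom hκ j hj i
    have := not_nontrivial_iff_subsingleton.1 (not_exists.1 hq i)
    exact e.symm.injective.subsingleton
end
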